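/- (Rationality of the Igusa Poincaré series, conjectured by Borevich–Shafarevich and proved by Igusa.) Let p be a prime, d ≥ 1, and f ∈ ℤ_p[x_1,…,x_d]. Then the formal power series Q(f;t) = ∑_{m≥1} N_m(f) t^m ∈ ℚ[[t]] is rational: there exist polynomials A, B ∈ ℚ[t] with B(0) = 1 such that B(t) · Q(f;t) = A(t) as formal power series in ℚ[[t]]. -/

import Mathlib

/-- `N_m(f)`: the number of solutions of `f ≡ 0` in `(ℤ/p^mℤ)^d`. -/
noncomputable def igusaN (p : ℕ) [Fact p.Prime] (d : ℕ)
    (f : MvPolynomial (Fin d) ℤ_[p]) (m : ℕ) : ℕ :=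
  Nat.card {u : Fin d → ZMod (p ^ m) //
    MvPolynomial.eval u (MvPolynomial.map (PadicInt.toZModPow m) f) = 0}

namespace Igusa

open MeasureTheory Measure Metric Set Filter Topology
open scoped NNReal ENNReal

variable {p : ℕ} [hp : Fact p.Prime] {n : ℕ}

noncomputable instance : MeasurableSpace ℚ_[p] := borel _

instance : BorelSpace ℚ_[p] := ⟨rfl⟩

/-- The closed unit ball of `ℚ_p` as a compact set with nonempty interior. -/
noncomputable def unitBall (p : ℕ) [Fact p.Prime] : TopologicalSpace.PositiveCompacts ℚ_[p] where
  carrier := closedBall 0 1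
  isCompact' := isCompact_closedBall 0 1
  interior_nonempty' := ⟨0, ball_subset_interior_closedBall (mem_ball_self one_pos)⟩

/-- The Haar measure of `ℚ_p` with total mass one on the unit ball. -/
noncomputable def haar (p : ℕ) [Fact p.Prime] : Measure ℚ_[p] := addHaarMeasure (unitBall p)

instance : IsAddHaarMeasure (haar p) := by unfold haar; infer_instance

/-- The normalised Haar measure of the unit ball, as a measure on `ℚ_p`. -/
noncomputable def unitHaar (p : ℕ) [Fact p.Prime] : Measure ℚ_[p] :=
  (haar p).restrict (closedBall 0 1)

lemma haar_closedBall_one : haar p (closedBall 0 1) = 1 := addHaarMeasure_self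

lemma haar_closedBall_eq (a : ℚ_[p]) (r : ℝ) :
    haar p (closedBall a r) = haar p (closedBall 0 r) := by
  have : closedBall a r = (fun x => -a + x) ⁻¹' closedBall 0 r := by
    ext x; simp [dist_eq_norm, sub_eq_neg_add]
  rw [this, measure_preimage_add]

lemma exists_natCast_close (n : ℕ) {x : ℚ_[p]} (hx : ‖x‖ ≤ 1) :
    ∃ i < p ^ n, ‖x - (i : ℚ_[p])‖ ≤ (p : ℝ) ^ (-n : ℤ) := by
  let y : ℤ_[p] := ⟨x, hx⟩
  refine ⟨y.appr n, PadicInt.appr_lt _ _, ?_⟩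
  have := (PadicInt.norm_le_pow_iff_mem_span_pow _ n).2 (PadicInt.appr_spec n y)
  simpa [PadicInt.norm_def] using this

lemma norm_eq_pow_of_norm_le_one {c : ℚ_[p]} (hc : ‖c‖ ≤ 1) (h0 : c ≠ 0) :
    ∃ n : ℕ, ‖c‖ = (p : ℝ) ^ (-n : ℤ) := by
  let y : ℤ_[p] := ⟨c, hc⟩
  refine ⟨y.valuation, PadicInt.norm_eq_zpow_neg_valuation (x := y) fun h => h0 ?_⟩
  exact congrArg (fun z : ℤ_[p] => (z : ℚ_[p])) h

lemma norm_sub_le_max' (x y : ℚ_[p]) : ‖x - y‖ ≤ max ‖x‖ ‖y‖ := by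
  rw [sub_eq_add_neg, ← norm_neg y]; exact Padic.nonarchimedean _ _

lemma natCast_eq_of_close {n i j : ℕ} (hi : i < p ^ n) (hj : j < p ^ n)
    (h : ‖(i : ℚ_[p]) - j‖ ≤ (p : ℝ) ^ (-n : ℤ)) : i = j := by
  have h' : ‖((i - j : ℤ) : ℚ_[p])‖ ≤ (p : ℝ) ^ (-n : ℤ) := by simpa using h
  rw [Padic.norm_int_le_pow_iff_dvd] at h'
  have := Int.natAbs_dvd_natAbs.2 h'
  have h2 : (i : ℤ) - j = 0 := by
    refine Int.eq_zero_of_abs_lt_dvd (by exact_mod_cast h') ?_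
    rw [abs_lt]
    have : ((p ^ n : ℕ) : ℤ) = (p : ℤ) ^ n := by push_cast; rfl
    constructor <;> omega
  omega

lemma norm_natCast_le_one (i : ℕ) : ‖(i : ℚ_[p])‖ ≤ 1 := by
  simpa using Padic.norm_int_le_one (p := p) i

lemma zpow_neg_natCast_le_one (n : ℕ) : (p : ℝ) ^ (-n : ℤ) ≤ 1 := by
  rw [zpow_neg, zpow_natCast]
  exact inv_le_one_of_one_le₀ (one_le_pow₀ (by exact_mod_cast hp.out.one_lt.le))

lemma closedBall_one_eq_biUnion (n : ℕ) : closedBall (0 : ℚ_[p]) 1 =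
    ⋃ i ∈ Finset.range (p ^ n), closedBall (i : ℚ_[p]) ((p : ℝ) ^ (-n : ℤ)) := by
  ext x
  simp only [mem_closedBall, dist_zero_right, Finset.mem_range, mem_iUnion, exists_prop]
  constructor
  · intro hx
    obtain ⟨i, hi, h⟩ := exists_natCast_close n hx
    exact ⟨i, hi, by rwa [dist_eq_norm]⟩
  · rintro ⟨i, -, h⟩
    rw [dist_eq_norm] at h
    calc ‖x‖ = ‖(x - i) + i‖ := by simp
      _ ≤ max ‖x - i‖ ‖(i : ℚ_[p])‖ := Padic.nonarchimedean _ _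
      _ ≤ 1 := max_le (h.trans (zpow_neg_natCast_le_one n)) (norm_natCast_le_one i)

lemma pairwiseDisjoint_closedBall (n : ℕ) : (Finset.range (p ^ n) : Set ℕ).PairwiseDisjoint
    (fun i : ℕ => closedBall (i : ℚ_[p]) ((p : ℝ) ^ (-n : ℤ))) := by
  intro i hi j hj hij
  simp only [Finset.coe_range, mem_Iio] at hi hj
  refine (Set.disjoint_left.2 fun x hx hy => hij ?_)
  refine natCast_eq_of_close hi hj ?_
  rw [mem_closedBall, dist_eq_norm] at hx hy
  calc ‖(i : ℚ_[p]) - j‖ = ‖(x - j) - (x - i)‖ := by congr 1; ring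
    _ ≤ max ‖x - j‖ ‖x - (i : ℚ_[p])‖ := norm_sub_le_max' _ _
    _ ≤ _ := max_le hy hx

lemma haar_closedBall_pow (n : ℕ) (a : ℚ_[p]) :
    haar p (closedBall a ((p : ℝ) ^ (-n : ℤ))) = ((p : ℝ≥0∞) ^ n)⁻¹ := by
  have h1 := haar_closedBall_one (p := p)
  rw [closedBall_one_eq_biUnion n,
    measure_biUnion_finset (pairwiseDisjoint_closedBall n)
      (fun i _ => measurableSet_closedBall)] at h1
  simp_rw [haar_closedBall_eq (p := p) (_ : ℚ_[p])] at h1 ⊢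
  rw [Finset.sum_const, Finset.card_range, nsmul_eq_mul] at h1
  push_cast at h1
  exact ENNReal.eq_inv_of_mul_eq_one_left (by rw [mul_comm]; exact h1)

lemma haar_closedBall_norm (a : ℚ_[p]) {c : ℚ_[p]} (hc : ‖c‖ ≤ 1) :
    haar p (closedBall a ‖c‖) = ‖c‖ₑ := by
  rcases eq_or_ne c 0 with rfl | h0
  · simp
  · obtain ⟨n, hcn⟩ := norm_eq_pow_of_norm_le_one hc h0
    rw [← ofReal_norm, hcn, haar_closedBall_pow, zpow_neg, zpow_natCast,
      ENNReal.ofReal_inv_of_pos (by have := hp.out.pos; positivity),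
      ENNReal.ofReal_pow (by positivity),
      ENNReal.ofReal_natCast]

instance : IsProbabilityMeasure (unitHaar p) := ⟨by simp [unitHaar, haar_closedBall_one]⟩

lemma unitHaar_restrict_closedBall : (unitHaar p).restrict (closedBall 0 1) = unitHaar p := by
  rw [unitHaar, Measure.restrict_restrict measurableSet_closedBall, inter_self]

lemma ae_unitHaar : ∀ᵐ t ∂(unitHaar p), ‖t‖ ≤ 1 := by
  have := ae_restrict_mem (μ := haar p) (s := closedBall 0 1) measurableSet_closedBall
  simpa [unitHaar] using this

lemma unitHaar_map_add {a : ℚ_[p]} (ha : ‖a‖ ≤ 1) :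
    (unitHaar p).map (fun t => a + t) = unitHaar p := by
  have h : closedBall (0 : ℚ_[p]) 1 = (fun t => a + t) ⁻¹' closedBall 0 1 := by
    ext t
    simp only [mem_closedBall, dist_zero_right, mem_preimage]
    constructor
    · intro h; exact (Padic.nonarchimedean _ _).trans (max_le ha h)
    · intro h
      calc ‖t‖ = ‖(a + t) - a‖ := by simp
        _ ≤ max ‖a + t‖ ‖a‖ := norm_sub_le_max' _ _
        _ ≤ 1 := max_le h ha
  rw [unitHaar]
  conv_lhs => rw [h]
  rw [← Measure.restrict_map (measurable_const_add a) measurableSet_closedBall,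
    map_add_left_eq_self]

lemma unitHaar_restrict_norm_le {c : ℚ_[p]} (hc : ‖c‖ ≤ 1) :
    (unitHaar p).restrict {t | ‖t‖ ≤ ‖c‖} = ‖c‖ₑ • (unitHaar p).map (fun t => c * t) := by
  have hset : {t : ℚ_[p] | ‖t‖ ≤ ‖c‖} = closedBall 0 ‖c‖ := by ext; simp
  rw [hset, unitHaar, Measure.restrict_restrict measurableSet_closedBall,
    inter_eq_left.2 (closedBall_subset_closedBall hc)]
  rcases eq_or_ne c 0 with rfl | h0
  · rw [norm_zero, closedBall_zero, enorm_zero, zero_smul, Measure.restrict_eq_zero]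
    simp
  · have hpre : closedBall (0 : ℚ_[p]) 1 = (fun t => c * t) ⁻¹' closedBall 0 ‖c‖ := by
      ext t
      have := norm_pos_iff.2 h0
      simp [this]
    let e : ℚ_[p] ≃L[ℚ_[p]] ℚ_[p] :=
      ContinuousLinearEquiv.smulLeft (Units.mk0 c h0)
    have hmap : IsAddHaarMeasure ((haar p).map (fun t => c * t)) :=
      e.isAddHaarMeasure_map (haar p)
    have hk := isAddLeftInvariant_eq_smul ((haar p).map (fun t => c * t)) (haar p)
    set k := addHaarScalarFactor ((haar p).map (fun t => c * t)) (haar p)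
    conv_rhs => rw [hpre]
    rw [← Measure.restrict_map (measurable_const_mul c) measurableSet_closedBall, hk]
    have hmass : (1 : ℝ≥0∞) = k * ‖c‖ₑ := by
      have := congrArg (fun μ : Measure ℚ_[p] => μ (closedBall 0 ‖c‖)) hk
      rw [Measure.map_apply (measurable_const_mul c) measurableSet_closedBall, ← hpre,
        haar_closedBall_one, Measure.smul_apply, haar_closedBall_norm _ hc] at this
      exact this
    rw [← Measure.restrict_smul]
    have : ‖c‖ₑ • (k • haar p) = haar p := by
      rw [show k • haar p = (k : ℝ≥0∞) • haar p from rfl, smul_smul, mul_comm, ← hmass, one_smul]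
    rw [this]

/-- The closed unit ball of `ℚ_p ^ n`. -/
def polydisc (p : ℕ) [Fact p.Prime] (n : ℕ) : Set (Fin n → ℚ_[p]) := closedBall 0 1

lemma mem_polydisc {y : Fin n → ℚ_[p]} : y ∈ polydisc p n ↔ ∀ i, ‖y i‖ ≤ 1 := by
  simp [polydisc, pi_norm_le_iff_of_nonneg]

lemma isClopen_polydisc : IsClopen (polydisc p n) :=
  IsUltrametricDist.isClopen_closedBall _ one_ne_zero

lemma isOpen_polydisc : IsOpen (polydisc p n) := isClopen_polydisc.2

lemma isCompact_polydisc : IsCompact (polydisc p n) := isCompact_closedBall _ _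

lemma measurableSet_polydisc : MeasurableSet (polydisc p n) := isOpen_polydisc.measurableSet

lemma zero_mem_polydisc : (0 : Fin n → ℚ_[p]) ∈ polydisc p n := by simp [polydisc]

/-- The normalised Haar measure of the polydisc. -/
noncomputable def unitPi (p : ℕ) [Fact p.Prime] (n : ℕ) : Measure (Fin n → ℚ_[p]) :=
  Measure.pi fun _ => unitHaar p

instance : IsProbabilityMeasure (unitPi p n) := by unfold unitPi; infer_instance

lemma unitPi_restrict_polydisc : (unitPi p n).restrict (polydisc p n) = unitPi p n := by
  have : polydisc p n = univ.pi fun _ => closedBall 0 1 := by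
    ext y; simp [mem_polydisc]
  rw [this, unitPi, Measure.restrict_pi_pi]
  simp_rw [unitHaar_restrict_closedBall]

lemma ae_unitPi : ∀ᵐ y ∂(unitPi p n), y ∈ polydisc p n := by
  rw [← unitPi_restrict_polydisc]
  exact ae_restrict_mem measurableSet_polydisc

lemma aemeasurable_unitPi {X : Type*} [TopologicalSpace X] [MeasurableSpace X] [BorelSpace X]
    {f : (Fin n → ℚ_[p]) → X} (hf : ContinuousOn f (polydisc p n)) :
    AEMeasurable f (unitPi p n) := by
  rw [← unitPi_restrict_polydisc]
  exact hf.aemeasurable measurableSet_polydisc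

lemma measurable_update_pair (i : Fin n) : Measurable
    (fun q : (Fin n → ℚ_[p]) × ℚ_[p] => Function.update q.1 i q.2) := by
  refine measurable_pi_iff.2 fun j => ?_
  rcases eq_or_ne j i with rfl | h
  · simpa using measurable_snd
  · simp only [ne_eq, h, not_false_eq_true, Function.update_of_ne]
    exact (measurable_pi_apply j).comp measurable_fst

lemma map_update_unitPi (i : Fin n) :
    ((unitPi p n).prod (unitHaar p)).map (fun q => Function.update q.1 i q.2) = unitPi p n := by
  rw [eq_comm, unitPi]
  refine Measure.pi_eq fun s hs => ?_
  rw [Measure.map_apply (measurable_update_pair i) (MeasurableSet.univ_pi hs)]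
  have : (fun q : (Fin n → ℚ_[p]) × ℚ_[p] => Function.update q.1 i q.2) ⁻¹' (univ.pi s)
      = (univ.pi (Function.update s i univ)) ×ˢ s i := by
    ext q
    simp only [mem_preimage, Set.mem_pi, mem_univ, true_imp_iff, mem_prod]
    constructor
    · intro h
      refine ⟨fun j => ?_, by simpa using h i⟩
      rcases eq_or_ne j i with rfl | hj
      · simp
      · simpa [hj] using h j
    · rintro ⟨h, h'⟩ j
      rcases eq_or_ne j i with rfl | hj
      · simpa using h'
      · simpa [hj] using h j
  rw [this, Measure.prod_prod, Measure.pi_pi, ← Finset.prod_erase_mul _ _ (Finset.mem_univ i),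
    ← Finset.prod_erase_mul (a := i) Finset.univ (fun j => unitHaar p (s j)) (Finset.mem_univ i)]
  simp only [Function.update_self, measure_univ, mul_one]
  congr 1
  refine Finset.prod_congr rfl fun j hj => ?_
  rw [Function.update_of_ne (Finset.ne_of_mem_erase hj)]

/-- `u` is analytic and of constant nonzero norm on the polydisc. -/
def IsUnitOn (u : (Fin n → ℚ_[p]) → ℚ_[p]) : Prop :=
  AnalyticOnNhd ℚ_[p] u (polydisc p n) ∧ ∃ r : ℝ, 0 < r ∧ ∀ y ∈ polydisc p n, ‖u y‖ = r

/-- The monomial with exponent vector `α`. -/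
noncomputable def mon (α : Fin n → ℕ) (y : Fin n → ℚ_[p]) : ℚ_[p] := ∏ j, y j ^ α j

/-- On the polydisc, `g` is a monomial with exponents divisible by `N` times a unit. -/
def Mono (N : ℕ) (g : (Fin n → ℚ_[p]) → ℚ_[p]) : Prop :=
  ∃ (α : Fin n → ℕ) (u : (Fin n → ℚ_[p]) → ℚ_[p]), IsUnitOn u ∧
    ∀ y ∈ polydisc p n, g y = mon α y ^ N * u y

lemma mon_add (α β : Fin n → ℕ) (y : Fin n → ℚ_[p]) : mon (α + β) y = mon α y * mon β y := by
  simp [mon, pow_add, Finset.prod_mul_distrib]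

lemma mon_smul (k : ℕ) (α : Fin n → ℕ) (y : Fin n → ℚ_[p]) : mon (k • α) y = mon α y ^ k := by
  simp [mon, mul_comm k, pow_mul, Finset.prod_pow]

@[simp] lemma mon_zero (y : Fin n → ℚ_[p]) : mon 0 y = 1 := by simp [mon]

lemma mon_single (i : Fin n) (y : Fin n → ℚ_[p]) : mon (Pi.single i 1) y = y i := by
  rw [mon, Finset.prod_eq_single i]
  · simp
  · intro j _ h; simp [h]
  · simp

lemma analyticOnNhd_coord (i : Fin n) (s : Set (Fin n → ℚ_[p])) :
    AnalyticOnNhd ℚ_[p] (fun y => y i) s :=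
  (ContinuousLinearMap.proj (R := ℚ_[p]) (φ := fun _ : Fin n => ℚ_[p]) i).analyticOnNhd s

lemma analyticOnNhd_mon (α : Fin n → ℕ) (s : Set (Fin n → ℚ_[p])) :
    AnalyticOnNhd ℚ_[p] (mon α) s := by
  unfold mon
  exact Finset.analyticOnNhd_fun_prod _ fun j _ => (analyticOnNhd_coord j s).fun_pow _

lemma continuous_mon (α : Fin n → ℕ) : Continuous (mon (p := p) α) := by
  unfold mon; fun_prop

lemma norm_mon_le_one (α : Fin n → ℕ) {y : Fin n → ℚ_[p]} (hy : y ∈ polydisc p n) :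
    ‖mon α y‖ ≤ 1 := by
  rw [mon, norm_prod]
  exact Finset.prod_le_one (fun _ _ => norm_nonneg _) fun j _ => by
    rw [norm_pow]; exact pow_le_one₀ (norm_nonneg _) (mem_polydisc.1 hy j)

namespace IsUnitOn

lemma mul {u v : (Fin n → ℚ_[p]) → ℚ_[p]} (hu : IsUnitOn u) (hv : IsUnitOn v) :
    IsUnitOn (fun y => u y * v y) := by
  obtain ⟨hu, r, hr, h⟩ := hu
  obtain ⟨hv, s, hs, h'⟩ := hv
  exact ⟨hu.mul hv, r * s, by positivity, fun y hy => by rw [norm_mul, h y hy, h' y hy]⟩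

lemma pow {u : (Fin n → ℚ_[p]) → ℚ_[p]} (hu : IsUnitOn u) (k : ℕ) :
    IsUnitOn (fun y => u y ^ k) := by
  obtain ⟨hu, r, hr, h⟩ := hu
  exact ⟨hu.fun_pow k, r ^ k, by positivity, fun y hy => by rw [norm_pow, h y hy]⟩

lemma const {c : ℚ_[p]} (hc : c ≠ 0) : IsUnitOn (fun _ : Fin n → ℚ_[p] => c) :=
  ⟨analyticOnNhd_const, ‖c‖, norm_pos_iff.2 hc, fun _ _ => rfl⟩

lemma comp {m : ℕ} {u : (Fin n → ℚ_[p]) → ℚ_[p]} (hu : IsUnitOn u)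
    {g : (Fin m → ℚ_[p]) → Fin n → ℚ_[p]} (hg : AnalyticOnNhd ℚ_[p] g (polydisc p m))
    (hm : MapsTo g (polydisc p m) (polydisc p n)) : IsUnitOn (u ∘ g) := by
  obtain ⟨hu, r, hr, h⟩ := hu
  exact ⟨hu.comp hg hm, r, hr, fun y hy => h _ (hm hy)⟩

end IsUnitOn

namespace Mono

variable {N : ℕ} {g h : (Fin n → ℚ_[p]) → ℚ_[p]}

lemma congr (hg : Mono N g) (e : EqOn g h (polydisc p n)) : Mono N h := by
  obtain ⟨α, u, hu, hg⟩ := hg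
  exact ⟨α, u, hu, fun y hy => by rw [← e hy, hg y hy]⟩

lemma analyticOnNhd (hg : Mono N g) : AnalyticOnNhd ℚ_[p] g (polydisc p n) := by
  obtain ⟨α, u, hu, hg⟩ := hg
  exact (((analyticOnNhd_mon α _).fun_pow N).mul hu.1).congr isOpen_polydisc
    fun y hy => (hg y hy).symm

lemma mul (hg : Mono N g) (hh : Mono N h) : Mono N (fun y => g y * h y) := by
  obtain ⟨α, u, hu, hg⟩ := hg
  obtain ⟨β, v, hv, hh⟩ := hh
  refine ⟨α + β, _, hu.mul hv, fun y hy => ?_⟩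
  simp only [hg y hy, hh y hy, mon_add]; ring

lemma pow (hg : Mono N g) (k : ℕ) : Mono N (fun y => g y ^ k) := by
  obtain ⟨α, u, hu, hg⟩ := hg
  refine ⟨k • α, _, hu.pow k, fun y hy => ?_⟩
  simp only [hg y hy, mon_smul]; ring

lemma pow_mul_self (hg : Mono N g) (k : ℕ) : Mono (N * k) (fun y => g y ^ k) := by
  obtain ⟨α, u, hu, hg⟩ := hg
  refine ⟨α, _, hu.pow k, fun y hy => ?_⟩
  simp only [hg y hy]; ring

lemma to_one (hg : Mono N g) : Mono 1 g := by
  obtain ⟨α, u, hu, hg⟩ := hg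
  exact ⟨N • α, u, hu, fun y hy => by rw [hg y hy, mon_smul, pow_one]⟩

lemma of_unit (hu : IsUnitOn g) : Mono N g := ⟨0, g, hu, fun y _ => by simp⟩

lemma const {c : ℚ_[p]} (hc : c ≠ 0) : Mono N (fun _ : Fin n → ℚ_[p] => c) :=
  of_unit (.const hc)

lemma coord (i : Fin n) : Mono 1 (fun y : Fin n → ℚ_[p] => y i) :=
  ⟨Pi.single i 1, _, .const one_ne_zero, fun y _ => by simp [mon_single]⟩

lemma prod {ι : Type*} (s : Finset ι) (f : ι → (Fin n → ℚ_[p]) → ℚ_[p])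
    (hf : ∀ i ∈ s, Mono N (f i)) : Mono N (fun y => ∏ i ∈ s, f i y) := by
  classical
  induction s using Finset.induction_on with
  | empty => simpa using const one_ne_zero
  | insert a s ha ih =>
    simp_rw [Finset.prod_insert ha]
    exact (hf a (by simp)).mul (ih fun i hi => hf i (by simp [hi]))

lemma mon_comp {m : ℕ} {f : (Fin m → ℚ_[p]) → Fin n → ℚ_[p]}
    (hf : ∀ j, Mono N (fun y => f y j)) (α : Fin n → ℕ) : Mono N (fun y => mon α (f y)) := by
  unfold mon
  exact prod _ _ fun j _ => (hf j).pow _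

end Mono

/-- A self-map of polydiscs whose components are monomials times units. -/
def Nice (N : ℕ) {m : ℕ} (f : (Fin m → ℚ_[p]) → Fin n → ℚ_[p]) : Prop :=
  MapsTo f (polydisc p m) (polydisc p n) ∧ ∀ j, Mono N (fun y => f y j)

lemma Nice.analyticOnNhd {N m : ℕ} {f : (Fin m → ℚ_[p]) → Fin n → ℚ_[p]} (hf : Nice N f) :
    AnalyticOnNhd ℚ_[p] f (polydisc p m) :=
  fun y hy => (analyticAt_pi_iff).2 fun j => (hf.2 j).analyticOnNhd y hy

lemma Nice.to_one {N m : ℕ} {f : (Fin m → ℚ_[p]) → Fin n → ℚ_[p]} (hf : Nice N f) : Nice 1 f :=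
  ⟨hf.1, fun j => (hf.2 j).to_one⟩

lemma Mono.comp {N m : ℕ} {g : (Fin n → ℚ_[p]) → ℚ_[p]} (hg : Mono N g)
    {f : (Fin m → ℚ_[p]) → Fin n → ℚ_[p]} (hf : Nice 1 f) : Mono N (g ∘ f) := by
  obtain ⟨α, u, hu, hg⟩ := hg
  have h1 := ((Mono.mon_comp hf.2 α).pow_mul_self N)
  rw [one_mul] at h1
  exact (h1.mul (.of_unit (hu.comp hf.analyticOnNhd hf.1))).congr fun y hy => (hg _ (hf.1 hy)).symm

lemma Mono.comp_nice {N m : ℕ} {g : (Fin n → ℚ_[p]) → ℚ_[p]} (hg : Mono 1 g)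
    {f : (Fin m → ℚ_[p]) → Fin n → ℚ_[p]} (hf : Nice N f) : Mono N (g ∘ f) := by
  obtain ⟨α, u, hu, hg⟩ := hg
  refine ((Mono.mon_comp hf.2 α).mul
    (.of_unit (hu.comp hf.to_one.analyticOnNhd hf.1))).congr fun y hy => ?_
  simp [hg _ (hf.1 hy)]

lemma Nice.comp {N m k : ℕ} {g : (Fin n → ℚ_[p]) → Fin k → ℚ_[p]} (hg : Nice N g)
    {f : (Fin m → ℚ_[p]) → Fin n → ℚ_[p]} (hf : Nice 1 f) : Nice N (g ∘ f) :=
  ⟨hg.1.comp hf.1, fun j => (hg.2 j).comp hf⟩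

lemma Nice.id : Nice 1 (id : (Fin n → ℚ_[p]) → Fin n → ℚ_[p]) :=
  ⟨mapsTo_id _, fun j => Mono.coord j⟩

section Good

set_option linter.unusedSectionVars false

variable {X Y : Type*} [NormedAddCommGroup X] [NormedSpace ℚ_[p] X] [MeasurableSpace X]
  [BorelSpace X] [NormedAddCommGroup Y] [NormedSpace ℚ_[p] Y] [MeasurableSpace Y] [BorelSpace Y]

/-- Measures which are finite nonnegative combinations of images, under analytic charts with
property `P`, of measures `‖J‖ dy` on the polydisc with `J` a monomial times a unit. -/
noncomputable def Good (n : ℕ) (P : ((Fin n → ℚ_[p]) → X) → Prop) : Submodule ℝ≥0 (Measure X) :=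
  Submodule.span ℝ≥0 {κ | ∃ (f : (Fin n → ℚ_[p]) → X) (J : (Fin n → ℚ_[p]) → ℚ_[p]),
    AnalyticOnNhd ℚ_[p] f (polydisc p n) ∧ P f ∧ Mono 1 J ∧
    κ = ((unitPi p n).withDensity fun y => ‖J y‖ₑ).map f}

lemma Mono.aemeasurable_enorm {N : ℕ} {J : (Fin n → ℚ_[p]) → ℚ_[p]} (hJ : Mono N J) :
    AEMeasurable (fun y => ‖J y‖ₑ) (unitPi p n) :=
  aemeasurable_unitPi (hJ.analyticOnNhd.continuousOn.enorm)

lemma map_withDensity_comp {X Y : Type*} [MeasurableSpace X] [MeasurableSpace Y] {κ : Measure X}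
    {f : X → Y} (hf : AEMeasurable f κ) {w : Y → ℝ≥0∞} (hw : Measurable w) :
    (κ.map f).withDensity w = (κ.withDensity (w ∘ f)).map f := by
  have hf' : AEMeasurable f (κ.withDensity (w ∘ f)) :=
    hf.mono_ac (withDensity_absolutelyContinuous _ _)
  ext s hs
  rw [withDensity_apply _ hs, Measure.map_apply_of_aemeasurable hf' hs]
  rw [Measure.restrict_map_of_aemeasurable hf hs, lintegral_map' hw.aemeasurable hf.restrict,
    withDensity_apply₀ _ (hf.nullMeasurable hs)]
  rfl

lemma map_withDensity_map_withDensity {J₀ : (Fin n → ℚ_[p]) → ℚ_[p]} (hJ₀ : Mono 1 J₀)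
    {g : (Fin n → ℚ_[p]) → Y} (hg : ContinuousOn g (polydisc p n))
    {f : Y → X} (hf : Measurable f) {J : Y → ℚ_[p]} (hJ : Measurable J) :
    (((((unitPi p n).withDensity fun y => ‖J₀ y‖ₑ).map g).withDensity fun y => ‖J y‖ₑ).map f) =
      ((unitPi p n).withDensity fun y => ‖J₀ y * J (g y)‖ₑ).map (f ∘ g) := by
  have hg' := aemeasurable_unitPi hg
  have hg'' : AEMeasurable g ((unitPi p n).withDensity fun y => ‖J₀ y‖ₑ) :=
    hg'.mono_ac (withDensity_absolutelyContinuous _ _)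
  have hJm : Measurable fun y => ‖J y‖ₑ := hJ.enorm
  rw [map_withDensity_comp hg'' hJm,
    ← withDensity_mul₀ hJ₀.aemeasurable_enorm (hJm.comp_aemeasurable hg'),
    AEMeasurable.map_map_of_aemeasurable hf.aemeasurable
      (hg'.mono_ac (withDensity_absolutelyContinuous _ _))]
  congr 2
  ext y
  simp [enorm_mul]

variable {P : ((Fin n → ℚ_[p]) → Y) → Prop} {P' : ((Fin n → ℚ_[p]) → X) → Prop}

lemma extend_measurable {S : Set Y} (hS : MeasurableSet S) {f : Y → X} (hf : ContinuousOn f S) :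
    ∃ f' : Y → X, Measurable f' ∧ EqOn f f' S := by
  classical
  exact ⟨S.piecewise f 0, hf.measurable_piecewise continuousOn_const hS, fun y hy => by simp [hy]⟩

lemma Good.ae_mem {κ : Measure Y} (hκ : κ ∈ Good n P) {S : Set Y} (hS : MeasurableSet S)
    (h : ∀ g, AnalyticOnNhd ℚ_[p] g (polydisc p n) → P g → MapsTo g (polydisc p n) S) :
    ∀ᵐ y ∂κ, y ∈ S := by
  induction hκ using Submodule.span_induction with
  | mem κ hκ =>
    obtain ⟨g, J₀, hg, hP, hJ₀, rfl⟩ := hκ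
    have hg' := (aemeasurable_unitPi hg.continuousOn).mono_ac
      (withDensity_absolutelyContinuous (unitPi p n) fun y => ‖J₀ y‖ₑ)
    refine (ae_map_iff hg' hS).2 ?_
    exact (withDensity_absolutelyContinuous _ _).ae_le
      (ae_unitPi.mono fun y hy => h g hg hP hy)
  | zero => simp
  | add κ₁ κ₂ _ _ h1 h2 => exact ae_add_measure_iff.2 ⟨h1, h2⟩
  | smul c κ _ h1 => exact ae_smul_measure h1 (c : ℝ≥0∞)

/-- Push a good measure forward along a map with a density. -/
lemma Good.refine {κ : Measure Y} (hκ : κ ∈ Good n P) {S : Set Y} (hS : MeasurableSet S)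
    {f : Y → X} (hf : ContinuousOn f S) {J : Y → ℚ_[p]} (hJ : ContinuousOn J S)
    (h : ∀ g, AnalyticOnNhd ℚ_[p] g (polydisc p n) → P g → MapsTo g (polydisc p n) S ∧
      AnalyticOnNhd ℚ_[p] (f ∘ g) (polydisc p n) ∧ P' (f ∘ g) ∧ Mono 1 (J ∘ g)) :
    (κ.withDensity fun y => ‖J y‖ₑ).map f ∈ Good n P' := by
  obtain ⟨f', hf', hff'⟩ := extend_measurable hS hf
  obtain ⟨J', hJ', hJJ'⟩ := extend_measurable hS hJ
  have hae := Good.ae_mem hκ hS fun g hg hP => (h g hg hP).1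
  rw [withDensity_congr_ae (g := fun y => ‖J' y‖ₑ) (hae.mono fun y hy => by rw [hJJ' hy]),
    Measure.map_congr (g := f') ((withDensity_absolutelyContinuous _ _).ae_le
      (hae.mono fun y hy => hff' hy))]
  clear hae
  induction hκ using Submodule.span_induction with
  | mem κ hκ =>
    obtain ⟨g, J₀, hg, hP, hJ₀, rfl⟩ := hκ
    obtain ⟨h0, h1, h2, h3⟩ := h g hg hP
    rw [map_withDensity_map_withDensity hJ₀ hg.continuousOn hf' hJ',
      withDensity_congr_ae (g := fun y => ‖J₀ y * J (g y)‖ₑ)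
        (ae_unitPi.mono fun y hy => by simp only [hJJ' (h0 hy)]),
      Measure.map_congr (f := f' ∘ g) (g := f ∘ g) ((withDensity_absolutelyContinuous _ _).ae_le
        (ae_unitPi.mono fun y hy => (hff' (h0 hy)).symm))]
    exact Submodule.subset_span ⟨_, _, h1, h2, hJ₀.mul h3, rfl⟩
  | zero => simp
  | add κ₁ κ₂ _ _ h1 h2 =>
    rw [withDensity_add_measure, Measure.map_add _ _ hf']
    exact add_mem h1 h2
  | smul c κ _ h1 =>
    rw [show c • κ = (c : ℝ≥0∞) • κ from rfl, withDensity_smul_measure, Measure.map_smul]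
    exact Submodule.smul_mem _ c h1

lemma Good.map {κ : Measure Y} (hκ : κ ∈ Good n P) {S : Set Y} (hS : MeasurableSet S)
    {f : Y → X} (hf : ContinuousOn f S)
    (h : ∀ g, AnalyticOnNhd ℚ_[p] g (polydisc p n) → P g → MapsTo g (polydisc p n) S ∧
      AnalyticOnNhd ℚ_[p] (f ∘ g) (polydisc p n) ∧ P' (f ∘ g)) :
    κ.map f ∈ Good n P' := by
  have := Good.refine hκ hS hf (J := fun _ => 1) continuousOn_const (P' := P')
    fun g h1 h2 => ⟨(h g h1 h2).1, (h g h1 h2).2.1, (h g h1 h2).2.2, Mono.const one_ne_zero⟩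
  simpa using this

lemma Good.mono {P P' : ((Fin n → ℚ_[p]) → X) → Prop} {κ : Measure X} (hκ : κ ∈ Good n P)
    (h : ∀ g, AnalyticOnNhd ℚ_[p] g (polydisc p n) → P g → P' g) : κ ∈ Good n P' := by
  simpa using Good.map hκ MeasurableSet.univ continuousOn_id
    fun g h1 h2 => ⟨mapsTo_univ _ _, h1, h g h1 h2⟩

/-- Charts may be refined along a good decomposition of the measure on the polydisc. -/
lemma Good.subdivide {Q : ((Fin n → ℚ_[p]) → Fin n → ℚ_[p]) → Prop}
    {κ : Measure (Fin n → ℚ_[p])} (hQ : κ ∈ Good n Q) (hQN : ∀ g, Q g → Nice 1 g)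
    {f : (Fin n → ℚ_[p]) → X} (hf : AnalyticOnNhd ℚ_[p] f (polydisc p n))
    {J : (Fin n → ℚ_[p]) → ℚ_[p]} (hJ : Mono 1 J) (h : ∀ g, Q g → P' (f ∘ g)) :
    (κ.withDensity fun y => ‖J y‖ₑ).map f ∈ Good n P' :=
  Good.refine hQ measurableSet_polydisc hf.continuousOn hJ.analyticOnNhd.continuousOn
    fun g _ hg => ⟨(hQN g hg).1, hf.comp (hQN g hg).analyticOnNhd (hQN g hg).1, h g hg,
      hJ.comp (hQN g hg)⟩

/-- The measure of the polydisc is good for `Q`, so charts may be composed with `Q`-maps. -/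
lemma Good.of_unitPi {Q : ((Fin n → ℚ_[p]) → Fin n → ℚ_[p]) → Prop}
    (hQ : unitPi p n ∈ Good n Q) (hQN : ∀ g, Q g → Nice 1 g)
    {P P' : ((Fin n → ℚ_[p]) → X) → Prop} {κ : Measure X} (hκ : κ ∈ Good n P)
    (h : ∀ f g, P f → Q g → P' (f ∘ g)) : κ ∈ Good n P' := by
  refine (Submodule.span_le.2 ?_ : Good n P ≤ Good n P') hκ
  rintro κ ⟨f, J, hf, hP, hJ, rfl⟩
  exact Good.subdivide hQ hQN hf hJ fun g hg => h f g hP hg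

lemma lintegral_unitPi_update (i : Fin n) {F : (Fin n → ℚ_[p]) → ℝ≥0∞} (hF : Measurable F) :
    ∫⁻ y, F y ∂(unitPi p n) =
      ∫⁻ y, ∫⁻ t, F (Function.update y i t) ∂(unitHaar p) ∂(unitPi p n) := by
  conv_lhs => rw [← map_update_unitPi i]
  rw [lintegral_map hF (measurable_update_pair i),
    lintegral_prod (fun q => F (Function.update q.1 i q.2))
      (hF.comp (measurable_update_pair i)).aemeasurable]

lemma lintegral_map_withDensity {X Y : Type*} [MeasurableSpace X] [MeasurableSpace Y]
    {μ : Measure X} {w : X → ℝ≥0∞} (hw : Measurable w) {φ : X → Y} (hφ : Measurable φ)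
    {F : Y → ℝ≥0∞} (hF : Measurable F) :
    ∫⁻ y, F y ∂((μ.withDensity w).map φ) = ∫⁻ x, w x * F (φ x) ∂μ := by
  rw [lintegral_map hF hφ,
    lintegral_withDensity_eq_lintegral_mul μ hw (g := fun x => F (φ x)) (hF.comp hφ)]
  rfl

/-- Decompose the measure of the polydisc along one coordinate. -/
lemma unitPi_mem_good_of_coord {ι : Type*} (s : Finset ι) (r : ι → ℝ≥0) (φ j : ι → ℚ_[p] → ℚ_[p])
    (hφ : ∀ c ∈ s, Measurable (φ c)) (hj : ∀ c ∈ s, Measurable (j c))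
    (hm : unitHaar p = ∑ c ∈ s, r c • ((unitHaar p).withDensity fun t => ‖j c t‖ₑ).map (φ c))
    (i : Fin n) {Q : ((Fin n → ℚ_[p]) → Fin n → ℚ_[p]) → Prop}
    (hN : ∀ c ∈ s, Nice 1 fun y : Fin n → ℚ_[p] => Function.update y i (φ c (y i)))
    (hJ : ∀ c ∈ s, Mono 1 fun y : Fin n → ℚ_[p] => j c (y i))
    (hQ : ∀ c ∈ s, Q fun y => Function.update y i (φ c (y i))) : unitPi p n ∈ Good n Q := by
  have key : unitPi p n = ∑ c ∈ s, r c • ((unitPi p n).withDensity fun y => ‖j c (y i)‖ₑ).map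
      (fun y => Function.update y i (φ c (y i))) := by
    refine Measure.ext_of_lintegral _ fun F hF => ?_
    rw [lintegral_finsetSum_measure, lintegral_unitPi_update i hF]
    have inner : ∀ y : Fin n → ℚ_[p], ∫⁻ t, F (Function.update y i t) ∂(unitHaar p) =
        ∑ c ∈ s, r c • ∫⁻ t, ‖j c t‖ₑ * F (Function.update y i (φ c t)) ∂(unitHaar p) := by
      intro y
      have hFy : Measurable fun t => F (Function.update y i t) := hF.comp (measurable_update y)
      conv_lhs => rw [hm]
      rw [lintegral_finsetSum_measure]
      refine Finset.sum_congr rfl fun c hc => ?_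
      rw [lintegral_smul_measure, lintegral_map_withDensity (hj c hc).enorm (hφ c hc) hFy]
    have hmeas : ∀ c ∈ s, Measurable fun y : Fin n → ℚ_[p] =>
        Function.update y i (φ c (y i)) := fun c hc =>
      (measurable_update_pair i).comp
        (measurable_id.prodMk ((hφ c hc).comp (measurable_pi_apply i)))
    have hmeas' : ∀ c ∈ s, Measurable fun y : Fin n → ℚ_[p] => ‖j c (y i)‖ₑ := fun c hc =>
      ((hj c hc).comp (measurable_pi_apply i)).enorm
    have hprod : ∀ c ∈ s, Measurable fun q : (Fin n → ℚ_[p]) × ℚ_[p] =>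
        ‖j c q.2‖ₑ * F (Function.update q.1 i (φ c q.2)) := fun c hc =>
      ((hj c hc).comp measurable_snd).enorm.mul (hF.comp ((measurable_update_pair i).comp
        (measurable_fst.prodMk ((hφ c hc).comp measurable_snd))))
    simp_rw [inner]
    rw [lintegral_finsetSum' (f := fun c y => r c •
      ∫⁻ t, ‖j c t‖ₑ * F (Function.update y i (φ c t)) ∂(unitHaar p)) _ fun c hc =>
      ((hprod c hc).lintegral_prod_right'.const_smul (r c)).aemeasurable]
    refine Finset.sum_congr rfl fun c hc => ?_
    rw [lintegral_smul_measure, lintegral_map_withDensity (hmeas' c hc) (hmeas c hc) hF,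
      lintegral_unitPi_update i (F := fun y => ‖j c (y i)‖ₑ * F (Function.update y i (φ c (y i))))
        ((hmeas' c hc).mul (hF.comp (hmeas c hc)))]
    simp only [Function.update_self, Function.update_idem]
    simp_rw [ENNReal.smul_def, smul_eq_mul]
    rw [lintegral_const_mul _ (hprod c hc).lintegral_prod_right']
  rw [key]
  refine sum_mem fun c hc => Submodule.smul_mem _ _ (Submodule.subset_span ?_)
  exact ⟨_, _, (hN c hc).analyticOnNhd, hQ c hc, hJ c hc, rfl⟩

end Good

lemma norm_natCast_pow (k : ℕ) : ‖((p : ℚ_[p]) ^ k)‖ = (p : ℝ) ^ (-k : ℤ) := by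
  rw [norm_pow, Padic.norm_p, inv_pow, zpow_neg, zpow_natCast]

lemma p_ne_zero : (p : ℚ_[p]) ≠ 0 := by exact_mod_cast hp.out.ne_zero

lemma unitHaar_restrict_closedBall_natCast {c : ℚ_[p]} (hc : ‖c‖ ≤ 1) (k : ℕ) :
    (unitHaar p).restrict (closedBall c ((p : ℝ) ^ (-k : ℤ))) =
      ‖(p : ℚ_[p]) ^ k‖ₑ • (unitHaar p).map fun t => c + (p : ℚ_[p]) ^ k * t := by
  have hpre : (fun t => c + t) ⁻¹' closedBall c ((p : ℝ) ^ (-k : ℤ)) =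
      {t : ℚ_[p] | ‖t‖ ≤ ‖(p : ℚ_[p]) ^ k‖} := by
    ext t; simp
  rw [← unitHaar_map_add hc, Measure.restrict_map (measurable_const_add c)
    measurableSet_closedBall, hpre, unitHaar_restrict_norm_le
      (by rw [norm_natCast_pow]; exact zpow_neg_natCast_le_one k), Measure.map_smul,
    Measure.map_map (measurable_const_add c) (measurable_const_mul _), unitHaar_map_add hc]
  rfl

lemma unitHaar_eq_sum (k : ℕ) : unitHaar p = ∑ c ∈ Finset.range (p ^ k),
    ‖(p : ℚ_[p]) ^ k‖₊ • (unitHaar p).map fun t => (c : ℚ_[p]) + (p : ℚ_[p]) ^ k * t := by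
  conv_lhs => rw [← unitHaar_restrict_closedBall, closedBall_one_eq_biUnion k,
    restrict_biUnion_finset (pairwiseDisjoint_closedBall k) fun _ => measurableSet_closedBall]
  rw [Measure.sum_fintype, Finset.sum_coe_sort (Finset.range (p ^ k)) fun c : ℕ =>
    (unitHaar p).restrict (closedBall (c : ℚ_[p]) ((p : ℝ) ^ (-k : ℤ)))]
  exact Finset.sum_congr rfl fun c _ =>
    unitHaar_restrict_closedBall_natCast (norm_natCast_le_one c) k

lemma Nice.update {i : Fin n} {φ : (Fin n → ℚ_[p]) → ℚ_[p]} (h : Mono 1 φ)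
    (h1 : ∀ y ∈ polydisc p n, ‖φ y‖ ≤ 1) :
    Nice 1 fun y : Fin n → ℚ_[p] => Function.update y i (φ y) := by
  refine ⟨fun y hy => mem_polydisc.2 fun j => ?_, fun j => ?_⟩
  · rcases eq_or_ne j i with rfl | hj
    · simpa using h1 y hy
    · simpa [hj] using mem_polydisc.1 hy j
  · rcases eq_or_ne j i with rfl | hj
    · simpa using h
    · simpa [hj] using Mono.coord j

/-- Decompose along all coordinates successively. -/
lemma unitPi_mem_good_of_forall_coord {R : ((Fin n → ℚ_[p]) → ℚ_[p]) → Prop}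
    (hR : ∀ h g, R h → Nice 1 g → R (h ∘ g))
    (h : ∀ i, unitPi p n ∈ Good n fun f : (Fin n → ℚ_[p]) → Fin n → ℚ_[p] =>
      Nice 1 f ∧ (∀ j ≠ i, ∀ y, f y j = y j) ∧ R fun y => f y i) :
    unitPi p n ∈ Good n fun f : (Fin n → ℚ_[p]) → Fin n → ℚ_[p] =>
      Nice 1 f ∧ ∀ j, R fun y => f y j := by
  classical
  have key : ∀ s : Finset (Fin n), unitPi p n ∈ Good n
      fun f : (Fin n → ℚ_[p]) → Fin n → ℚ_[p] => Nice 1 f ∧ ∀ j ∈ s, R fun y => f y j := by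
    intro s
    induction s using Finset.induction_on with
    | empty =>
      refine Submodule.subset_span ⟨id, fun _ => 1, analyticOnNhd_id,
        ⟨Nice.id, by simp⟩, Mono.const one_ne_zero, by simp⟩
    | insert i s hi ih =>
      refine Good.of_unitPi ih (fun g hg => hg.1) (h i) fun f g hf hg => ⟨hf.1.comp hg.1, ?_⟩
      intro j hj
      rcases eq_or_ne j i with rfl | hji
      · exact hR _ _ hf.2.2 hg.1
      · simpa [hf.2.1 j hji] using hg.2 j ((Finset.mem_insert.1 hj).resolve_left hji)
  exact Good.mono (key Finset.univ) fun f _ hf => ⟨hf.1, fun j => hf.2 j (Finset.mem_univ j)⟩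

lemma isUnitOn_add {c : ℚ_[p]} {v : (Fin n → ℚ_[p]) → ℚ_[p]}
    (hv : AnalyticOnNhd ℚ_[p] v (polydisc p n)) (h : ∀ y ∈ polydisc p n, ‖v y‖ < ‖c‖) :
    IsUnitOn fun y => c + v y :=
  ⟨analyticOnNhd_const.add hv, ‖c‖, (norm_nonneg _).trans_lt (h 0 zero_mem_polydisc), fun y hy => by
    rw [IsUltrametricDist.norm_add_eq_max_of_norm_ne_norm (h y hy).ne', max_eq_left (h y hy).le]⟩

/-- The polydisc decomposes into arbitrarily small polydiscs. -/
lemma unitPi_mem_good_small (k : ℕ) : unitPi p n ∈ Good n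
    fun f : (Fin n → ℚ_[p]) → Fin n → ℚ_[p] => Nice 1 f ∧ ∀ j, ∀ y ∈ polydisc p n,
      ∀ y' ∈ polydisc p n, ‖f y j - f y' j‖ ≤ (p : ℝ) ^ (-k : ℤ) := by
  refine unitPi_mem_good_of_forall_coord
    (R := fun h => ∀ y ∈ polydisc p n, ∀ y' ∈ polydisc p n, ‖h y - h y'‖ ≤ (p : ℝ) ^ (-k : ℤ))
    (fun h g hh hg y hy y' hy' => hh _ (hg.1 hy) _ (hg.1 hy')) fun i => ?_
  have hsmall : ∀ y ∈ polydisc p n, ‖(p : ℚ_[p]) ^ k * y i‖ ≤ (p : ℝ) ^ (-k : ℤ) := by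
    intro y hy
    rw [norm_mul, norm_natCast_pow]
    exact mul_le_of_le_one_right (by positivity) (mem_polydisc.1 hy i)
  have hmono : ∀ c ∈ Finset.range (p ^ k), Mono 1 fun y : Fin n → ℚ_[p] =>
      (c : ℚ_[p]) + (p : ℚ_[p]) ^ k * y i := by
    intro c hc
    rcases eq_or_ne c 0 with rfl | hc0
    · simpa using (Mono.const (pow_ne_zero k p_ne_zero)).mul (Mono.coord i)
    · refine Mono.of_unit (isUnitOn_add
        (analyticOnNhd_const.mul (analyticOnNhd_coord i _)) fun y hy => (hsmall y hy).trans_lt ?_)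
      by_contra hlt
      exact hc0 (natCast_eq_of_close (p := p) (Finset.mem_range.1 hc) (pow_pos hp.out.pos k)
        (by simpa using not_lt.1 hlt))
  have hN : ∀ c ∈ Finset.range (p ^ k), Nice 1 fun y : Fin n → ℚ_[p] =>
      Function.update y i ((c : ℚ_[p]) + (p : ℚ_[p]) ^ k * y i) := fun c hc =>
    Nice.update (hmono c hc) fun y hy => (Padic.nonarchimedean _ _).trans
      (max_le (norm_natCast_le_one c) ((hsmall y hy).trans (zpow_neg_natCast_le_one k)))
  refine unitPi_mem_good_of_coord (Finset.range (p ^ k)) (fun _ => ‖(p : ℚ_[p]) ^ k‖₊)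
    (fun c t => (c : ℚ_[p]) + (p : ℚ_[p]) ^ k * t) (fun _ _ => 1) (fun c _ => by fun_prop)
    (fun c _ => measurable_const) (by simpa using unitHaar_eq_sum k) i hN
    (fun c _ => Mono.const one_ne_zero) fun c hc => ⟨hN c hc, fun j hj y => by simp [hj], ?_⟩
  intro y hy y' hy'
  simp only [Function.update_self, add_sub_add_left_eq_sub]
  exact (norm_sub_le_max' _ _).trans (max_le (hsmall y hy) (hsmall y' hy'))

lemma unitPi_restrict_mem_good {W : Set (Fin n → ℚ_[p])} (hW : IsClopen W) :
    (unitPi p n).restrict W ∈ Good n fun f : (Fin n → ℚ_[p]) → Fin n → ℚ_[p] =>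
      Nice 1 f ∧ MapsTo f (polydisc p n) W := by
  obtain ⟨δ, hδ, hL⟩ := lebesgue_number_lemma_of_metric (c := fun b : Bool => cond b W Wᶜ)
    (isCompact_polydisc (p := p) (n := n))
    (by rintro (_ | _); exacts [hW.1.isOpen_compl, hW.2])
    (by intro x _; by_cases hx : x ∈ W
        · exact mem_iUnion.2 ⟨true, hx⟩
        · exact mem_iUnion.2 ⟨false, hx⟩)
  obtain ⟨k, hk⟩ := exists_pow_lt_of_lt_one hδ
    (inv_lt_one_of_one_lt₀ (show (1 : ℝ) < p by exact_mod_cast hp.out.one_lt))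
  have hk' : (p : ℝ) ^ (-k : ℤ) < δ := by rwa [zpow_neg, zpow_natCast, ← inv_pow]
  have key := unitPi_mem_good_small (p := p) (n := n) k
  set κ := unitPi p n
  clear_value κ
  induction key using Submodule.span_induction with
  | mem κ hκ =>
    obtain ⟨f, J, hf, ⟨hN, hs⟩, hJ, rfl⟩ := hκ
    have hball : ∀ y ∈ polydisc p n, f y ∈ ball (f 0) δ := fun y hy => by
      rw [mem_ball, dist_eq_norm]
      refine lt_of_le_of_lt ((pi_norm_le_iff_of_nonneg (by positivity)).2 fun j => ?_) hk'
      exact hs j y hy 0 zero_mem_polydisc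
    have hac := withDensity_absolutelyContinuous (unitPi p n) fun y => ‖J y‖ₑ
    have hf' := (aemeasurable_unitPi hf.continuousOn).mono_ac hac
    obtain ⟨b, hb⟩ := hL (f 0) (hN.1 zero_mem_polydisc)
    rcases b with _ | _
    · rw [Measure.restrict_eq_zero.2]
      · exact zero_mem _
      · rw [Measure.map_apply_of_aemeasurable hf' hW.2.measurableSet]
        refine measure_mono_null (t := (polydisc p n)ᶜ) (fun y hy hy' => hb (hball y hy') hy) ?_
        exact hac.ae_le ae_unitPi
    · rw [Measure.restrict_eq_self_of_ae_mem]
      · exact Submodule.subset_span ⟨f, J, hf, ⟨hN, fun y hy => hb (hball y hy)⟩, hJ, rfl⟩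
      · exact (ae_map_iff hf' hW.2.measurableSet).2
          (hac.ae_le (ae_unitPi.mono fun y hy => hb (hball y hy)))
  | zero => simp
  | add κ₁ κ₂ _ _ h1 h2 => rw [Measure.restrict_add]; exact add_mem h1 h2
  | smul c κ _ h1 => rw [Measure.restrict_smul]; exact Submodule.smul_mem _ c h1

section Good

variable {X : Type*} [NormedAddCommGroup X] [NormedSpace ℚ_[p] X] [MeasurableSpace X]
  [BorelSpace X] {P : ((Fin n → ℚ_[p]) → X) → Prop}

lemma Good.restrict {κ : Measure X} (hκ : κ ∈ Good n P)
    (hP : ∀ f g, P f → Nice 1 g → P (f ∘ g)) {W : Set X} (hW : IsClopen W) :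
    κ.restrict W ∈ Good n fun f => P f ∧ MapsTo f (polydisc p n) W := by
  induction hκ using Submodule.span_induction with
  | mem κ hκ =>
    obtain ⟨f, J, hf, hPf, hJ, rfl⟩ := hκ
    have hac := withDensity_absolutelyContinuous (unitPi p n) fun y => ‖J y‖ₑ
    have hf' := (aemeasurable_unitPi hf.continuousOn).mono_ac hac
    have hW' : IsClopen (polydisc p n ∩ f ⁻¹' W) :=
      ⟨hf.continuousOn.preimage_isClosed_of_isClosed isClopen_polydisc.1 hW.1,
        hf.continuousOn.isOpen_inter_preimage isOpen_polydisc hW.2⟩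
    have hset : f ⁻¹' W =ᵐ[(unitPi p n).withDensity fun y => ‖J y‖ₑ] (polydisc p n ∩ f ⁻¹' W :
        Set _) := hac.ae_le (ae_unitPi.mono fun y hy => propext ⟨fun h => ⟨hy, h⟩, fun h => h.2⟩)
    rw [Measure.restrict_map_of_aemeasurable hf' hW.2.measurableSet,
      Measure.restrict_congr_set hset, restrict_withDensity hW'.2.measurableSet]
    exact Good.subdivide (unitPi_restrict_mem_good hW') (fun g hg => hg.1) hf hJ
      fun g hg => ⟨hP f g hPf hg.1, fun y hy => (hg.2 hy).2⟩
  | zero => simp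
  | add κ₁ κ₂ _ _ h1 h2 => rw [Measure.restrict_add]; exact add_mem h1 h2
  | smul c κ _ h1 => rw [Measure.restrict_smul]; exact Submodule.smul_mem _ c h1

lemma Good.of_local {μ : Measure X} {W : Set X} (hW : IsCompact W) (hW' : IsClopen W)
    (hP : ∀ f g, P f → Nice 1 g → P (f ∘ g))
    (h : ∀ x ∈ W, ∃ V ∈ 𝓝 x, IsClopen V ∧ μ.restrict V ∈ Good n P) :
    μ.restrict W ∈ Good n fun f => P f ∧ MapsTo f (polydisc p n) W := by
  obtain ⟨V, hWV, hV, hG⟩ : ∃ V, W ⊆ V ∧ IsClopen V ∧ μ.restrict V ∈ Good n P := by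
    refine hW.induction_on (p := fun S => ∃ V, S ⊆ V ∧ IsClopen V ∧ μ.restrict V ∈ Good n P)
      ⟨∅, Subset.rfl, isClopen_empty, by simp⟩ ?_ ?_ ?_
    · rintro S T hST ⟨V, h1, h2⟩
      exact ⟨V, hST.trans h1, h2⟩
    · rintro S T ⟨V₁, h1, hc1, hg1⟩ ⟨V₂, h2, hc2, hg2⟩
      refine ⟨V₁ ∪ V₂, union_subset_union h1 h2, hc1.union hc2, ?_⟩
      rw [← union_sdiff_self, Measure.restrict_union disjoint_sdiff_right
        (hc2.diff hc1).2.measurableSet]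
      refine add_mem hg1 ?_
      have := Good.restrict hg2 hP hc1.compl
      rw [Measure.restrict_restrict hc1.compl.2.measurableSet, inter_comm, ← sdiff_eq] at this
      exact Good.mono this fun f _ hf => hf.1
    · intro x hx
      obtain ⟨V, hV, hc, hg⟩ := h x hx
      exact ⟨V, mem_nhdsWithin_of_mem_nhds hV, V, Subset.rfl, hc, hg⟩
  have := Good.restrict hG hP hW'
  rwa [Measure.restrict_restrict hW'.2.measurableSet, inter_eq_left.2 hWV] at this

end Good

lemma setLIntegral_unitHaar_norm_le {c : ℚ_[p]} (hc : ‖c‖ ≤ 1) {F : ℚ_[p] → ℝ≥0∞}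
    (hF : Measurable F) :
    ∫⁻ t in {t | ‖t‖ ≤ ‖c‖}, F t ∂(unitHaar p) = ‖c‖ₑ * ∫⁻ t, F (c * t) ∂(unitHaar p) := by
  rw [unitHaar_restrict_norm_le hc, lintegral_smul_measure,
    lintegral_map hF (measurable_const_mul c), smul_eq_mul]

lemma measurableSet_norm_le {Y : Type*} [MeasurableSpace Y] {u v : Y → ℚ_[p]} (hu : Measurable u)
    (hv : Measurable v) : MeasurableSet {q | ‖u q‖ ≤ ‖v q‖} :=
  measurableSet_le hu.norm hv.norm

/-- Fibrewise scaling of the last variable. -/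
lemma prod_restrict_norm_le {Y : Type*} [MeasurableSpace Y] {μ : Measure Y} [SFinite μ]
    {w : Y → ℚ_[p]} (hw : Measurable w) (h1 : ∀ᵐ y ∂μ, ‖w y‖ ≤ 1) :
    (μ.prod (unitHaar p)).restrict {q | ‖q.2‖ ≤ ‖w q.1‖} =
      ((μ.prod (unitHaar p)).withDensity fun q => ‖w q.1‖ₑ).map fun q => (q.1, w q.1 * q.2) := by
  have hS : MeasurableSet {q : Y × ℚ_[p] | ‖q.2‖ ≤ ‖w q.1‖} :=
    measurableSet_norm_le measurable_snd (hw.comp measurable_fst)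
  have hm : Measurable fun q : Y × ℚ_[p] => (q.1, w q.1 * q.2) :=
    measurable_fst.prodMk ((hw.comp measurable_fst).mul measurable_snd)
  have hw' : Measurable fun q : Y × ℚ_[p] => ‖w q.1‖ₑ := (hw.comp measurable_fst).enorm
  refine Measure.ext_of_lintegral _ fun F hF => ?_
  rw [lintegral_map_withDensity hw' hm hF, ← lintegral_indicator hS,
    lintegral_prod _ (hF.indicator hS).aemeasurable,
    lintegral_prod (fun q => ‖w q.1‖ₑ * F (q.1, w q.1 * q.2)) (hw'.mul (hF.comp hm)).aemeasurable]
  refine lintegral_congr_ae (h1.mono fun y hy => ?_)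
  have hFy : Measurable fun t => F (y, t) := hF.comp measurable_prodMk_left
  have hFy' : Measurable fun t => F (y, w y * t) := hFy.comp (measurable_const_mul _)
  simp only
  rw [lintegral_const_mul _ hFy', ← setLIntegral_unitHaar_norm_le hy hFy,
    ← lintegral_indicator (show MeasurableSet {t : ℚ_[p] | ‖t‖ ≤ ‖w y‖} from
      measurableSet_norm_le measurable_id measurable_const)]
  rfl

/-- Scaling of one coordinate by a function of the others. -/
lemma unitPi_restrict_norm_le (i : Fin n) {w : (Fin n → ℚ_[p]) → ℚ_[p]} (hw : Measurable w)
    (h1 : ∀ y ∈ polydisc p n, ‖w y‖ ≤ 1) (hi : ∀ y t, w (Function.update y i t) = w y) :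
    (unitPi p n).restrict {y | ‖y i‖ ≤ ‖w y‖} =
      ((unitPi p n).withDensity fun y => ‖w y‖ₑ).map fun y => Function.update y i (w y * y i) := by
  have hu := measurable_update_pair (p := p) i
  have hS : MeasurableSet {y : Fin n → ℚ_[p] | ‖y i‖ ≤ ‖w y‖} :=
    measurableSet_norm_le (measurable_pi_apply i) hw
  have hm : Measurable fun y : Fin n → ℚ_[p] => Function.update y i (w y * y i) :=
    hu.comp (measurable_id.prodMk (hw.mul (measurable_pi_apply i)))
  have hm' : Measurable fun q : (Fin n → ℚ_[p]) × ℚ_[p] => (q.1, w q.1 * q.2) :=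
    measurable_fst.prodMk ((hw.comp measurable_fst).mul measurable_snd)
  conv_lhs => rw [← map_update_unitPi i]
  rw [Measure.restrict_map hu hS]
  have hpre : (fun q : (Fin n → ℚ_[p]) × ℚ_[p] => Function.update q.1 i q.2) ⁻¹'
      {y | ‖y i‖ ≤ ‖w y‖} = {q | ‖q.2‖ ≤ ‖w q.1‖} := by
    ext q; simp [hi]
  rw [hpre, prod_restrict_norm_le hw (ae_unitPi.mono h1), Measure.map_map hu hm']
  conv_rhs => rw [← map_update_unitPi i]
  rw [map_withDensity_comp hu.aemeasurable hw.enorm, Measure.map_map hm hu]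
  have e1 : ((fun q : (Fin n → ℚ_[p]) × ℚ_[p] => Function.update q.1 i q.2) ∘
      fun q => (q.1, w q.1 * q.2)) = (fun y => Function.update y i (w y * y i)) ∘
      fun q : (Fin n → ℚ_[p]) × ℚ_[p] => Function.update q.1 i q.2 := by
    ext q : 1; simp [hi]
  have e2 : ((fun y => ‖w y‖ₑ) ∘ fun q : (Fin n → ℚ_[p]) × ℚ_[p] => Function.update q.1 i q.2) =
      fun q => ‖w q.1‖ₑ := by
    ext q; simp [hi]
  rw [e1, e2]

lemma ae_coord_ne_zero (i : Fin n) : ∀ᵐ y ∂(unitPi p n), y i ≠ 0 := by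
  have : NullSingletonClass (unitHaar p) := by unfold unitHaar; infer_instance
  exact measure_eq_zero_iff_ae_notMem.1
    (Measure.pi_hyperplane (μ := fun _ : Fin n => unitHaar p) i 0)

lemma norm_le_of_lt {a b : ℚ_[p]} (h : ‖a‖ < ‖b‖) : ‖a‖ ≤ ‖(p : ℚ_[p]) * b‖ := by
  have hb : 0 < ‖b‖ := (norm_nonneg a).trans_lt h
  have h1 : ‖a / b‖ < 1 := by rwa [norm_div, div_lt_one hb]
  have h2 := (Padic.norm_le_pow_iff_norm_lt_pow_add_one (a / b) (-1)).2 (by simpa using h1)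
  rw [norm_div, div_le_iff₀ hb] at h2
  rw [norm_mul, Padic.norm_p]
  simpa using h2

lemma norm_p_lt_one : ‖(p : ℚ_[p])‖ < 1 := Padic.norm_p_lt_one

/-- The part of the polydisc where the monomial `γ` is smaller than the coordinate `i`. -/
lemma unitPi_restrict_mon_lt_mem_good (i : Fin n) (k : ℕ) (γ : Fin n → ℕ) (hk : ∑ j, γ j = k)
    (hγ : γ i = 0) :
    (unitPi p n).restrict {y | ‖mon γ y‖ < ‖y i‖} ∈ Good n
      fun f : (Fin n → ℚ_[p]) → Fin n → ℚ_[p] => Nice 1 f ∧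
        ∃ s, AnalyticOnNhd ℚ_[p] s (polydisc p n) ∧ (∀ y ∈ polydisc p n, ‖s y‖ < 1) ∧
          ∀ y ∈ polydisc p n, mon γ (f y) = f y i * s y := by
  classical
  induction k generalizing γ with
  | zero =>
    have : γ = 0 := by
      ext j; simpa using (Finset.sum_eq_zero_iff.1 hk) j (Finset.mem_univ j)
    subst this
    rw [Measure.restrict_eq_zero.2]
    · exact zero_mem _
    · refine measure_mono_null (t := (polydisc p n)ᶜ) (fun y hy hy' => ?_) ae_unitPi
      simp only [mon_zero, norm_one, mem_ofPred_eq] at hy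
      exact absurd (mem_polydisc.1 hy' i) (not_le.2 hy)
  | succ k ih =>
    obtain ⟨j, hj⟩ : ∃ j, γ j ≠ 0 := by
      by_contra! h
      simp [h] at hk
    have hji : j ≠ i := fun h => hj (h ▸ hγ)
    obtain ⟨γ', rfl⟩ : ∃ γ', γ = γ' + Pi.single j 1 :=
      ⟨γ - Pi.single j 1, by
        ext l
        rcases eq_or_ne l j with rfl | hl
        · simp; omega
        · simp [hl]⟩
    have hγ' : γ' i = 0 := by simpa [hji.symm] using hγ
    have hk' : ∑ j, γ' j = k := by
      simp [Finset.sum_add_distrib] at hk; omega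
    have hmon : ∀ y : Fin n → ℚ_[p], mon (γ' + Pi.single j 1) y = mon γ' y * y j := fun y => by
      rw [mon_add, mon_single]
    have hupd : ∀ (y : Fin n → ℚ_[p]) t, mon γ' (Function.update y i t) = mon γ' y := by
      intro y t
      unfold mon
      refine Finset.prod_congr rfl fun l _ => ?_
      rcases eq_or_ne l i with rfl | hl
      · simp [hγ']
      · simp [hl]
    have hR' : MeasurableSet {y : Fin n → ℚ_[p] | ‖mon γ' y‖ < ‖y i‖} :=
      measurableSet_lt (continuous_mon _).measurable.norm (measurable_pi_apply i).norm
    have hR : MeasurableSet {y : Fin n → ℚ_[p] | ‖mon (γ' + Pi.single j 1) y‖ < ‖y i‖} :=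
      measurableSet_lt (continuous_mon _).measurable.norm (measurable_pi_apply i).norm
    have hS : MeasurableSet {y : Fin n → ℚ_[p] | ‖y i‖ ≤ ‖y j‖} :=
      measurableSet_norm_le (measurable_pi_apply i) (measurable_pi_apply j)
    rw [← Measure.restrict_inter_add_sdiff _ hS]
    refine add_mem ?_ ?_
    · -- the chart `y i ↦ y j * y i`
      rw [← Measure.restrict_restrict hR, unitPi_restrict_norm_le (w := fun y => y j) i
        (measurable_pi_apply j) (fun y hy => mem_polydisc.1 hy j) (fun y t => by simp [hji])]
      have hT : Measurable fun y : Fin n → ℚ_[p] => Function.update y i (y j * y i) :=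
        (measurable_update_pair i).comp
          (measurable_id.prodMk ((measurable_pi_apply j).mul (measurable_pi_apply i)))
      have hdens : ((unitPi p n).restrict ((fun y : Fin n → ℚ_[p] =>
          Function.update y i (y j * y i)) ⁻¹'
            {y | ‖mon (γ' + Pi.single j 1) y‖ < ‖y i‖})).withDensity (fun y => ‖y j‖ₑ) =
          ((unitPi p n).restrict {y | ‖mon γ' y‖ < ‖y i‖}).withDensity fun y => ‖y j‖ₑ := by
        rw [← withDensity_indicator (hT hR), ← withDensity_indicator hR']
        congr 1
        ext y
        rcases eq_or_ne (y j) 0 with h0 | h0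
        · simp [indicator, h0]
        · have := norm_pos_iff.2 h0
          simp [indicator, hmon, hupd, hji, mul_comm ‖y j‖, mul_lt_mul_iff_left₀ this]
      rw [Measure.restrict_map hT hR, restrict_withDensity (hT hR), hdens]
      have hTN : Nice 1 fun y : Fin n → ℚ_[p] => Function.update y i (y j * y i) :=
        Nice.update ((Mono.coord j).mul (Mono.coord i)) fun y hy => by
          rw [norm_mul]
          exact mul_le_one₀ (mem_polydisc.1 hy j) (norm_nonneg _) (mem_polydisc.1 hy i)
      refine Good.refine (ih γ' hk' hγ') measurableSet_polydisc hTN.analyticOnNhd.continuousOn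
        (continuous_apply j).continuousOn ?_
      rintro g - ⟨hg, s, hs, hs1, hgs⟩
      refine ⟨hg.1, (hTN.comp hg).analyticOnNhd, ⟨hTN.comp hg, s, hs, hs1, fun y hy => ?_⟩, hg.2 j⟩
      simp only [Function.comp, hmon, hupd, hgs y hy, Function.update_self, ne_eq, hji,
        not_false_eq_true, Function.update_of_ne]
      ring
    · -- the chart `y j ↦ p * y i * y j`
      have hset : ({y | ‖mon (γ' + Pi.single j 1) y‖ < ‖y i‖} \ {y | ‖y i‖ ≤ ‖y j‖} : Set _)
          =ᵐ[unitPi p n] {y : Fin n → ℚ_[p] | ‖y j‖ ≤ ‖(p : ℚ_[p]) * y i‖} := by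
        filter_upwards [ae_unitPi, ae_coord_ne_zero i] with y hy hi0
        refine propext ⟨fun h => norm_le_of_lt (not_le.1 h.2), fun h => ?_⟩
        have hlt : ‖y j‖ < ‖y i‖ := by
          refine lt_of_le_of_lt h ?_
          rw [norm_mul]
          exact mul_lt_of_lt_one_left (norm_pos_iff.2 hi0) norm_p_lt_one
        refine ⟨?_, not_le.2 hlt⟩
        simp only [mem_ofPred_eq, hmon, norm_mul]
        exact lt_of_le_of_lt (mul_le_of_le_one_left (norm_nonneg _) (norm_mon_le_one γ' hy)) hlt
      have hle : ∀ y ∈ polydisc p n, ‖(p : ℚ_[p]) * y i‖ ≤ 1 := fun y hy => by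
        rw [norm_mul]
        exact mul_le_one₀ norm_p_lt_one.le (norm_nonneg _) (mem_polydisc.1 hy i)
      have hmono : Mono 1 fun y : Fin n → ℚ_[p] => (p : ℚ_[p]) * y i :=
        (Mono.const p_ne_zero).mul (Mono.coord i)
      have hTN : Nice 1 fun y : Fin n → ℚ_[p] => Function.update y j ((p : ℚ_[p]) * y i * y j) :=
        Nice.update (hmono.mul (Mono.coord j)) fun y hy => by
          rw [norm_mul]
          exact mul_le_one₀ (hle y hy) (norm_nonneg _) (mem_polydisc.1 hy j)
      rw [Measure.restrict_congr_set hset, unitPi_restrict_norm_le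
        (w := fun y => (p : ℚ_[p]) * y i) j (by fun_prop) hle (fun y t => by simp [hji.symm])]
      refine Submodule.subset_span ⟨_, _, hTN.analyticOnNhd, ⟨hTN, fun y => (p : ℚ_[p]) * y j *
        mon γ' (Function.update y j ((p : ℚ_[p]) * y i * y j)), ?_, fun y hy => ?_, fun y hy => ?_⟩,
        hmono, rfl⟩
      · exact (analyticOnNhd_const.mul (analyticOnNhd_coord j _)).mul
          ((analyticOnNhd_mon γ' _).comp hTN.analyticOnNhd hTN.1)
      · rw [norm_mul, norm_mul]
        exact lt_of_le_of_lt (mul_le_of_le_one_right (by positivity) (norm_mon_le_one _ (hTN.1 hy)))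
          (lt_of_le_of_lt (mul_le_of_le_one_right (by positivity) (mem_polydisc.1 hy j))
            norm_p_lt_one)
      · simp only [hmon, Function.update_self, ne_eq, hji.symm, not_false_eq_true,
          Function.update_of_ne]
        ring

lemma exists_pow_neg_lt {r : ℝ} (hr : 0 < r) : ∃ k : ℕ, 1 ≤ k ∧ (p : ℝ) ^ (-k : ℤ) ≤ r := by
  obtain ⟨k, hk⟩ := exists_pow_lt_of_lt_one hr (norm_p_lt_one (p := p))
  refine ⟨k + 1, by omega, ?_⟩
  rw [← norm_natCast_pow, norm_pow, pow_succ]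
  exact (mul_le_of_le_one_right (by positivity) norm_p_lt_one.le).trans hk.le

lemma norm_eq_of_sub_lt {a b : ℚ_[p]} (h : ‖a - b‖ < ‖b‖) : ‖a‖ = ‖b‖ := by
  have := IsUltrametricDist.norm_add_eq_max_of_norm_ne_norm h.ne
  rw [sub_add_cancel, max_eq_right h.le] at this
  exact this

lemma exists_pow_eq {N : ℕ} (hN : N ≠ 0) : ∃ k : ℕ, 1 ≤ k ∧ ∀ u : ℚ_[p],
    ‖u - 1‖ ≤ (p : ℝ) ^ (-k : ℤ) → ∃ a : ℚ_[p], ‖a‖ = 1 ∧ a ^ N = u := by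
  have hd : HasStrictDerivAt (fun z : ℚ_[p] => z ^ N) (N : ℚ_[p]) 1 := by
    simpa using hasStrictDerivAt_pow N (1 : ℚ_[p])
  have h1 := hd.map_nhds_eq (by exact_mod_cast hN)
  have h2 : range (fun z : ℚ_[p] => z ^ N) ∈ 𝓝 (1 : ℚ_[p]) := by
    rw [one_pow] at h1
    rw [← h1]
    exact range_mem_map
  obtain ⟨r, hr, hr'⟩ := Metric.nhds_basis_closedBall.mem_iff.1 h2
  obtain ⟨k, hk, hk'⟩ := exists_pow_neg_lt (p := p) hr
  refine ⟨k, hk, fun u hu => ?_⟩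
  obtain ⟨a, rfl⟩ := hr' (mem_closedBall_iff_norm.2 (hu.trans hk'))
  refine ⟨a, ?_, rfl⟩
  have h3 : ‖a ^ N - 1‖ < ‖(1 : ℚ_[p])‖ := by
    refine hu.trans_lt ?_
    rw [← norm_natCast_pow, norm_pow, norm_one]
    exact pow_lt_one₀ (norm_nonneg _) norm_p_lt_one (by omega)
  have h4 := norm_eq_of_sub_lt h3
  rw [norm_pow, norm_one] at h4
  exact (pow_eq_one_iff_of_nonneg (norm_nonneg _) hN).1 h4

instance : NullSingletonClass (unitHaar p) := by unfold unitHaar; infer_instance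

lemma lintegral_unitHaar_mul_left {a : ℚ_[p]} (ha : ‖a‖ = 1) {F : ℚ_[p] → ℝ≥0∞}
    (hF : Measurable F) : ∫⁻ t, F (a * t) ∂(unitHaar p) = ∫⁻ t, F t ∂(unitHaar p) := by
  have h := setLIntegral_unitHaar_norm_le ha.le hF
  have h1 : {t : ℚ_[p] | ‖t‖ ≤ ‖a‖} = closedBall 0 1 := by ext; simp [ha]
  have h2 : ‖a‖ₑ = 1 := by rw [← ofReal_norm, ha]; simp
  rw [h1, unitHaar_restrict_closedBall, h2, one_mul] at h
  exact h.symm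

/-- The integral of `Φ` against the image of `‖z ^ (N - 1)‖ dz` under `z ↦ u * z ^ N`. -/
noncomputable def powInt (N : ℕ) (Φ : ℚ_[p] → ℝ≥0∞) (u : ℚ_[p]) : ℝ≥0∞ :=
  ∫⁻ z, ‖z ^ (N - 1)‖ₑ * Φ (u * z ^ N) ∂(unitHaar p)

lemma powInt_mul_pow (N : ℕ) {Φ : ℚ_[p] → ℝ≥0∞} (hΦ : Measurable Φ) (u : ℚ_[p]) {a : ℚ_[p]}
    (ha : ‖a‖ = 1) : powInt N Φ (u * a ^ N) = powInt N Φ u := by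
  unfold powInt
  have hm : Measurable fun z : ℚ_[p] => ‖z ^ (N - 1)‖ₑ * Φ (u * z ^ N) := by fun_prop
  rw [← lintegral_unitHaar_mul_left ha hm]
  refine lintegral_congr fun z => ?_
  have h2 : ‖a‖ₑ = 1 := by rw [← ofReal_norm, ha]; simp
  rw [mul_pow, mul_pow, enorm_mul, enorm_pow a, h2, one_pow, one_mul, mul_assoc]

lemma measurableSet_sphere (r : ℝ) : MeasurableSet {z : ℚ_[p] | ‖z‖ = r} :=
  measurableSet_eq_fun measurable_norm measurable_const

lemma lintegral_sphere {c : ℚ_[p]} (hc : ‖c‖ ≤ 1) (h0 : c ≠ 0) {F : ℚ_[p] → ℝ≥0∞}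
    (hF : Measurable F) :
    ∫⁻ z, {z : ℚ_[p] | ‖z‖ = ‖c‖}.indicator F z ∂(unitHaar p) =
      ‖c‖ₑ * ∫⁻ t, {z : ℚ_[p] | ‖z‖ = 1}.indicator (fun t => F (c * t)) t ∂(unitHaar p) := by
  have h := setLIntegral_unitHaar_norm_le hc (hF.indicator (measurableSet_sphere ‖c‖))
  rw [setLIntegral_eq_of_support_subset fun t ht => ?_] at h
  · rw [h]
    congr 1
    refine lintegral_congr fun t => ?_
    have hc' : ‖c‖ ≠ 0 := norm_ne_zero_iff.2 h0
    have : c * t ∈ {z : ℚ_[p] | ‖z‖ = ‖c‖} ↔ t ∈ {z : ℚ_[p] | ‖z‖ = 1} := by simp [hc']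
    by_cases ht : t ∈ {z : ℚ_[p] | ‖z‖ = 1}
    · rw [indicator_of_mem ht, indicator_of_mem (this.2 ht)]
    · rw [indicator_of_notMem ht, indicator_of_notMem (mt this.1 ht)]
  · exact le_of_eq (support_indicator_subset ht : t ∈ {z : ℚ_[p] | ‖z‖ = ‖c‖})

lemma lintegral_sphere_inv {c : ℚ_[p]} (hc : ‖c‖ ≤ 1) (h0 : c ≠ 0) :
    ∫⁻ z, ({z : ℚ_[p] | ‖z‖ = ‖c‖}.indicator fun z => ‖z‖ₑ⁻¹) z ∂(unitHaar p) =
      unitHaar p {z | ‖z‖ = 1} := by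
  rw [lintegral_sphere (F := fun z => ‖z‖ₑ⁻¹) hc h0 measurable_enorm.inv, ← lintegral_const_mul _
    (by exact Measurable.indicator (by fun_prop) (measurableSet_sphere 1)),
    ← lintegral_indicator_one (measurableSet_sphere 1)]
  refine lintegral_congr fun t => ?_
  by_cases ht : t ∈ {z : ℚ_[p] | ‖z‖ = 1}
  · have e : ‖t‖ₑ = 1 := by rw [← ofReal_norm, show ‖t‖ = 1 from ht]; simp
    rw [indicator_of_mem ht, indicator_of_mem ht, enorm_mul, e, mul_one,
      ENNReal.mul_inv_cancel (by simpa using h0) (by simp)]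
    rfl
  · rw [indicator_of_notMem ht, indicator_of_notMem ht, mul_zero]

lemma lintegral_powInt {N : ℕ} (hN : N ≠ 0) {Φ : ℚ_[p] → ℝ≥0∞} (hΦ : Measurable Φ) {c : ℚ_[p]}
    (hc : ‖c‖ ≤ 1) (h0 : c ≠ 0) :
    ‖c‖ₑ * ∫⁻ u, {u : ℚ_[p] | ‖u‖ = 1}.indicator (fun u => powInt N Φ (u * c)) u ∂(unitHaar p) =
      ∫⁻ y, Φ y * ∫⁻ z, {z : ℚ_[p] | ‖c * z ^ N‖ = ‖y‖}.indicator (fun z => ‖z‖ₑ⁻¹) z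
        ∂(unitHaar p) ∂(unitHaar p) := by
  have hS : MeasurableSet {q : ℚ_[p] × ℚ_[p] | ‖c * q.2 ^ N‖ = ‖q.1‖} :=
    measurableSet_eq_fun (by fun_prop) (by fun_prop)
  have hU : MeasurableSet {q : ℚ_[p] × ℚ_[p] | ‖q.1‖ = 1} :=
    measurableSet_eq_fun (by fun_prop) (by fun_prop)
  have hg : Measurable fun q : ℚ_[p] × ℚ_[p] =>
      {q : ℚ_[p] × ℚ_[p] | ‖c * q.2 ^ N‖ = ‖q.1‖}.indicator
      (fun q => Φ q.1 * ‖q.2‖ₑ⁻¹) q := Measurable.indicator (by fun_prop) hS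
  have hf : Measurable fun q : ℚ_[p] × ℚ_[p] => {q : ℚ_[p] × ℚ_[p] | ‖q.1‖ = 1}.indicator
      (fun q => ‖q.2 ^ (N - 1)‖ₑ * Φ (q.1 * c * q.2 ^ N)) q := Measurable.indicator (by fun_prop) hU
  calc
    _ = ‖c‖ₑ * ∫⁻ u, ∫⁻ z, {q : ℚ_[p] × ℚ_[p] | ‖q.1‖ = 1}.indicator
      (fun q => ‖q.2 ^ (N - 1)‖ₑ * Φ (q.1 * c * q.2 ^ N)) (u, z) ∂(unitHaar p) ∂(unitHaar p) := by
        congr 1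
        refine lintegral_congr fun u => ?_
        by_cases hu : ‖u‖ = 1 <;> simp [indicator, hu, powInt]
    _ = ‖c‖ₑ * ∫⁻ z, ∫⁻ u, {q : ℚ_[p] × ℚ_[p] | ‖q.1‖ = 1}.indicator
      (fun q => ‖q.2 ^ (N - 1)‖ₑ * Φ (q.1 * c * q.2 ^ N)) (u, z) ∂(unitHaar p) ∂(unitHaar p) := by
        rw [lintegral_lintegral_swap hf.aemeasurable]
    _ = ∫⁻ z, ∫⁻ y, {q : ℚ_[p] × ℚ_[p] | ‖c * q.2 ^ N‖ = ‖q.1‖}.indicator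
      (fun q => Φ q.1 * ‖q.2‖ₑ⁻¹) (y, z) ∂(unitHaar p) ∂(unitHaar p) := by
        rw [← lintegral_const_mul _ hf.lintegral_prod_left']
        refine lintegral_congr_ae ?_
        filter_upwards [ae_unitHaar, (measure_eq_zero_iff_ae_notMem.1
          (measure_singleton (μ := unitHaar p) (0 : ℚ_[p])))] with z hz1 hz0
        have hz0 : z ≠ 0 := hz0
        have hw : ‖c * z ^ N‖ ≤ 1 := by
          rw [norm_mul, norm_pow]
          exact mul_le_one₀ hc (by positivity) (pow_le_one₀ (norm_nonneg _) hz1)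
        have hw0 : c * z ^ N ≠ 0 := mul_ne_zero h0 (pow_ne_zero _ hz0)
        have hze : ‖z‖ₑ ≠ 0 := by simpa using hz0
        have e := lintegral_sphere hw hw0 hΦ
        have e1 : ∀ y, {q : ℚ_[p] × ℚ_[p] | ‖c * q.2 ^ N‖ = ‖q.1‖}.indicator
            (fun q => Φ q.1 * ‖q.2‖ₑ⁻¹) (y, z) =
            {y : ℚ_[p] | ‖y‖ = ‖c * z ^ N‖}.indicator Φ y * ‖z‖ₑ⁻¹ := fun y => by
          by_cases hy : ‖y‖ = ‖c * z ^ N‖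
          · simp only [indicator, mem_ofPred_eq, hy, if_true]
          · simp only [indicator, mem_ofPred_eq, hy, Ne.symm hy, if_false, zero_mul]
        have e2 : ∀ u, {q : ℚ_[p] × ℚ_[p] | ‖q.1‖ = 1}.indicator
            (fun q => ‖q.2 ^ (N - 1)‖ₑ * Φ (q.1 * c * q.2 ^ N)) (u, z) = ‖z ^ (N - 1)‖ₑ *
            {y : ℚ_[p] | ‖y‖ = 1}.indicator (fun t => Φ (c * z ^ N * t)) u := fun u => by
          by_cases hu : ‖u‖ = 1
          · simp only [indicator, mem_ofPred_eq, hu, if_true]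
            ring_nf
          · simp only [indicator, mem_ofPred_eq, hu, if_false, mul_zero]
        simp only [e1, e2]
        have hm : Measurable ({y : ℚ_[p] | ‖y‖ = 1}.indicator fun t => Φ (c * z ^ N * t)) :=
          Measurable.indicator (by fun_prop) (measurableSet_sphere 1)
        rw [lintegral_mul_const _ (hΦ.indicator (measurableSet_sphere _)), e,
          lintegral_const_mul _ hm]
        obtain ⟨M, rfl⟩ := Nat.exists_eq_succ_of_ne_zero hN
        rw [enorm_mul, enorm_pow, enorm_pow, Nat.succ_eq_add_one, Nat.add_sub_cancel,
          pow_succ ‖z‖ₑ]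
        have hc1 : ‖z‖ₑ * ‖z‖ₑ⁻¹ = 1 := ENNReal.mul_inv_cancel hze (by simp)
        generalize ∫⁻ t, {y : ℚ_[p] | ‖y‖ = 1}.indicator (fun t => Φ (c * z ^ (M + 1) * t)) t
          ∂(unitHaar p) = I
        calc ‖c‖ₑ * (‖z‖ₑ ^ M * I) = ‖c‖ₑ * ‖z‖ₑ ^ M * I * 1 := by ring
          _ = _ := by rw [← hc1]; ring
    _ = ∫⁻ y, ∫⁻ z, {q : ℚ_[p] × ℚ_[p] | ‖c * q.2 ^ N‖ = ‖q.1‖}.indicator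
      (fun q => Φ q.1 * ‖q.2‖ₑ⁻¹) (y, z) ∂(unitHaar p) ∂(unitHaar p) := by
        exact lintegral_lintegral_swap (hg.comp measurable_swap).aemeasurable
    _ = _ := by
        refine lintegral_congr fun y => ?_
        rw [← lintegral_const_mul _ (Measurable.indicator (by fun_prop)
          (measurableSet_eq_fun (by fun_prop) (by fun_prop)))]
        refine lintegral_congr fun z => ?_
        by_cases hy : ‖c * z ^ N‖ = ‖y‖
        · simp only [indicator, mem_ofPred_eq, hy, if_true]
        · simp only [indicator, mem_ofPred_eq, hy, if_false, mul_zero]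

lemma norm_p_pow_inj {a b : ℕ} (h : ‖(p : ℚ_[p]) ^ a‖ = ‖(p : ℚ_[p]) ^ b‖) : a = b := by
  rw [norm_pow, norm_pow] at h
  exact pow_right_injective₀ (norm_pos_iff.2 p_ne_zero) norm_p_lt_one.ne h

lemma exists_norm_eq_p_pow {c : ℚ_[p]} (hc : ‖c‖ ≤ 1) (h0 : c ≠ 0) :
    ∃ k : ℕ, ‖c‖ = ‖(p : ℚ_[p]) ^ k‖ := by
  obtain ⟨k, hk⟩ := norm_eq_pow_of_norm_le_one hc h0
  exact ⟨k, by rw [norm_natCast_pow, hk]⟩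

lemma sum_lintegral_sphere {N : ℕ} (hN : N ≠ 0) {y : ℚ_[p]} (hy : ‖y‖ ≤ 1) (h0 : y ≠ 0) :
    ∑ i ∈ Finset.range N, ∫⁻ z, {z : ℚ_[p] | ‖(p : ℚ_[p]) ^ i * z ^ N‖ = ‖y‖}.indicator
      (fun z => ‖z‖ₑ⁻¹) z ∂(unitHaar p) = unitHaar p {z | ‖z‖ = 1} := by
  obtain ⟨k, hk⟩ := exists_norm_eq_p_pow hy h0
  have key : ∀ i < N, ∀ z : ℚ_[p], ‖z‖ ≤ 1 → (‖(p : ℚ_[p]) ^ i * z ^ N‖ = ‖y‖ ↔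
      i = k % N ∧ ‖z‖ = ‖(p : ℚ_[p]) ^ (k / N)‖) := by
    intro i hi z hz
    rcases eq_or_ne z 0 with rfl | hz0
    · have h1 : ‖(p : ℚ_[p]) ^ (k / N)‖ ≠ 0 := norm_ne_zero_iff.2 (pow_ne_zero _ p_ne_zero)
      rw [zero_pow hN, mul_zero, norm_zero]
      exact ⟨fun h => absurd h.symm (norm_ne_zero_iff.2 h0), fun h => absurd h.2.symm h1⟩
    · obtain ⟨a, ha⟩ := exists_norm_eq_p_pow hz hz0
      have : ‖(p : ℚ_[p]) ^ i * z ^ N‖ = ‖(p : ℚ_[p]) ^ (i + N * a)‖ := by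
        rw [norm_mul, norm_pow z, ha, ← norm_pow, ← norm_mul]; ring_nf
      rw [this, hk, ha]
      constructor
      · intro h
        have := norm_p_pow_inj h
        subst this
        rw [Nat.add_mul_mod_self_left, Nat.mod_eq_of_lt hi, Nat.add_mul_div_left _ _ (by omega),
          Nat.div_eq_of_lt hi, zero_add]
        simp
      · rintro ⟨rfl, h⟩
        rw [norm_p_pow_inj h, Nat.mod_add_div]
  have hk1 : ‖(p : ℚ_[p]) ^ (k / N)‖ ≤ 1 := by
    rw [norm_pow]; exact pow_le_one₀ (norm_nonneg _) norm_p_lt_one.le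
  rw [Finset.sum_eq_single (k % N), ← lintegral_sphere_inv hk1 (pow_ne_zero _ p_ne_zero)]
  · refine lintegral_congr_ae (ae_unitHaar.mono fun z hz => ?_)
    simp only [indicator, mem_ofPred_eq, key _ (Nat.mod_lt _ (by omega)) z hz, true_and]
  · intro i hi hne
    rw [← lintegral_zero (μ := unitHaar p)]
    refine lintegral_congr_ae (ae_unitHaar.mono fun z hz => ?_)
    simp only [indicator, mem_ofPred_eq, key _ (Finset.mem_range.1 hi) z hz, hne, false_and,
      if_false]
  · intro h
    exact absurd (Finset.mem_range.2 (Nat.mod_lt _ (by omega))) h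

lemma lintegral_unitHaar_eq_sum (k : ℕ) {F : ℚ_[p] → ℝ≥0∞} (hF : Measurable F) :
    ∫⁻ t, F t ∂(unitHaar p) = ∑ c ∈ Finset.range (p ^ k),
      ‖(p : ℚ_[p]) ^ k‖ₑ * ∫⁻ t, F ((c : ℚ_[p]) + (p : ℚ_[p]) ^ k * t) ∂(unitHaar p) := by
  conv_lhs => rw [unitHaar_eq_sum k]
  rw [lintegral_finsetSum_measure]
  refine Finset.sum_congr rfl fun c _ => ?_
  rw [lintegral_smul_measure, lintegral_map hF (by fun_prop)]
  rfl

lemma measurable_powInt (N : ℕ) {Φ : ℚ_[p] → ℝ≥0∞} (hΦ : Measurable Φ) :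
    Measurable (powInt N Φ) := by
  have : Measurable fun q : ℚ_[p] × ℚ_[p] => ‖q.2 ^ (N - 1)‖ₑ * Φ (q.1 * q.2 ^ N) := by fun_prop
  exact this.lintegral_prod_right'

lemma lintegral_unit_powInt {N k : ℕ} (hk : 1 ≤ k) (hkN : ∀ u : ℚ_[p],
    ‖u - 1‖ ≤ (p : ℝ) ^ (-k : ℤ) → ∃ a : ℚ_[p], ‖a‖ = 1 ∧ a ^ N = u) {Φ : ℚ_[p] → ℝ≥0∞}
    (hΦ : Measurable Φ) (b : ℚ_[p]) :
    ∫⁻ u, {u : ℚ_[p] | ‖u‖ = 1}.indicator (fun u => powInt N Φ (u * b)) u ∂(unitHaar p) =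
      ∑ c ∈ (Finset.range (p ^ k)).filter (fun c : ℕ => ‖(c : ℚ_[p])‖ = 1),
        ‖(p : ℚ_[p]) ^ k‖ₑ * powInt N Φ (c * b) := by
  have hm : Measurable fun u => powInt N Φ (u * b) :=
    (measurable_powInt N hΦ).comp (measurable_mul_const b)
  rw [lintegral_unitHaar_eq_sum k (hm.indicator (measurableSet_sphere 1)), Finset.sum_filter]
  refine Finset.sum_congr rfl fun c _ => ?_
  have hpk : ∀ t : ℚ_[p], ‖t‖ ≤ 1 → ‖(p : ℚ_[p]) ^ k * t‖ < 1 := fun t ht => by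
    rw [norm_mul, norm_pow]
    exact lt_of_le_of_lt (mul_le_of_le_one_right (by positivity) ht)
      (pow_lt_one₀ (norm_nonneg _) norm_p_lt_one (by omega))
  split_ifs with hc
  · congr 1
    rw [show powInt N Φ (c * b) = ∫⁻ _ : ℚ_[p], powInt N Φ (c * b) ∂(unitHaar p) by simp]
    refine lintegral_congr_ae (ae_unitHaar.mono fun t ht => ?_)
    have h1 : ‖(c : ℚ_[p]) + (p : ℚ_[p]) ^ k * t‖ = 1 := by
      rw [← hc]
      refine norm_eq_of_sub_lt ?_
      rw [add_sub_cancel_left, hc]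
      exact hpk t ht
    have hc0 : (c : ℚ_[p]) ≠ 0 := by rw [← norm_ne_zero_iff, hc]; simp
    obtain ⟨a, ha, hac⟩ := hkN (1 + (p : ℚ_[p]) ^ k * t / c) (by
      rw [add_sub_cancel_left, norm_div, hc, div_one, norm_mul, ← norm_natCast_pow]
      exact mul_le_of_le_one_right (norm_nonneg _) ht)
    simp only
    rw [indicator_of_mem (show _ ∈ {u : ℚ_[p] | ‖u‖ = 1} from h1),
      ← powInt_mul_pow N hΦ (c * b) ha, hac]
    congr 1
    field_simp
  · rw [← mul_zero ‖(p : ℚ_[p]) ^ k‖ₑ]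
    congr 1
    rw [← lintegral_zero (μ := unitHaar p)]
    refine lintegral_congr_ae (ae_unitHaar.mono fun t ht => ?_)
    refine indicator_of_notMem (fun h => hc ?_) _
    have h : ‖(c : ℚ_[p]) + (p : ℚ_[p]) ^ k * t‖ = 1 := h
    rw [← h]
    refine norm_eq_of_sub_lt ?_
    rw [h, sub_add_cancel_left, norm_neg]
    exact hpk t ht

lemma unitHaar_units_ne_zero : unitHaar p {z | ‖z‖ = 1} ≠ 0 := by
  intro h
  have h1 : (unitHaar p) {t | ‖t‖ ≤ ‖(p : ℚ_[p])‖} = ‖(p : ℚ_[p])‖ₑ := by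
    rw [← Measure.restrict_apply_univ, unitHaar_restrict_norm_le norm_p_lt_one.le,
      Measure.smul_apply, Measure.map_apply (measurable_const_mul _) MeasurableSet.univ]
    simp
  have h2 : (unitHaar p) {t | ‖t‖ ≤ ‖(p : ℚ_[p])‖} = 1 := by
    refine prob_compl_eq_zero_iff (measurableSet_le measurable_norm measurable_const) |>.1 ?_
    refine measure_mono_null (t := {z : ℚ_[p] | ‖z‖ = 1} ∪ (closedBall 0 1)ᶜ) (fun t ht => ?_)
      (measure_union_null h ?_)
    · have ht' : ¬ ‖t‖ ≤ ‖(p : ℚ_[p])‖ := ht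
      by_contra! h3
      simp only [mem_union, mem_ofPred_eq, mem_compl_iff, mem_closedBall_zero_iff, not_or,
        not_not] at h3
      refine ht' ?_
      have := norm_le_of_lt (a := t) (b := 1) (by rw [norm_one]; exact lt_of_le_of_ne h3.2 h3.1)
      simpa using this
    · refine mem_ae_iff.1 (ae_unitHaar.mono fun t ht => ?_)
      simpa using ht
  rw [h1, ← ofReal_norm] at h2
  have := norm_p_lt_one (p := p)
  rw [ENNReal.ofReal_eq_one] at h2
  exact this.ne h2

/-- The unit ball is a combination of images under power maps. -/
lemma unitHaar_eq_sum_pow {N : ℕ} (hN : N ≠ 0) : ∃ (s : Finset (ℕ × ℕ)) (r : ℕ × ℕ → ℝ≥0)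
    (c : ℕ × ℕ → ℚ_[p]), (∀ x ∈ s, c x ≠ 0 ∧ ‖c x‖ ≤ 1) ∧ unitHaar p =
      ∑ x ∈ s, r x • ((unitHaar p).withDensity fun t => ‖t ^ (N - 1)‖ₑ).map
        fun t => c x * t ^ N := by
  obtain ⟨k, hk, hkN⟩ := exists_pow_eq (p := p) hN
  set M := unitHaar p {z | ‖z‖ = 1} with hM
  have hM0 : M ≠ 0 := unitHaar_units_ne_zero
  have hMt : M ≠ ∞ := measure_ne_top _ _
  refine ⟨Finset.range N ×ˢ (Finset.range (p ^ k)).filter (fun c : ℕ => ‖(c : ℚ_[p])‖ = 1),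
    fun x => M.toNNReal⁻¹ * (‖(p : ℚ_[p]) ^ x.1‖₊ * ‖(p : ℚ_[p]) ^ k‖₊),
    fun x => x.2 * (p : ℚ_[p]) ^ x.1, ?_, ?_⟩
  · rintro ⟨i, c⟩ hx
    simp only [Finset.mem_product, Finset.mem_filter] at hx
    have hc0 : (c : ℚ_[p]) ≠ 0 := by rw [← norm_ne_zero_iff, hx.2.2]; simp
    refine ⟨mul_ne_zero hc0 (pow_ne_zero _ p_ne_zero), ?_⟩
    rw [norm_mul, hx.2.2, one_mul, norm_pow]
    exact pow_le_one₀ (norm_nonneg _) norm_p_lt_one.le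
  · refine Measure.ext_of_lintegral _ fun Φ hΦ => ?_
    have hpi : ∀ i : ℕ, ‖(p : ℚ_[p]) ^ i‖ ≤ 1 := fun i => by
      rw [norm_pow]
      exact pow_le_one₀ (norm_nonneg _) norm_p_lt_one.le
    have key : M * ∫⁻ y, Φ y ∂(unitHaar p) = ∑ x ∈ Finset.range N ×ˢ
        (Finset.range (p ^ k)).filter (fun c : ℕ => ‖(c : ℚ_[p])‖ = 1),
        ‖(p : ℚ_[p]) ^ x.1‖ₑ * (‖(p : ℚ_[p]) ^ k‖ₑ * powInt N Φ (x.2 * (p : ℚ_[p]) ^ x.1)) := by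
      have hmeas : ∀ c : ℚ_[p], Measurable fun y => Φ y * ∫⁻ z,
          {z : ℚ_[p] | ‖c * z ^ N‖ = ‖y‖}.indicator (fun z => ‖z‖ₑ⁻¹) z ∂(unitHaar p) := by
        intro c
        refine hΦ.mul ?_
        have : Measurable fun q : ℚ_[p] × ℚ_[p] =>
            {q : ℚ_[p] × ℚ_[p] | ‖c * q.2 ^ N‖ = ‖q.1‖}.indicator (fun q => ‖q.2‖ₑ⁻¹) q :=
          Measurable.indicator (by fun_prop) (measurableSet_eq_fun (by fun_prop) (by fun_prop))
        exact this.lintegral_prod_right'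
      rw [Finset.sum_product]
      simp only [← Finset.mul_sum, ← lintegral_unit_powInt hk hkN hΦ]
      simp only [lintegral_powInt hN hΦ (hpi _) (pow_ne_zero _ p_ne_zero)]
      rw [← lintegral_finsetSum _ fun i _ => hmeas _, ← lintegral_const_mul _ hΦ]
      refine lintegral_congr_ae ?_
      filter_upwards [ae_unitHaar, (measure_eq_zero_iff_ae_notMem.1
          (measure_singleton (μ := unitHaar p) (0 : ℚ_[p])))] with y hy1 hy0
      rw [← Finset.mul_sum, sum_lintegral_sphere hN hy1 hy0, mul_comm]
    have h2 : ∫⁻ y, Φ y ∂(unitHaar p) = M⁻¹ * (M * ∫⁻ y, Φ y ∂(unitHaar p)) := by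
      rw [← mul_assoc, ENNReal.inv_mul_cancel hM0 hMt, one_mul]
    rw [h2, key, lintegral_finsetSum_measure, Finset.mul_sum]
    refine Finset.sum_congr rfl fun x _ => ?_
    rw [lintegral_smul_measure, lintegral_map_withDensity (by fun_prop) (by fun_prop) hΦ]
    have hMr : M⁻¹ = ((M.toNNReal⁻¹ : ℝ≥0) : ℝ≥0∞) := by
      rw [ENNReal.coe_inv (by rw [ENNReal.toNNReal_ne_zero]; exact ⟨hM0, hMt⟩),
        ENNReal.coe_toNNReal hMt]
    rw [hMr, ENNReal.smul_def, smul_eq_mul, ENNReal.coe_mul, ENNReal.coe_mul]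
    simp only [powInt, enorm, mul_assoc]

lemma unitPi_mem_good_nice {N : ℕ} (hN : N ≠ 0) : unitPi p n ∈ Good n
    fun f : (Fin n → ℚ_[p]) → Fin n → ℚ_[p] => Nice N f := by
  obtain ⟨s, r, c, hc, hm⟩ := unitHaar_eq_sum_pow (p := p) hN
  have h := unitPi_mem_good_of_forall_coord (p := p) (n := n) (R := Mono N)
    (fun h g hh hg => hh.comp hg) fun i => by
      have hMN : ∀ x ∈ s, Mono N fun y : Fin n → ℚ_[p] => c x * y i ^ N := fun x hx =>
        (Mono.const (hc x hx).1).mul (by simpa using (Mono.coord (p := p) i).pow_mul_self N)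
      have hNi : ∀ x ∈ s, Nice 1 fun y : Fin n → ℚ_[p] => Function.update y i (c x * y i ^ N) :=
        fun x hx => Nice.update (hMN x hx).to_one fun y hy => by
          rw [norm_mul, norm_pow]
          exact mul_le_one₀ (hc x hx).2 (by positivity)
            (pow_le_one₀ (norm_nonneg _) (mem_polydisc.1 hy i))
      refine unitPi_mem_good_of_coord s r (fun x t => c x * t ^ N) (fun _ t => t ^ (N - 1))
        (fun x _ => by fun_prop) (fun x _ => by fun_prop) hm i hNi
        (fun x hx => (Mono.coord i).pow _) fun x hx => ⟨hNi x hx, fun j hj y => by simp [hj], ?_⟩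
      simpa using hMN x hx
  exact Good.mono h fun g _ hg => ⟨hg.1.1, hg.2⟩

lemma mon_p_pow (α w : Fin n → ℕ) :
    mon α (fun l => (p : ℚ_[p]) ^ w l) = (p : ℚ_[p]) ^ (∑ l, α l * w l) := by
  unfold mon
  rw [← Finset.prod_pow_eq_pow_sum]
  exact Finset.prod_congr rfl fun l _ => by rw [← pow_mul, mul_comm]

lemma p_pow_mem_polydisc (w : Fin n → ℕ) : (fun l => (p : ℚ_[p]) ^ w l) ∈ polydisc p n :=
  mem_polydisc.2 fun l => by
    rw [norm_pow]; exact pow_le_one₀ (norm_nonneg _) norm_p_lt_one.le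

/-- On a curve going to a coordinate hyperplane the monomial with smaller exponent dominates. -/
lemma exists_forall_lt {r s : ℝ} (hr : 0 < r) (hs : 0 < s) {a b : ℕ} (hab : a < b) :
    ∃ A : ℕ, ∀ k ≥ A, ‖(p : ℚ_[p]) ^ (b * k)‖ * s < ‖(p : ℚ_[p]) ^ (a * k)‖ * r := by
  obtain ⟨A, hA⟩ := exists_pow_lt_of_lt_one (div_pos hr hs) (norm_p_lt_one (p := p))
  refine ⟨A, fun k hk => ?_⟩
  have hp0 : 0 < ‖(p : ℚ_[p])‖ := norm_pos_iff.2 p_ne_zero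
  have h1 : ‖(p : ℚ_[p]) ^ (b * k)‖ ≤ ‖(p : ℚ_[p]) ^ (a * k)‖ * ‖(p : ℚ_[p])‖ ^ A := by
    rw [norm_pow, norm_pow, ← pow_add]
    refine pow_le_pow_of_le_one hp0.le norm_p_lt_one.le ?_
    nlinarith
  refine (mul_le_mul_of_nonneg_right h1 hs.le).trans_lt ?_
  rw [mul_assoc]
  refine mul_lt_mul_of_pos_left ?_ (norm_pos_iff.2 (pow_ne_zero _ p_ne_zero))
  rwa [lt_div_iff₀ hs] at hA

lemma norm_eq_of_norm_sub {a b : ℚ_[p]} (h : ‖b‖ < ‖a‖) : ‖a - b‖ = ‖a‖ := by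
  refine norm_eq_of_sub_lt ?_
  simpa using h

/-- If the difference of two monomials (up to units) is again a monomial, then one of the two
divides the other; this is the half of the argument giving an exponent of the difference. -/
lemma exponent_eq_of_lt {α β δ : Fin n → ℕ} {r s t : ℝ} (hr : 0 < r) (hs : 0 < s)
    {g h : (Fin n → ℚ_[p]) → ℚ_[p]} (hg : ∀ y ∈ polydisc p n, ‖g y‖ = ‖mon α y‖ * r)
    (hh : ∀ y ∈ polydisc p n, ‖h y‖ = ‖mon β y‖ * s)
    (hd : ∀ y ∈ polydisc p n, ‖g y - h y‖ = ‖mon δ y‖ * t) {i : Fin n} (hi : α i < β i)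
    (j : Fin n) : δ j = α j := by
  classical
  let w : ℕ → ℕ → Fin n → ℕ := fun a b => a • Pi.single i 1 + b • Pi.single j 1
  have hw : ∀ (η : Fin n → ℕ) a b, ∑ l, η l * w a b l = η i * a + η j * b := fun η a b => by
    simp [w, mul_add, Finset.sum_add_distrib, Pi.single_apply]
  have key : ∀ b, ∃ A : ℕ, ∀ a ≥ A, ‖(p : ℚ_[p]) ^ (δ i * a + δ j * b)‖ * t =
      ‖(p : ℚ_[p]) ^ (α i * a + α j * b)‖ * r := by
    intro b
    have hpos : ∀ m : ℕ, 0 < ‖(p : ℚ_[p]) ^ m‖ := fun m =>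
      norm_pos_iff.2 (pow_ne_zero _ p_ne_zero)
    obtain ⟨A, hA⟩ := exists_forall_lt (p := p) (mul_pos (hpos (α j * b)) hr)
      (mul_pos (hpos (β j * b)) hs) hi
    refine ⟨A, fun a ha => ?_⟩
    have hy := p_pow_mem_polydisc (p := p) (w a b)
    have h1 := hd _ hy
    rw [norm_eq_of_norm_sub, hg _ hy, mon_p_pow, mon_p_pow, hw, hw] at h1
    · exact h1.symm
    · rw [hg _ hy, hh _ hy, mon_p_pow, mon_p_pow, hw, hw, pow_add, pow_add, norm_mul, norm_mul,
        mul_assoc, mul_assoc]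
      exact hA a ha
  obtain ⟨A₀, h0⟩ := key 0
  obtain ⟨A₁, h1⟩ := key 1
  have e0 := h0 (max A₀ A₁) (le_max_left _ _)
  have e1 := h1 (max A₀ A₁) (le_max_right _ _)
  simp only [mul_zero, add_zero, mul_one] at e0 e1
  rw [pow_add, pow_add, norm_mul, norm_mul, mul_right_comm, e0, mul_right_comm] at e1
  exact norm_p_pow_inj (mul_left_cancel₀ (norm_ne_zero_iff.2 (pow_ne_zero _ p_ne_zero))
    (mul_right_cancel₀ hr.ne' e1))

lemma IsUnitOn.exists_norm {u : (Fin n → ℚ_[p]) → ℚ_[p]} (hu : IsUnitOn u) (α : Fin n → ℕ) :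
    ∃ r > 0, ∀ y ∈ polydisc p n, ‖mon α y * u y‖ = ‖mon α y‖ * r := by
  obtain ⟨-, r, hr, h⟩ := hu
  exact ⟨r, hr, fun y hy => by rw [norm_mul, h y hy]⟩

/-- Two monomials whose difference is zero or a monomial have comparable exponents. -/
lemma exponents_comparable {α β : Fin n → ℕ} {g h u v : (Fin n → ℚ_[p]) → ℚ_[p]}
    (hu : IsUnitOn u) (hv : IsUnitOn v) (hg : ∀ y ∈ polydisc p n, g y = mon α y * u y)
    (hh : ∀ y ∈ polydisc p n, h y = mon β y * v y)
    (hd : (∀ y ∈ polydisc p n, g y - h y = 0) ∨ Mono 1 fun y => g y - h y) : α ≤ β ∨ β ≤ α := by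
  obtain ⟨r, hr, hr'⟩ := hu.exists_norm α
  obtain ⟨s, hs, hs'⟩ := hv.exists_norm β
  have hg' : ∀ y ∈ polydisc p n, ‖g y‖ = ‖mon α y‖ * r := fun y hy => by rw [hg y hy, hr' y hy]
  have hh' : ∀ y ∈ polydisc p n, ‖h y‖ = ‖mon β y‖ * s := fun y hy => by rw [hh y hy, hs' y hy]
  by_contra! hcon
  obtain ⟨j, hj⟩ : ∃ j, β j < α j := by simpa [Pi.le_def] using hcon.1
  obtain ⟨i, hi⟩ : ∃ i, α i < β i := by simpa [Pi.le_def] using hcon.2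
  rcases hd with hd | ⟨δ, w, hw, hd⟩
  · classical
    obtain ⟨A, hA⟩ := exists_forall_lt (p := p) hr hs hi
    have hy := p_pow_mem_polydisc (p := p) (A • Pi.single i 1 : Fin n → ℕ)
    have hw : ∀ (η : Fin n → ℕ), ∑ l, η l * (A • Pi.single i 1 : Fin n → ℕ) l = η i * A :=
      fun η => by simp [Pi.single_apply]
    have := hA A le_rfl
    rw [← hw, ← hw, ← mon_p_pow, ← mon_p_pow, ← hg' _ hy, ← hh' _ hy, sub_eq_zero.1 (hd _ hy)]
      at this
    exact lt_irrefl _ this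
  · obtain ⟨t, -, ht'⟩ := hw.exists_norm δ
    have hd1 : ∀ y ∈ polydisc p n, ‖g y - h y‖ = ‖mon δ y‖ * t := fun y hy => by
      have := hd y hy
      simp only at this
      rw [this, pow_one, ht' y hy]
    have hd2 : ∀ y ∈ polydisc p n, ‖h y - g y‖ = ‖mon δ y‖ * t := fun y hy => by
      rw [norm_sub_rev, hd1 y hy]
    have h1 := exponent_eq_of_lt hr hs hg' hh' hd1 hi j
    have h2 := exponent_eq_of_lt hs hr hh' hg' hd2 hj j
    omega

/-- Splitting off the first coordinate. -/
def splitFirst (y : Fin (n + 1) → ℚ_[p]) : (Fin n → ℚ_[p]) × ℚ_[p] := (fun j => y j.succ, y 0)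

lemma map_splitFirst : (unitPi p (n + 1)).map splitFirst = (unitPi p n).prod (unitHaar p) := by
  have h := (measurePreserving_piFinSuccAbove (fun _ : Fin (n + 1) => unitHaar p) 0)
  have h2 := (Measure.measurePreserving_swap (μ := unitHaar p) (ν := unitPi p n)).comp h
  exact h2.map_eq

lemma analyticOnNhd_splitFirst (s : Set (Fin (n + 1) → ℚ_[p])) :
    AnalyticOnNhd ℚ_[p] splitFirst s := fun y _ =>
  AnalyticAt.prod (analyticAt_pi_iff.2 fun j : Fin n => analyticOnNhd_coord j.succ univ y trivial)
    (analyticOnNhd_coord 0 univ y trivial)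

lemma continuous_splitFirst : Continuous (splitFirst (p := p) (n := n)) := by
  unfold splitFirst; fun_prop

lemma splitFirst_mem {y : Fin (n + 1) → ℚ_[p]} (hy : y ∈ polydisc p (n + 1)) :
    (splitFirst y).1 ∈ polydisc p n ∧ ‖(splitFirst y).2‖ ≤ 1 :=
  ⟨mem_polydisc.2 fun _ => mem_polydisc.1 hy _, mem_polydisc.1 hy 0⟩

section

variable {X : Type*} [NormedAddCommGroup X] [NormedSpace ℚ_[p] X] [MeasurableSpace X]
  [BorelSpace X] {Y : Type*} [NormedAddCommGroup Y] [NormedSpace ℚ_[p] Y] [MeasurableSpace Y]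
  [BorelSpace Y]

/-- Products of a good measure with the unit ball. -/
lemma Good.prod_unitHaar {P : ((Fin n → ℚ_[p]) → X) → Prop}
    {P' : ((Fin (n + 1) → ℚ_[p]) → Y) → Prop} {κ : Measure X} (hκ : κ ∈ Good n P)
    {Ψ : X × ℚ_[p] → Y} (hΨ : Measurable Ψ)
    (h : ∀ f, AnalyticOnNhd ℚ_[p] f (polydisc p n) → P f →
      ∃ Q : ((Fin (n + 1) → ℚ_[p]) → (Fin n → ℚ_[p]) × ℚ_[p]) → Prop,
      (unitPi p n).prod (unitHaar p) ∈ Good (n + 1) Q ∧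
      ContinuousOn (fun q : (Fin n → ℚ_[p]) × ℚ_[p] => Ψ (f q.1, q.2)) (Prod.fst ⁻¹' polydisc p n) ∧
      ∀ g, AnalyticOnNhd ℚ_[p] g (polydisc p (n + 1)) → Q g → Nice 1 (fun y => (g y).1) ∧
        AnalyticOnNhd ℚ_[p] (fun y => Ψ (f (g y).1, (g y).2)) (polydisc p (n + 1)) ∧
        P' (fun y => Ψ (f (g y).1, (g y).2))) :
    (κ.prod (unitHaar p)).map Ψ ∈ Good (n + 1) P' := by
  suffices SFinite κ ∧ (κ.prod (unitHaar p)).map Ψ ∈ Good (n + 1) P' from this.2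
  refine Submodule.span_induction (p := fun κ _ => SFinite κ ∧
    (κ.prod (unitHaar p)).map Ψ ∈ Good (n + 1) P') ?_ ?_ ?_ ?_ hκ
  · rintro κ ⟨f, J, hf, hPf, hJ, rfl⟩
    refine ⟨inferInstance, ?_⟩
    obtain ⟨Q, hQ, hc, hg⟩ := h f hf hPf
    obtain ⟨f', hf', hff'⟩ := extend_measurable measurableSet_polydisc hf.continuousOn
    have hmap : ((unitPi p n).withDensity fun y => ‖J y‖ₑ).map f =
        ((unitPi p n).withDensity fun y => ‖J y‖ₑ).map f' :=
      Measure.map_congr ((withDensity_absolutelyContinuous _ _).ae_le (ae_unitPi.mono hff'))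
    have hae : ∀ᵐ q ∂((unitPi p n).prod (unitHaar p)), q.1 ∈ polydisc p n :=
      Measure.quasiMeasurePreserving_fst.ae ae_unitPi
    have h1 : ((((unitPi p n).withDensity fun y => ‖J y‖ₑ).map f).prod (unitHaar p)).map Ψ =
        ((((unitPi p n).prod (unitHaar p)).withDensity fun q => ‖J q.1‖ₑ).map
          fun q => Ψ (f q.1, q.2)) := by
      rw [hmap]
      conv_lhs => rw [← Measure.map_id (μ := unitHaar p)]
      rw [Measure.map_prod_map _ _ hf' measurable_id, prod_withDensity_left₀ hJ.aemeasurable_enorm,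
        Measure.map_map hΨ (hf'.prodMap measurable_id)]
      refine Measure.map_congr ((withDensity_absolutelyContinuous _ _).ae_le ?_)
      exact hae.mono fun q hq => by simp [Function.comp, Prod.map, hff' hq]
    rw [h1]
    refine Good.refine hQ (measurable_fst measurableSet_polydisc) hc
      (hJ.analyticOnNhd.continuousOn.comp continuousOn_fst (mapsTo_preimage _ _)) ?_
    intro g hga hgQ
    obtain ⟨hn, ha, hP'⟩ := hg g hga hgQ
    exact ⟨hn.1, ha, hP', hJ.comp hn⟩
  · exact ⟨inferInstance, by simp⟩
  · rintro κ κ' - - ⟨hs, h1⟩ ⟨hs', h2⟩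
    refine ⟨inferInstance, ?_⟩
    rw [Measure.add_prod, Measure.map_add _ _ hΨ]
    exact add_mem h1 h2
  · rintro c κ - ⟨hs, h1⟩
    refine ⟨inferInstance, ?_⟩
    rw [Measure.prod_smul_left, Measure.map_smul]
    exact Submodule.smul_mem _ _ h1

end

set_option linter.unusedSectionVars false

section Analytic

variable {𝕜 E : Type*} [NontriviallyNormedField 𝕜] [NormedAddCommGroup E]
  [NormedSpace 𝕜 E]

/-- The projection `(x, t) ↦ (x, 0)`. -/
noncomputable def dropSnd (𝕜 E : Type*) [NontriviallyNormedField 𝕜] [NormedAddCommGroup E]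
    [NormedSpace 𝕜 E] : E × 𝕜 →L[𝕜] E × 𝕜 :=
  (ContinuousLinearMap.inl 𝕜 E 𝕜).comp (ContinuousLinearMap.fst 𝕜 E 𝕜)

@[simp] lemma dropSnd_apply (z : E × 𝕜) : dropSnd 𝕜 E z = (z.1, 0) := rfl

lemma norm_dropSnd_le : ‖dropSnd 𝕜 E‖ ≤ 1 :=
  ContinuousLinearMap.opNorm_le_bound _ zero_le_one fun z => by
    simp [Prod.norm_def]

/-- Telescoping the difference of two diagonal values of a multilinear map. -/
lemma map_diag_sub_map_diag {m : ℕ} {M : Type*} [NormedAddCommGroup M] [NormedSpace 𝕜 M]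
    (f : ContinuousMultilinearMap 𝕜 (fun _ : Fin (m + 1) => M) 𝕜) (a b : M) :
    f (fun _ => a) - f (fun _ => b) = ∑ k : Fin (m + 1),
      f (k.insertNth (a - b) fun j => if j.castSucc < k then a else b) := by
  let v : ℕ → Fin (m + 1) → M := fun k j => if j.1 < k then a else b
  have h0 : f (fun _ => a) - f (fun _ => b) = f (v (m + 1)) - f (v 0) := by
    have h1 : v (m + 1) = fun _ => a := funext fun j => if_pos j.2
    have h2 : v 0 = fun _ => b := funext fun j => if_neg (Nat.not_lt_zero _)
    rw [h1, h2]
  rw [h0, ← Finset.sum_range_sub (fun k => f (v k)), Finset.sum_range]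
  refine Finset.sum_congr rfl fun k _ => ?_
  have hv : ∀ (c : M) (l : ℕ), (∀ j : Fin m, (v l) (k.succAbove j) =
      if j.castSucc < k then a else b) → v l k = c →
      v l = k.insertNth c fun j => if j.castSucc < k then a else b := by
    intro c l h1 h2
    rw [Fin.eq_insertNth_iff]
    exact ⟨h2, funext h1⟩
  have hs : ∀ j : Fin m, (k.succAbove j).1 = if j.castSucc < k then j.1 else j.1 + 1 := by
    intro j
    rw [Fin.succAbove]
    split_ifs <;> simp
  rw [hv a (k + 1) (fun j => ?_) (by simp [v]), hv b k (fun j => ?_) (by simp [v])]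
  · have h := f.map_update_sub (k.insertNth a fun j => if j.castSucc < k then a else b) k a b
    simpa only [Fin.update_insertNth] using h.symm
  · simp only [v, hs]
    simp only [Fin.lt_def, Fin.val_castSucc]
    grind
  · simp only [v, hs]
    simp only [Fin.lt_def, Fin.val_castSucc]
    grind

/-- The power series of the difference quotient in the last variable. -/
noncomputable def divSeries (q : FormalMultilinearSeries 𝕜 (E × 𝕜) 𝕜) :
    FormalMultilinearSeries 𝕜 (E × 𝕜) 𝕜 := fun m =>
  ∑ k : Fin (m + 1), ((q (m + 1)).curryMid k (0, 1)).compContinuousLinearMap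
    (fun j => if j.castSucc < k then ContinuousLinearMap.id 𝕜 _ else dropSnd 𝕜 E)

lemma divSeries_apply (q : FormalMultilinearSeries 𝕜 (E × 𝕜) 𝕜) (m : ℕ) (z : E × 𝕜) :
    q (m + 1) (fun _ => z) - q (m + 1) (fun _ => (z.1, 0)) = z.2 * divSeries q m fun _ => z := by
  rw [map_diag_sub_map_diag, divSeries, _root_.sum_apply, Finset.mul_sum]
  refine Finset.sum_congr rfl fun k _ => ?_
  rw [ContinuousMultilinearMap.compContinuousLinearMap_apply,
    ContinuousMultilinearMap.curryMid_apply]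
  have h1 : z - (z.1, 0) = z.2 • ((0 : E), (1 : 𝕜)) := by ext <;> simp
  have h2 : ∀ j : Fin m, (if j.castSucc < k then ContinuousLinearMap.id 𝕜 _ else dropSnd 𝕜 E) z =
      if j.castSucc < k then z else (z.1, 0) := fun j => by split_ifs <;> simp
  simp only [h2]
  rw [h1]
  have h := (q (m + 1)).map_update_smul
    (k.insertNth z fun j => if j.castSucc < k then z else (z.1, 0)) k z.2 (0, 1)
  simpa only [Fin.update_insertNth, smul_eq_mul] using h

lemma norm_divSeries_le (q : FormalMultilinearSeries 𝕜 (E × 𝕜) 𝕜) (m : ℕ) :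
    ‖divSeries q m‖ ≤ (m + 1) * ‖q (m + 1)‖ := by
  have h : ∀ k : Fin (m + 1), ‖((q (m + 1)).curryMid k (0, 1)).compContinuousLinearMap
      (fun j : Fin m => if j.castSucc < k then ContinuousLinearMap.id 𝕜 _ else dropSnd 𝕜 E)‖ ≤
      ‖q (m + 1)‖ := by
    intro k
    refine (ContinuousMultilinearMap.norm_compContinuousLinearMap_le _ _).trans ?_
    have h1 : ‖(q (m + 1)).curryMid k (0, 1)‖ ≤ ‖q (m + 1)‖ := by
      refine (ContinuousLinearMap.le_opNorm _ _).trans ?_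
      rw [ContinuousMultilinearMap.norm_curryMid]
      simp [Prod.norm_def]
    refine (mul_le_of_le_one_right (norm_nonneg _) ?_).trans h1
    refine Finset.prod_le_one (fun _ _ => norm_nonneg _) fun j _ => ?_
    split_ifs
    · exact ContinuousLinearMap.norm_id_le
    · exact norm_dropSnd_le
  refine (norm_sum_le _ _).trans ((Finset.sum_le_sum fun k _ => h k).trans ?_)
  simp

/-- Division by the last coordinate: an analytic function is congruent to its restriction to
`t = 0` modulo `t`. -/
lemma exists_eq_add_mul [CompleteSpace 𝕜] {G : E × 𝕜 → 𝕜} {x : E} (hG : AnalyticAt 𝕜 G (x, 0)) :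
    ∃ H : E × 𝕜 → 𝕜, AnalyticAt 𝕜 H (x, 0) ∧
      ∀ᶠ z in 𝓝 (x, (0 : 𝕜)), G z = G (z.1, 0) + z.2 * H z := by
  obtain ⟨q, r, hq⟩ := hG
  obtain ⟨C, R, hC, hR, hCR⟩ := q.le_mul_pow_of_radius_pos (hq.r_pos.trans_le hq.r_le)
  have hrad : 0 < (divSeries q).radius := by
    let s : ℝ≥0 := ⟨(2 * R)⁻¹, by positivity⟩
    have hs : 0 < s := by
      have : 0 < (2 * R)⁻¹ := by positivity
      exact this
    refine (ENNReal.coe_pos.2 hs).trans_le ((divSeries q).le_radius_of_bound (C * R) fun m => ?_)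
    have h2 : ((m : ℝ) + 1) ≤ 2 ^ m := by exact_mod_cast Nat.lt_two_pow_self
    calc ‖divSeries q m‖ * (s : ℝ) ^ m
      _ ≤ ((m + 1) * (C * R ^ (m + 1))) * ((2 * R)⁻¹) ^ m := by
        refine mul_le_mul_of_nonneg_right ((norm_divSeries_le q m).trans ?_) (by positivity)
        exact mul_le_mul_of_nonneg_left (hCR _) (by positivity)
      _ ≤ (2 ^ m * (C * R ^ (m + 1))) * ((2 * R)⁻¹) ^ m := by gcongr
      _ = C * R := by
        rw [inv_pow, mul_pow, pow_succ]
        field_simp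
  have hd := (divSeries q).hasFPowerSeriesOnBall hrad
  set ρ := min r (divSeries q).radius with hρ
  have hρ0 : 0 < ρ := lt_min hq.r_pos hrad
  have hadd := hd.comp_sub (x, (0 : 𝕜))
  rw [zero_add] at hadd
  refine ⟨_, hadd.analyticAt, ?_⟩
  filter_upwards [Metric.eball_mem_nhds (x, (0 : 𝕜)) hρ0] with z hz
  set y := z - (x, (0 : 𝕜)) with hy
  have hzy : z = (x, 0) + y := by simp [hy]
  have hy0 : y ∈ Metric.eball (0 : E × 𝕜) ρ := by
    rw [Metric.mem_eball, edist_zero_right, hy, ← edist_eq_enorm_sub]; exact hz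
  have hy1 : (y.1, (0 : 𝕜)) ∈ Metric.eball (0 : E × 𝕜) ρ := by
    rw [Metric.mem_eball, edist_zero_right] at hy0 ⊢
    refine lt_of_le_of_lt ?_ hy0
    simp [enorm_eq_nnnorm, Prod.nnnorm_def]
  have e1 := hq.hasSum (Metric.eball_subset_eball (min_le_left _ _) hy0)
  have e2 := hq.hasSum (Metric.eball_subset_eball (min_le_left _ _) hy1)
  have e3 := hd.hasSum (Metric.eball_subset_eball (min_le_right _ _) hy0)
  rw [zero_add] at e3
  have e4 := (hasSum_nat_add_iff' 1).2 (e1.sub e2)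
  have e5 := e3.mul_left y.2
  simp only [divSeries_apply] at e4
  have e6 := e4.unique e5
  have h7 : (q 0 fun _ => y) = q 0 fun _ => (y.1, 0) := by
    congr 1; exact Subsingleton.elim _ _
  rw [Finset.sum_range_one, h7, sub_self, sub_zero] at e6
  have h8 : (x, (0 : 𝕜)) + (y.1, 0) = (z.1, 0) := by simp [hy]
  have h9 : y.2 = z.2 := by simp [hy]
  rw [← hzy, h8, h9] at e6
  linear_combination e6

/-- The partial derivative in the last variable. -/
noncomputable def dsnd (F : E × 𝕜 → 𝕜) : E × 𝕜 → 𝕜 := fun z => deriv (fun t => F (z.1, t)) z.2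

lemma dsnd_congr {F G : E × 𝕜 → 𝕜} {z : E × 𝕜} (h : F =ᶠ[𝓝 z] G) : dsnd F =ᶠ[𝓝 z] dsnd G := by
  filter_upwards [eventually_eventually_nhds.2 h] with w hw
  refine EventuallyEq.deriv_eq ?_
  have hc : Continuous fun t : 𝕜 => (w.1, t) := by fun_prop
  exact hc.continuousAt.eventually hw

lemma iterate_dsnd_congr {F G : E × 𝕜 → 𝕜} {z : E × 𝕜} (h : F =ᶠ[𝓝 z] G) (l : ℕ) :
    dsnd^[l] F =ᶠ[𝓝 z] dsnd^[l] G := by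
  induction l with
  | zero => exact h
  | succ l ih => simpa only [Function.iterate_succ_apply'] using dsnd_congr ih

lemma analyticAt_dsnd [CompleteSpace 𝕜] {F : E × 𝕜 → 𝕜} {z : E × 𝕜} (h : AnalyticAt 𝕜 F z) :
    AnalyticAt 𝕜 (dsnd F) z := by
  have h1 : AnalyticAt 𝕜 (fun w => fderiv 𝕜 F w (0, 1)) z :=
    ((ContinuousLinearMap.apply 𝕜 𝕜 ((0 : E), (1 : 𝕜))).analyticAt _).comp h.fderiv
  refine h1.congr ?_
  filter_upwards [h.eventually_analyticAt] with w hw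
  have h2 : HasDerivAt (fun t : 𝕜 => (w.1, t)) ((0 : E), (1 : 𝕜)) w.2 :=
    (hasDerivAt_const _ _).prodMk (hasDerivAt_id _)
  have h3 := (hw.differentiableAt.hasFDerivAt (x := (w.1, w.2))).comp_hasDerivAt w.2 h2
  exact h3.deriv.symm

lemma analyticAt_iterate_dsnd [CompleteSpace 𝕜] {F : E × 𝕜 → 𝕜} {z : E × 𝕜}
    (h : AnalyticAt 𝕜 F z) (l : ℕ) : AnalyticAt 𝕜 (dsnd^[l] F) z := by
  induction l with
  | zero => exact h
  | succ l ih => simpa only [Function.iterate_succ_apply'] using analyticAt_dsnd ih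

lemma iterate_dsnd_affine {E' : Type*} (F : E × 𝕜 → 𝕜) (g : E' → E) (c a b : E' → 𝕜) (l : ℕ)
    (z : E' × 𝕜) : dsnd^[l] (fun z => c z.1 * F (g z.1, a z.1 + b z.1 * z.2)) z =
      c z.1 * b z.1 ^ l * dsnd^[l] F (g z.1, a z.1 + b z.1 * z.2) := by
  induction l generalizing z with
  | zero => simp
  | succ l ih =>
    rw [Function.iterate_succ_apply', Function.iterate_succ_apply']
    have : dsnd^[l] (fun z : E' × 𝕜 => c z.1 * F (g z.1, a z.1 + b z.1 * z.2)) =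
        fun z => c z.1 * b z.1 ^ l * dsnd^[l] F (g z.1, a z.1 + b z.1 * z.2) := funext ih
    rw [this]
    simp only [dsnd]
    have h := deriv_comp_mul_left (b z.1) (fun s => dsnd^[l] F (g z.1, a z.1 + s)) z.2
    rw [deriv_const_mul_field, h, deriv_comp_const_add (fun s => dsnd^[l] F (g z.1, s)),
      smul_eq_mul]
    ring

lemma iterate_dsnd_const_add (c : E → 𝕜) (F : E × 𝕜 → 𝕜) (l : ℕ) :
    dsnd^[l + 1] (fun z => c z.1 + F z) = dsnd^[l + 1] F := by
  rw [Function.iterate_succ_apply, Function.iterate_succ_apply]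
  congr 1
  funext z
  simp [dsnd]

lemma iterate_dsnd_mul [CompleteSpace 𝕜] {F : E × 𝕜 → 𝕜} {z : E × 𝕜} (h : AnalyticAt 𝕜 F z)
    (l : ℕ) : dsnd^[l + 1] (fun z => z.2 * F z) =ᶠ[𝓝 z]
      fun z => z.2 * dsnd^[l + 1] F z + (l + 1) * dsnd^[l] F z := by
  have hd : ∀ {G : E × 𝕜 → 𝕜} {w : E × 𝕜}, AnalyticAt 𝕜 G w →
      HasDerivAt (fun t => G (w.1, t)) (dsnd G w) w.2 := fun {G w} hG =>
    DifferentiableAt.hasDerivAt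
      ((hG.comp (x := w.2) (f := fun t => (w.1, t)) (by fun_prop)).differentiableAt)
  induction l with
  | zero =>
    filter_upwards [h.eventually_analyticAt] with w hw
    have := (hasDerivAt_id w.2).mul (hd hw)
    refine (this.deriv : deriv (fun t => t * F (w.1, t)) w.2 = _).trans ?_
    simp [dsnd, add_comm]
  | succ l ih =>
    rw [Function.iterate_succ_apply']
    refine (dsnd_congr ih).trans ?_
    filter_upwards [h.eventually_analyticAt] with w hw
    have h1 := (hasDerivAt_id w.2).mul (hd (analyticAt_iterate_dsnd hw (l + 1)))
    have h2 := (hd (analyticAt_iterate_dsnd hw l)).const_mul ((l : 𝕜) + 1)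
    have h3 := (h1.add h2).deriv
    simp only [← Function.iterate_succ_apply' dsnd] at h3
    rw [dsnd]
    refine Eq.trans ?_ (h3.trans ?_)
    · rfl
    · push_cast
      simp only [id]
      ring

/-- Taylor expansion with remainder in the last variable. -/
lemma exists_taylor [CompleteSpace 𝕜] (e : ℕ) {G : E × 𝕜 → 𝕜} {x : E}
    (hG : AnalyticAt 𝕜 G (x, 0)) : ∃ (a : ℕ → E → 𝕜) (u : E × 𝕜 → 𝕜), (∀ l, AnalyticAt 𝕜 (a l) x) ∧
      AnalyticAt 𝕜 u (x, 0) ∧ ∀ᶠ z in 𝓝 (x, (0 : 𝕜)),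
        G z = ∑ l ∈ Finset.range e, a l z.1 * z.2 ^ l + u z * z.2 ^ e := by
  induction e generalizing G with
  | zero => exact ⟨fun _ _ => 0, G, fun _ => analyticAt_const, hG, by simp⟩
  | succ e ih =>
    obtain ⟨H, hH, hGH⟩ := exists_eq_add_mul hG
    obtain ⟨a, u, ha, hu, hau⟩ := ih hH
    refine ⟨fun l => Nat.casesOn l (fun y => G (y, 0)) a, u, ?_, hu, ?_⟩
    · rintro (_ | l)
      · exact hG.comp (f := fun y : E => (y, (0 : 𝕜))) (by fun_prop)
      · exact ha l
    · filter_upwards [hGH, hau] with z h1 h2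
      rw [h1, h2, Finset.sum_range_succ', mul_add, Finset.mul_sum]
      change _ = ∑ l ∈ Finset.range e, a l z.1 * z.2 ^ (l + 1) + G (z.1, 0) * z.2 ^ 0 + _
      have : ∀ l, z.2 * (a l z.1 * z.2 ^ l) = a l z.1 * z.2 ^ (l + 1) := fun l => by ring
      simp only [this]
      ring

lemma iterate_dsnd_taylor [CompleteSpace 𝕜] (e : ℕ) {G : E × 𝕜 → 𝕜} {x : E} {a : ℕ → E → 𝕜}
    {u : E × 𝕜 → 𝕜} (ha : ∀ l < e, AnalyticAt 𝕜 (a l) x) (hu : AnalyticAt 𝕜 u (x, 0))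
    (hG : ∀ᶠ z in 𝓝 (x, (0 : 𝕜)), G z = ∑ l ∈ Finset.range e, a l z.1 * z.2 ^ l + u z * z.2 ^ e) :
    (∀ l < e, dsnd^[l] G (x, 0) = l.factorial * a l x) ∧
      dsnd^[e] G (x, 0) = e.factorial * u (x, 0) := by
  induction e generalizing G a with
  | zero =>
    refine ⟨fun l hl => absurd hl (Nat.not_lt_zero _), ?_⟩
    simpa using hG.self_of_nhds
  | succ e ih =>
    let H : E × 𝕜 → 𝕜 := fun z => ∑ l ∈ Finset.range e, a (l + 1) z.1 * z.2 ^ l + u z * z.2 ^ e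
    have hH : AnalyticAt 𝕜 H (x, 0) := by
      refine AnalyticAt.add (Finset.analyticAt_fun_sum _ fun l hl => AnalyticAt.mul ?_ ?_)
        (hu.mul ?_)
      · exact (ha _ (Nat.succ_lt_succ (Finset.mem_range.1 hl))).comp
          (f := Prod.fst) (x := (x, (0 : 𝕜))) analyticAt_fst
      · exact analyticAt_snd.pow _
      · exact analyticAt_snd.pow _
    have hGH : G =ᶠ[𝓝 (x, 0)] fun z => a 0 z.1 + z.2 * H z := by
      filter_upwards [hG] with z h1
      rw [h1, Finset.sum_range_succ', mul_add, Finset.mul_sum]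
      have : ∀ l, z.2 * (a (l + 1) z.1 * z.2 ^ l) = a (l + 1) z.1 * z.2 ^ (l + 1) :=
        fun l => by ring
      simp only [this]
      ring
    have key : ∀ l, dsnd^[l + 1] G (x, 0) = (l + 1) * dsnd^[l] H (x, 0) := fun l => by
      rw [(iterate_dsnd_congr hGH (l + 1)).self_of_nhds, iterate_dsnd_const_add,
        (iterate_dsnd_mul hH l).self_of_nhds]
      simp
    obtain ⟨h1, h2⟩ := ih (G := H) (a := fun l => a (l + 1))
      (fun l hl => ha _ (Nat.succ_lt_succ hl))
      (Eventually.of_forall fun z => rfl)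
    refine ⟨?_, ?_⟩
    · rintro (_ | l) hl
      · simpa using hGH.self_of_nhds
      · rw [key, h1 l (by omega), Nat.factorial_succ]
        push_cast; ring
    · rw [key, h2, Nat.factorial_succ]
      push_cast; ring

/-- The analytic implicit function theorem for one equation in one unknown. -/
lemma exists_implicit [CompleteSpace 𝕜] [CompleteSpace E] {H : E × 𝕜 → 𝕜} {z : E × 𝕜}
    (hH : AnalyticAt 𝕜 H z) (h0 : H z = 0) (hd : dsnd H z ≠ 0) :
    ∃ φ : E → 𝕜, AnalyticAt 𝕜 φ z.1 ∧ φ z.1 = z.2 ∧ ∀ᶠ x in 𝓝 z.1, H (x, φ x) = 0 := by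
  set L := fderiv 𝕜 H z with hL
  set c := L (0, 1) with hc
  have hcd : dsnd H z = c := by
    have h2 : HasDerivAt (fun t : 𝕜 => (z.1, t)) ((0 : E), (1 : 𝕜)) z.2 :=
      (hasDerivAt_const _ _).prodMk (hasDerivAt_id _)
    exact ((hH.differentiableAt.hasFDerivAt (x := (z.1, z.2))).comp_hasDerivAt z.2 h2).deriv
  have hc0 : c ≠ 0 := hcd ▸ hd
  let A : E × 𝕜 →L[𝕜] E × 𝕜 := (ContinuousLinearMap.fst 𝕜 E 𝕜).prod L
  let B : E × 𝕜 →L[𝕜] E × 𝕜 := (ContinuousLinearMap.fst 𝕜 E 𝕜).prod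
    (c⁻¹ • (ContinuousLinearMap.snd 𝕜 E 𝕜 - L.comp (dropSnd 𝕜 E)))
  have hLz : ∀ w : E × 𝕜, L w = L (w.1, 0) + c * w.2 := fun w => by
    have : w = (w.1, 0) + w.2 • ((0 : E), (1 : 𝕜)) := by ext <;> simp
    conv_lhs => rw [this, map_add, map_smul, smul_eq_mul, mul_comm]
  let i : (E × 𝕜) ≃L[𝕜] (E × 𝕜) := ContinuousLinearEquiv.equivOfInverse A B
    (fun w => by
      ext
      · simp [A, B]
      · simp only [A, B, ContinuousLinearMap.prod_apply, ContinuousLinearMap.coe_fst',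
          _root_.smul_apply, _root_.sub_apply,
          ContinuousLinearMap.coe_snd', ContinuousLinearMap.comp_apply, dropSnd_apply, smul_eq_mul]
        rw [hLz w]; field_simp; ring)
    (fun w => by
      ext
      · simp [A, B]
      · simp only [A, B, ContinuousLinearMap.prod_apply, ContinuousLinearMap.coe_fst',
          _root_.smul_apply, _root_.sub_apply,
          ContinuousLinearMap.coe_snd', ContinuousLinearMap.comp_apply, dropSnd_apply, smul_eq_mul]
        rw [hLz]; field_simp; ring)
  let Φ : E × 𝕜 → E × 𝕜 := fun w => (w.1, H w)
  have hΦ : AnalyticAt 𝕜 Φ z := analyticAt_fst.prod hH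
  have hΦ' : HasStrictFDerivAt Φ (i : E × 𝕜 →L[𝕜] E × 𝕜) z :=
    hasStrictFDerivAt_fst.prodMk hH.hasStrictFDerivAt
  let e := hΦ'.toOpenPartialHomeomorph Φ
  have he : ∀ w, e w = Φ w := fun w => rfl
  have hz : z ∈ e.source := hΦ'.mem_toOpenPartialHomeomorph_source
  have hsymm : AnalyticAt 𝕜 e.symm (z.1, 0) := by
    have := e.analyticAt_symm' (i := i) hz hΦ hΦ'.hasFDerivAt.fderiv
    rwa [he, show Φ z = (z.1, 0) from Prod.ext rfl h0] at this
  have hin : AnalyticAt 𝕜 (fun x : E => e.symm (x, 0)) z.1 :=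
    hsymm.comp (f := fun x : E => (x, (0 : 𝕜))) (by fun_prop)
  refine ⟨fun x => (e.symm (x, 0)).2, analyticAt_snd.comp hin, ?_, ?_⟩
  · have : e.symm (e z) = z := e.left_inv hz
    rw [he, show Φ z = (z.1, 0) from Prod.ext rfl h0] at this
    exact congrArg Prod.snd this
  · have hcont : ContinuousAt (fun x : E => (x, (0 : 𝕜))) z.1 := by fun_prop
    have ht : ∀ᶠ x in 𝓝 z.1, (x, (0 : 𝕜)) ∈ e.target := by
      refine hcont.eventually (e.open_target.mem_nhds ?_)
      have := e.map_source hz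
      rwa [he, show Φ z = (z.1, 0) from Prod.ext rfl h0] at this
    filter_upwards [ht] with x hx
    have h1 : Φ (e.symm (x, 0)) = (x, 0) := e.right_inv hx
    have h2 : (e.symm (x, 0)).1 = x := congrArg Prod.fst h1
    have h3 : H (e.symm (x, 0)) = 0 := congrArg Prod.snd h1
    have h4 : (x, (e.symm (x, 0)).2) = e.symm (x, 0) := Prod.ext h2.symm rfl
    rw [h4, h3]

end Analytic

/-- The product of the unit polydisc with the unit disc. -/
def bidisc (p : ℕ) [Fact p.Prime] (n : ℕ) : Set ((Fin n → ℚ_[p]) × ℚ_[p]) :=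
  polydisc p n ×ˢ closedBall 0 1

lemma mem_bidisc {z : (Fin n → ℚ_[p]) × ℚ_[p]} :
    z ∈ bidisc p n ↔ z.1 ∈ polydisc p n ∧ ‖z.2‖ ≤ 1 := by
  simp [bidisc, mem_prod]

lemma isClopen_bidisc : IsClopen (bidisc p n) :=
  isClopen_polydisc.prod (IsUltrametricDist.isClopen_closedBall _ one_ne_zero)

lemma isCompact_bidisc : IsCompact (bidisc p n) :=
  isCompact_polydisc.prod (isCompact_closedBall _ _)

lemma restrict_bidisc :
    ((unitPi p n).prod (unitHaar p)).restrict (bidisc p n) = (unitPi p n).prod (unitHaar p) := by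
  rw [← map_splitFirst, restrict_map continuous_splitFirst.measurable
    isClopen_bidisc.isOpen.measurableSet]
  congr 1
  refine restrict_eq_self_of_ae_mem ?_
  filter_upwards [ae_unitPi (p := p) (n := n + 1)] with y hy
  exact mem_bidisc.2 (splitFirst_mem hy)

/-- The charts that are used for the functions `F` on the bidisc. -/
def IsChart {ι : Type*} (F : ι → (Fin n → ℚ_[p]) × ℚ_[p] → ℚ_[p])
    (g : (Fin (n + 1) → ℚ_[p]) → (Fin n → ℚ_[p]) × ℚ_[p]) : Prop :=
  MapsTo g (polydisc p (n + 1)) (bidisc p n) ∧ Nice 1 (fun y => (g y).1) ∧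
    ∀ i, Mono 1 fun y => F i (g y)

lemma mon_splitFirst (γ : Fin n → ℕ) (y : Fin (n + 1) → ℚ_[p]) :
    mon γ (splitFirst y).1 = mon (Fin.cons 0 γ : Fin (n + 1) → ℕ) y := by
  simp [mon, splitFirst, Fin.prod_univ_succ]

section Toric

variable {ι : Type*} {e : ι → ℕ} {F u : ι → (Fin n → ℚ_[p]) × ℚ_[p] → ℚ_[p]}
  {a : ι → ℕ → (Fin n → ℚ_[p]) → ℚ_[p]} {γ : Fin n → ℕ} {r : ι → ℝ}

lemma sum_eq_pow_mul {m : ℕ} (x t s : ℚ_[p]) (c : ℕ → ℚ_[p]) (v : ℚ_[p]) (h : x = t * s) :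
    ∑ l ∈ Finset.range m, x ^ (m - l) * c l * t ^ l + v * t ^ m =
      t ^ m * (v + ∑ l ∈ Finset.range m, s ^ (m - l) * c l) := by
  rw [mul_add, Finset.mul_sum, add_comm, mul_comm]
  congr 1
  refine Finset.sum_congr rfl fun l hl => ?_
  have : t ^ m = t ^ (m - l) * t ^ l := by
    rw [← pow_add, Nat.sub_add_cancel (Finset.mem_range.1 hl).le]
  rw [this, h, mul_pow]; ring

lemma norm_sum_lt_of_forall {ι' : Type*} {s : Finset ι'} {f : ι' → ℚ_[p]} {r : ℝ} (hr : 0 < r)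
    (h : ∀ i ∈ s, ‖f i‖ < r) : ‖∑ i ∈ s, f i‖ < r := by
  classical
  induction s using Finset.induction_on with
  | empty => simpa using hr
  | insert i s hi ih =>
    rw [Finset.sum_insert hi]
    exact (IsUltrametricDist.norm_add_le_max _ _).trans_lt
      (max_lt (h i (Finset.mem_insert_self _ _)) (ih fun j hj => h j (Finset.mem_insert_of_mem hj)))

/-- The part of the bidisc where the last coordinate dominates. -/
lemma restrict_lt_mem_good (hu : ∀ i, AnalyticOnNhd ℚ_[p] (u i) (bidisc p n)) (hr : ∀ i, 0 < r i)
    (hur : ∀ i, ∀ z ∈ bidisc p n, ‖u i z‖ = r i)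
    (ha : ∀ i, ∀ l < e i, AnalyticOnNhd ℚ_[p] (a i l) (polydisc p n))
    (har : ∀ i, ∀ l < e i, ∀ y ∈ polydisc p n, ‖a i l y‖ ≤ r i)
    (hF : ∀ i, ∀ z ∈ bidisc p n, F i z =
      ∑ l ∈ Finset.range (e i), mon γ z.1 ^ (e i - l) * a i l z.1 * z.2 ^ l + u i z * z.2 ^ e i) :
    ((unitPi p n).prod (unitHaar p)).restrict {q | ‖mon γ q.1‖ < ‖q.2‖} ∈
      Good (n + 1) (IsChart F) := by
  have hm : MeasurableSet {q : (Fin n → ℚ_[p]) × ℚ_[p] | ‖mon γ q.1‖ < ‖q.2‖} := by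
    refine measurableSet_lt ?_ measurable_snd.norm
    exact (continuous_mon γ).measurable.norm.comp measurable_fst
  rw [← map_splitFirst, restrict_map continuous_splitFirst.measurable hm]
  have hset : splitFirst ⁻¹' {q : (Fin n → ℚ_[p]) × ℚ_[p] | ‖mon γ q.1‖ < ‖q.2‖} =
      {y | ‖mon (Fin.cons 0 γ : Fin (n + 1) → ℕ) y‖ < ‖y 0‖} := by
    ext y
    rw [mem_preimage, mem_ofPred_eq, mem_ofPred_eq, mon_splitFirst]
    rfl
  rw [hset]
  refine Good.map (unitPi_restrict_mon_lt_mem_good 0 _ _ rfl (by simp)) (S := univ)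
    MeasurableSet.univ continuous_splitFirst.continuousOn ?_
  rintro g hg ⟨hgn, s, hs, hs1, hgs⟩
  have hmaps : MapsTo (fun y => splitFirst (g y)) (polydisc p (n + 1)) (bidisc p n) := fun y hy =>
    mem_bidisc.2 (splitFirst_mem (hgn.1 hy))
  have han : AnalyticOnNhd ℚ_[p] (fun y => splitFirst (g y)) (polydisc p (n + 1)) :=
    (analyticOnNhd_splitFirst univ).comp hg (mapsTo_univ _ _)
  have han1 : AnalyticOnNhd ℚ_[p] (fun y => (splitFirst (g y)).1) (polydisc p (n + 1)) :=
    fun y hy => analyticAt_fst.comp (han y hy)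
  refine ⟨mapsTo_univ _ _, han, hmaps, ⟨fun y hy => (mem_bidisc.1 (hmaps hy)).1, fun j =>
    hgn.2 j.succ⟩, fun i => ?_⟩
  have hv : AnalyticOnNhd ℚ_[p] (fun y => ∑ l ∈ Finset.range (e i),
      s y ^ (e i - l) * a i l (splitFirst (g y)).1) (polydisc p (n + 1)) := by
    intro y hy
    refine Finset.analyticAt_fun_sum _ fun l hl => ((hs y hy).pow _).mul ?_
    exact AnalyticAt.comp (f := fun y => (splitFirst (g y)).1)
      (ha i l (Finset.mem_range.1 hl) _ (mem_bidisc.1 (hmaps hy)).1) (han1 y hy)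
  have hvr : ∀ y ∈ polydisc p (n + 1), ‖∑ l ∈ Finset.range (e i),
      s y ^ (e i - l) * a i l (splitFirst (g y)).1‖ < r i := by
    intro y hy
    refine norm_sum_lt_of_forall (hr i) fun l hl => ?_
    rw [Finset.mem_range] at hl
    rw [norm_mul, norm_pow]
    have h1 : ‖s y‖ ^ (e i - l) < 1 := pow_lt_one₀ (norm_nonneg _) (hs1 y hy) (by omega)
    calc _ ≤ ‖s y‖ ^ (e i - l) * r i := mul_le_mul_of_nonneg_left
            (har i l hl _ (mem_bidisc.1 (hmaps hy)).1) (by positivity)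
      _ < r i := by nlinarith [hr i]
  have hunit : IsUnitOn fun y => u i (splitFirst (g y)) + ∑ l ∈ Finset.range (e i),
      s y ^ (e i - l) * a i l (splitFirst (g y)).1 := by
    refine ⟨fun y hy => (AnalyticAt.comp (f := fun y => splitFirst (g y))
      (hu i _ (hmaps hy)) (han y hy)).add (hv y hy), r i, hr i,
      fun y hy => ?_⟩
    rw [← hur i _ (hmaps hy)]
    refine norm_eq_of_sub_lt ?_
    rw [hur i _ (hmaps hy)]
    simpa only [add_sub_cancel_left] using hvr y hy
  refine (((hgn.2 0).pow (e i)).mul (.of_unit hunit)).congr fun y hy => ?_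
  change _ = F i (splitFirst (g y))
  refine Eq.trans ?_ (hF i _ (hmaps hy)).symm
  refine (sum_eq_pow_mul _ _ (s y) (fun l => a i l (splitFirst (g y)).1) _ ?_).symm
  rw [mon_splitFirst]
  exact hgs y hy

/-- The rescaling of the functions `F` on the part of the bidisc where `mon γ` dominates. -/
noncomputable def rescale (e : ι → ℕ) (u : ι → (Fin n → ℚ_[p]) × ℚ_[p] → ℚ_[p])
    (a : ι → ℕ → (Fin n → ℚ_[p]) → ℚ_[p]) (γ : Fin n → ℕ) (i : ι)
    (z : (Fin n → ℚ_[p]) × ℚ_[p]) : ℚ_[p] :=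
  ∑ l ∈ Finset.range (e i), a i l z.1 * z.2 ^ l + u i (z.1, mon γ z.1 * z.2) * z.2 ^ e i

lemma blowup_mem_bidisc {z : (Fin n → ℚ_[p]) × ℚ_[p]} (hz : z ∈ bidisc p n) :
    (z.1, mon γ z.1 * z.2) ∈ bidisc p n := by
  rw [mem_bidisc] at hz ⊢
  refine ⟨hz.1, ?_⟩
  rw [norm_mul]
  exact mul_le_one₀ (norm_mon_le_one γ hz.1) (norm_nonneg _) hz.2

lemma eq_mul_rescale (hF : ∀ i, ∀ z ∈ bidisc p n, F i z =
      ∑ l ∈ Finset.range (e i), mon γ z.1 ^ (e i - l) * a i l z.1 * z.2 ^ l + u i z * z.2 ^ e i)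
    (i : ι) {z : (Fin n → ℚ_[p]) × ℚ_[p]} (hz : z ∈ bidisc p n) :
    F i (z.1, mon γ z.1 * z.2) = mon γ z.1 ^ e i * rescale e u a γ i z := by
  rw [hF i _ (blowup_mem_bidisc hz), rescale, mul_add, Finset.mul_sum]
  congr 1
  · refine Finset.sum_congr rfl fun l hl => ?_
    have : mon γ z.1 ^ e i = mon γ z.1 ^ (e i - l) * mon γ z.1 ^ l := by
      rw [← pow_add, Nat.sub_add_cancel (Finset.mem_range.1 hl).le]
    rw [this]; ring
  · ring

/-- The part of the bidisc where `mon γ` dominates. -/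
lemma restrict_le_mem_good (hF : ∀ i, ∀ z ∈ bidisc p n, F i z =
      ∑ l ∈ Finset.range (e i), mon γ z.1 ^ (e i - l) * a i l z.1 * z.2 ^ l + u i z * z.2 ^ e i)
    (h : (unitPi p n).prod (unitHaar p) ∈ Good (n + 1) (IsChart (rescale e u a γ))) :
    ((unitPi p n).prod (unitHaar p)).restrict {q | ‖q.2‖ ≤ ‖mon γ q.1‖} ∈
      Good (n + 1) (IsChart F) := by
  rw [prod_restrict_norm_le (continuous_mon γ).measurable]
  · have hc : Continuous fun q : (Fin n → ℚ_[p]) × ℚ_[p] => mon γ q.1 :=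
      (continuous_mon γ).comp continuous_fst
    refine Good.refine h (S := univ) MeasurableSet.univ
      (by fun_prop) (J := fun q => mon γ q.1) hc.continuousOn ?_
    rintro g hg ⟨hgm, hgn, hgF⟩
    have hm : Mono 1 fun y => mon γ (g y).1 := Mono.mon_comp hgn.2 γ
    refine ⟨mapsTo_univ _ _, fun y hy => ?_, ⟨fun y hy => blowup_mem_bidisc (hgm hy), hgn,
      fun i => ?_⟩, hm⟩
    · exact AnalyticAt.prod (analyticAt_fst.comp (hg y hy))
        ((hm.analyticOnNhd y hy).mul (analyticAt_snd.comp (hg y hy)))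
    · refine ((hm.pow (e i)).mul (hgF i)).congr fun y hy => ?_
      exact (eq_mul_rescale hF i (hgm hy)).symm
  · filter_upwards [ae_unitPi (p := p) (n := n)] with y hy using norm_mon_le_one γ hy

lemma iterate_dsnd_eval {X : Type*} {G : X × ℚ_[p] → ℚ_[p]} {x : X} {P : Polynomial ℚ_[p]}
    (h : ∀ t, G (x, t) = P.eval t) (l : ℕ) (t : ℚ_[p]) :
    dsnd^[l] G (x, t) = (Polynomial.derivative^[l] P).eval t := by
  induction l generalizing t with
  | zero => exact h t
  | succ l ih =>
    rw [Function.iterate_succ_apply', Function.iterate_succ_apply', ← Polynomial.deriv]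
    exact congrArg (fun f => deriv f t) (funext ih)

lemma iterate_derivative_eval (m k : ℕ) (c : ℕ → ℚ_[p]) (v t : ℚ_[p])
    (hc : ∀ l < m, k ≤ l → c l = 0) :
    (Polynomial.derivative^[k] (∑ l ∈ Finset.range m, Polynomial.C (c l) * Polynomial.X ^ l +
      Polynomial.C v * Polynomial.X ^ m)).eval t = v * (m.descFactorial k * t ^ (m - k)) := by
  rw [iterate_map_add, Polynomial.iterate_derivative_sum, Finset.sum_eq_zero,
    zero_add, Polynomial.iterate_derivative_C_mul,
    Polynomial.iterate_derivative_X_pow_eq_natCast_mul]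
  · simp
  · intro l hl
    rw [Polynomial.iterate_derivative_C_mul, Polynomial.iterate_derivative_X_pow_eq_natCast_mul]
    rcases lt_or_ge l k with h | h
    · simp [Nat.descFactorial_of_lt h]
    · simp [hc l (Finset.mem_range.1 hl) h]

lemma iterate_dsnd_rescale_of_eq_zero {i : ι} {z : (Fin n → ℚ_[p]) × ℚ_[p]} (hz : mon γ z.1 = 0)
    {k : ℕ} (hc : ∀ l < e i, k ≤ l → a i l z.1 = 0) : dsnd^[k] (rescale e u a γ i) z =
      u i (z.1, 0) * ((e i).descFactorial k * z.2 ^ (e i - k)) := by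
  rw [← iterate_derivative_eval _ _ (fun l => a i l z.1) _ _ hc]
  refine iterate_dsnd_eval (x := z.1) (fun t => ?_) k z.2
  simp [rescale, hz, Polynomial.eval_finsetSum]

lemma iterate_dsnd_rescale_ne_zero (hF : ∀ i, ∀ z ∈ bidisc p n, F i z =
      ∑ l ∈ Finset.range (e i), mon γ z.1 ^ (e i - l) * a i l z.1 * z.2 ^ l + u i z * z.2 ^ e i)
    {i : ι} {z : (Fin n → ℚ_[p]) × ℚ_[p]} (hz : z ∈ bidisc p n) (h0 : mon γ z.1 ≠ 0) {k : ℕ}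
    (h : dsnd^[k] (F i) (z.1, mon γ z.1 * z.2) ≠ 0) : dsnd^[k] (rescale e u a γ i) z ≠ 0 := by
  intro hk
  have h1 : (fun z : (Fin n → ℚ_[p]) × ℚ_[p] => 1 * F i (z.1, 0 + mon γ z.1 * z.2)) =ᶠ[𝓝 z]
      fun z => mon γ z.1 ^ e i * rescale e u a γ i (z.1, 0 + 1 * z.2) := by
    filter_upwards [isClopen_bidisc.isOpen.mem_nhds hz] with w hw
    simp only [one_mul, zero_add]
    exact eq_mul_rescale hF i hw
  have h2 := (iterate_dsnd_congr h1 k).self_of_nhds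
  rw [iterate_dsnd_affine (F i) (fun x => x) (fun _ => 1) (fun _ => 0) (mon γ),
    iterate_dsnd_affine (rescale e u a γ i) (fun x => x) (fun x => mon γ x ^ e i) (fun _ => 0)
      (fun _ => 1)] at h2
  simp only [one_mul, zero_add, hk, mul_zero] at h2
  exact mul_ne_zero (pow_ne_zero _ h0) h h2

lemma analyticAt_mon_fst (γ : Fin n → ℕ) (z : (Fin n → ℚ_[p]) × ℚ_[p]) :
    AnalyticAt ℚ_[p] (fun z : (Fin n → ℚ_[p]) × ℚ_[p] => mon γ z.1) z :=
  AnalyticAt.comp (g := mon γ) (f := Prod.fst) (analyticOnNhd_mon γ univ z.1 (mem_univ _))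
    analyticAt_fst

lemma analyticAt_comp_blowup {v : (Fin n → ℚ_[p]) × ℚ_[p] → ℚ_[p]}
    {z : (Fin n → ℚ_[p]) × ℚ_[p]} (hv : AnalyticAt ℚ_[p] v (z.1, mon γ z.1 * z.2)) :
    AnalyticAt ℚ_[p] (fun z => v (z.1, mon γ z.1 * z.2)) z :=
  AnalyticAt.comp (g := v)
    (f := fun z : (Fin n → ℚ_[p]) × ℚ_[p] => (z.1, mon γ z.1 * z.2)) hv
    (analyticAt_fst.prod ((analyticAt_mon_fst γ z).mul analyticAt_snd))

lemma analyticAt_rescale (hu : ∀ i, AnalyticOnNhd ℚ_[p] (u i) (bidisc p n))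
    (ha : ∀ i, ∀ l < e i, AnalyticOnNhd ℚ_[p] (a i l) (polydisc p n)) (i : ι)
    {z : (Fin n → ℚ_[p]) × ℚ_[p]} (hz : z ∈ bidisc p n) :
    AnalyticAt ℚ_[p] (rescale e u a γ i) z := by
  refine AnalyticAt.add (Finset.analyticAt_fun_sum _ fun l hl => AnalyticAt.mul ?_ ?_)
    (AnalyticAt.mul ?_ ?_)
  · exact AnalyticAt.comp (f := Prod.fst)
      (ha i l (Finset.mem_range.1 hl) z.1 (mem_bidisc.1 hz).1) analyticAt_fst
  · exact analyticAt_snd.pow _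
  · exact analyticAt_comp_blowup (hu i _ (blowup_mem_bidisc hz))
  · exact analyticAt_snd.pow _

end Toric

/-- Local monomialization near a point where the `F i` are regular of order at most `ε i` in the
last variable. -/
def LocalClaim (p : ℕ) [Fact p.Prime] (n s : ℕ) : Prop :=
  ∀ (ι κ : Type) [Fintype ι] [Fintype κ] (F : ι → (Fin n → ℚ_[p]) × ℚ_[p] → ℚ_[p])
    (w : κ → (Fin n → ℚ_[p]) → ℚ_[p]) (ε : ι → ℕ) (z : (Fin n → ℚ_[p]) × ℚ_[p]),
    z ∈ bidisc p n → (∀ i, AnalyticAt ℚ_[p] (F i) z) → (∀ i, dsnd^[ε i] (F i) z ≠ 0) →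
    ∑ i, ε i ≤ s → (∀ j, AnalyticAt ℚ_[p] (w j) z.1) →
    (∀ j, ¬ ∀ᶠ x in 𝓝 z.1, w j x = 0) →
    ∃ V ∈ 𝓝 z, IsClopen V ∧ ((unitPi p n).prod (unitHaar p)).restrict V ∈
      Good (n + 1) fun g => (∀ i, Mono 1 fun y => F i (g y)) ∧ ∀ j, Mono 1 fun y => w j (g y).1

lemma not_eventually_coord_eq_zero (j : Fin n) (x : Fin n → ℚ_[p]) :
    ¬ ∀ᶠ y in 𝓝 x, y j = 0 := by
  classical
  intro h
  have hc : ContinuousAt (fun t => Function.update x j t) (x j) := by fun_prop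
  rw [ContinuousAt, Function.update_eq_self] at hc
  have h1 : ∀ᶠ t in 𝓝 (x j), t = 0 := by
    filter_upwards [hc.eventually h] with t ht
    simpa using ht
  have h2 : x j = 0 := h1.self_of_nhds
  have h3 : ∀ᶠ t in 𝓝[≠] (x j), t = 0 := h1.filter_mono nhdsWithin_le_nhds
  obtain ⟨t, ht1, ht2⟩ := (h3.and self_mem_nhdsWithin).exists
  exact ht2 (ht1.trans h2.symm)

variable {ι : Type} [Fintype ι] {e : ι → ℕ} {F u : ι → (Fin n → ℚ_[p]) × ℚ_[p] → ℚ_[p]}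
  {a : ι → ℕ → (Fin n → ℚ_[p]) → ℚ_[p]} {γ : Fin n → ℕ} {r : ι → ℝ}

/-- After the rescaling the total order drops everywhere. -/
lemma rescale_mem_good (hu : ∀ i, AnalyticOnNhd ℚ_[p] (u i) (bidisc p n))
    (hu0 : ∀ i, ∀ z ∈ bidisc p n, u i z ≠ 0)
    (ha : ∀ i, ∀ l < e i, AnalyticOnNhd ℚ_[p] (a i l) (polydisc p n))
    (hF : ∀ i, ∀ z ∈ bidisc p n, F i z =
      ∑ l ∈ Finset.range (e i), mon γ z.1 ^ (e i - l) * a i l z.1 * z.2 ^ l + u i z * z.2 ^ e i)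
    (hd : ∀ i, ∀ z ∈ bidisc p n, dsnd^[e i] (F i) z ≠ 0)
    {i₀ : ι} {l₀ : ℕ} (hl₀ : l₀ < e i₀) (ha₀ : ∀ y ∈ polydisc p n, a i₀ l₀ y ≠ 0)
    {i₁ : ι} (hi₁ : e i₁ ≠ 0) (ha₁ : ∀ y ∈ polydisc p n, a i₁ (e i₁ - 1) y = 0)
    (hd₁ : ∀ z ∈ bidisc p n, dsnd^[e i₁ - 1] (F i₁) z = 0 → z.2 = 0)
    (IH : ∀ s < ∑ i, e i, LocalClaim p n s) :
    (unitPi p n).prod (unitHaar p) ∈ Good (n + 1) (IsChart (rescale e u a γ)) := by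
  classical
  have hz0 : ∀ z ∈ bidisc p n, (z.1, (0 : ℚ_[p])) ∈ bidisc p n := fun z hz => by
    rw [mem_bidisc] at hz ⊢; exact ⟨hz.1, by simp⟩
  have hord : ∀ i, ∀ z ∈ bidisc p n, dsnd^[e i] (rescale e u a γ i) z ≠ 0 := by
    intro i z hz
    by_cases h0 : mon γ z.1 = 0
    · rw [iterate_dsnd_rescale_of_eq_zero h0 (fun l hl hl' => absurd hl (not_lt.2 hl'))]
      refine mul_ne_zero (hu0 i _ (hz0 z hz)) ?_
      simp [Nat.descFactorial_self, Nat.factorial_ne_zero]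
    · exact iterate_dsnd_rescale_ne_zero hF hz h0 (hd i _ (blowup_mem_bidisc hz))
  have hdrop : ∀ z ∈ bidisc p n, ∃ i, ∃ k < e i, dsnd^[k] (rescale e u a γ i) z ≠ 0 := by
    intro z hz
    by_cases ht : z.2 = 0
    · refine ⟨i₀, l₀, hl₀, ?_⟩
      have hzz : z = (z.1, 0) := Prod.ext rfl ht
      have h1 := (iterate_dsnd_taylor (e i₀) (G := rescale e u a γ i₀) (x := z.1) (a := a i₀)
        (u := fun z => u i₀ (z.1, mon γ z.1 * z.2))
        (fun l hl => ha i₀ l hl z.1 (mem_bidisc.1 hz).1) ?_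
        (Eventually.of_forall fun z => rfl)).1 l₀ hl₀
      · rw [hzz, h1]
        exact mul_ne_zero (Nat.cast_ne_zero.2 (Nat.factorial_ne_zero _))
          (ha₀ _ (mem_bidisc.1 hz).1)
      · exact analyticAt_comp_blowup (z := (z.1, 0)) (hu i₀ _ (blowup_mem_bidisc (hz0 z hz)))
    · refine ⟨i₁, e i₁ - 1, by omega, ?_⟩
      by_cases h0 : mon γ z.1 = 0
      · rw [iterate_dsnd_rescale_of_eq_zero h0 (fun l hl hl' => ?_)]
        · refine mul_ne_zero (hu0 _ _ (hz0 z hz)) (mul_ne_zero ?_ (pow_ne_zero _ ht))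
          rw [Nat.cast_ne_zero, Ne, Nat.descFactorial_eq_zero_iff_lt]
          omega
        · rw [show l = e i₁ - 1 by omega]
          exact ha₁ _ (mem_bidisc.1 hz).1
      · refine iterate_dsnd_rescale_ne_zero hF hz h0 fun h => ?_
        exact mul_ne_zero h0 ht (hd₁ _ (blowup_mem_bidisc hz) h)
  have hloc : ∀ z ∈ bidisc p n, ∃ V ∈ 𝓝 z, IsClopen V ∧
      ((unitPi p n).prod (unitHaar p)).restrict V ∈ Good (n + 1) fun g =>
        (∀ i, Mono 1 fun y => rescale e u a γ i (g y)) ∧ ∀ j, Mono 1 fun y => (g y).1 j := by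
    intro z hz
    obtain ⟨i, k, hk, hne⟩ := hdrop z hz
    let ε := Function.update e i k
    have hlt : ∑ i, ε i < ∑ i, e i := by
      refine Finset.sum_lt_sum (fun j _ => ?_) ⟨i, Finset.mem_univ _, by simpa [ε] using hk⟩
      by_cases hj : j = i
      · subst hj; simpa [ε] using hk.le
      · simp [ε, hj]
    refine IH _ hlt ι (Fin n) (rescale e u a γ) (fun j x => x j) ε z hz
      (fun i => analyticAt_rescale hu ha i hz) (fun j => ?_) le_rfl
      (fun j => analyticOnNhd_coord j univ _ (mem_univ _))
      (fun j => not_eventually_coord_eq_zero j _)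
    by_cases hj : j = i
    · subst hj; simpa [ε] using hne
    · simpa [ε, hj] using hord j z hz
  have h := Good.of_local isCompact_bidisc isClopen_bidisc
    (fun f g hf hg => ⟨fun i => (hf.1 i).comp hg, fun j => (hf.2 j).comp hg⟩) hloc
  rw [restrict_bidisc] at h
  refine Good.mono h ?_
  rintro g - ⟨⟨h1, h2⟩, h3⟩
  exact ⟨h3, ⟨fun y hy => (mem_bidisc.1 (h3 hy)).1, h2⟩, h1⟩

lemma one_mem_polydisc : (1 : Fin n → ℚ_[p]) ∈ polydisc p n := mem_polydisc.2 fun _ => by simp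

lemma mon_one (γ : Fin n → ℕ) : mon γ (1 : Fin n → ℚ_[p]) = 1 := by simp [mon]

section

variable {ι : Type} [Fintype ι] {e : ι → ℕ} {F u : ι → (Fin n → ℚ_[p]) × ℚ_[p] → ℚ_[p]}
  {b : ι → ℕ → (Fin n → ℚ_[p]) → ℚ_[p]} {r : ι → ℝ}

/-- Weierstrass polynomials whose coefficients are comparable monomials can be monomialized, given
the result for smaller total order. -/
lemma weierstrass_mem_good (hu : ∀ i, AnalyticOnNhd ℚ_[p] (u i) (bidisc p n)) (hr : ∀ i, 0 < r i)
    (hur : ∀ i, ∀ z ∈ bidisc p n, ‖u i z‖ = r i)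
    (hbr : ∀ i, ∀ l < e i, ∀ y ∈ polydisc p n, ‖b i l y‖ ≤ r i)
    (hF : ∀ i, ∀ z ∈ bidisc p n, F i z =
      ∑ l ∈ Finset.range (e i), b i l z.1 * z.2 ^ l + u i z * z.2 ^ e i)
    (S : Finset (ι × ℕ)) (hS : ∀ q ∈ S, q.2 < e q.1)
    (hS0 : ∀ i, ∀ l < e i, (i, l) ∉ S → ∀ y ∈ polydisc p n, b i l y = 0)
    (δ : ι × ℕ → Fin n → ℕ) (v : ι × ℕ → (Fin n → ℚ_[p]) → ℚ_[p]) (hv : ∀ q ∈ S, IsUnitOn (v q))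
    (hb : ∀ q ∈ S, ∀ y ∈ polydisc p n, b q.1 q.2 y = mon (δ q) y ^ (e q.1 - q.2) * v q y)
    (hcomp : ∀ q ∈ S, ∀ q' ∈ S, δ q ≤ δ q' ∨ δ q' ≤ δ q)
    (hd : ∀ i, ∀ z ∈ bidisc p n, dsnd^[e i] (F i) z ≠ 0)
    (hc : S.Nonempty → ∃ i, e i ≠ 0 ∧ (i, e i - 1) ∉ S ∧
      ∀ z ∈ bidisc p n, dsnd^[e i - 1] (F i) z = 0 → z.2 = 0)
    (IH : ∀ s < ∑ i, e i, LocalClaim p n s) :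
    (unitPi p n).prod (unitHaar p) ∈ Good (n + 1) (IsChart F) := by
  classical
  rcases S.eq_empty_or_nonempty with rfl | hne
  · rw [← map_splitFirst]
    refine Good.map (unitPi_mem_good_nice one_ne_zero) measurableSet_polydisc
      continuous_splitFirst.continuousOn fun g hg hgn => ?_
    have han : AnalyticOnNhd ℚ_[p] (fun y => splitFirst (g y)) (polydisc p (n + 1)) :=
      (analyticOnNhd_splitFirst univ).comp hg (mapsTo_univ _ _)
    have hmaps : MapsTo (fun y => splitFirst (g y)) (polydisc p (n + 1)) (bidisc p n) :=
      fun y hy => mem_bidisc.2 (splitFirst_mem (hgn.1 hy))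
    refine ⟨hgn.1, han, hmaps, ⟨fun y hy => (mem_bidisc.1 (hmaps hy)).1, fun j =>
      hgn.2 j.succ⟩, fun i => ?_⟩
    have hunit : IsUnitOn fun y => u i (splitFirst (g y)) :=
      ⟨fun y hy => AnalyticAt.comp (f := fun y => splitFirst (g y)) (hu i _ (hmaps hy)) (han y hy),
        r i, hr i, fun y hy => hur i _ (hmaps hy)⟩
    refine ((Mono.of_unit hunit).mul ((hgn.2 0).pow (e i))).congr fun y hy => ?_
    change _ = F i (splitFirst (g y))
    rw [hF i _ (hmaps hy), Finset.sum_eq_zero, zero_add]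
    · rfl
    · intro l hl
      rw [hS0 i l (Finset.mem_range.1 hl) (Finset.notMem_empty _) _ (mem_bidisc.1 (hmaps hy)).1,
        zero_mul]
  obtain ⟨i₁, hi₁, hi₁S, hd₁⟩ := hc hne
  obtain ⟨q₀, hq₀, hmin⟩ := S.exists_minimalFor δ hne
  have hle : ∀ q ∈ S, δ q₀ ≤ δ q := fun q hq =>
    (hcomp q hq q₀ hq₀).elim (fun h => hmin hq h) id
  let a : ι → ℕ → (Fin n → ℚ_[p]) → ℚ_[p] := fun i l y =>
    if (i, l) ∈ S then mon (δ (i, l) - δ q₀) y ^ (e i - l) * v (i, l) y else 0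
  have ha : ∀ i, ∀ l < e i, AnalyticOnNhd ℚ_[p] (a i l) (polydisc p n) := by
    intro i l hl
    by_cases h : (i, l) ∈ S
    · simp only [a, h, if_true]
      exact ((analyticOnNhd_mon _ _).pow _).mul (hv _ h).1
    · simp only [a, h, if_false]
      exact analyticOnNhd_const
  have har : ∀ i, ∀ l < e i, ∀ y ∈ polydisc p n, ‖a i l y‖ ≤ r i := by
    intro i l hl y hy
    by_cases h : (i, l) ∈ S
    · simp only [a, h, if_true, norm_mul, norm_pow]
      obtain ⟨-, s, hs, hvs⟩ := hv _ h
      have h1 := hbr i l hl 1 one_mem_polydisc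
      rw [hb _ h 1 one_mem_polydisc, mon_one, one_pow, one_mul, hvs 1 one_mem_polydisc] at h1
      rw [hvs y hy]
      exact (mul_le_of_le_one_left hs.le
        (pow_le_one₀ (norm_nonneg _) (norm_mon_le_one _ hy))).trans h1
    · simp only [a, h, if_false, norm_zero]
      exact (hr i).le
  have hF' : ∀ i, ∀ z ∈ bidisc p n, F i z = ∑ l ∈ Finset.range (e i),
      mon (δ q₀) z.1 ^ (e i - l) * a i l z.1 * z.2 ^ l + u i z * z.2 ^ e i := by
    intro i z hz
    rw [hF i z hz]
    congr 1
    refine Finset.sum_congr rfl fun l hl => ?_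
    congr 1
    by_cases h : (i, l) ∈ S
    · simp only [a, h, if_true]
      rw [hb _ h _ (mem_bidisc.1 hz).1, ← mul_assoc, ← mul_pow, ← mon_add,
        add_tsub_cancel_of_le (hle _ h)]
    · simp only [a, h, if_false, mul_zero]
      exact hS0 i l (Finset.mem_range.1 hl) h _ (mem_bidisc.1 hz).1
  have hu0 : ∀ i, ∀ z ∈ bidisc p n, u i z ≠ 0 := fun i z hz => by
    rw [← norm_pos_iff, hur i z hz]; exact hr i
  have hresc := rescale_mem_good hu hu0 ha hF' hd (hS q₀ hq₀)
    (fun y hy => by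
      obtain ⟨-, s, hs, hvs⟩ := hv _ hq₀
      have : v q₀ y ≠ 0 := by rw [← norm_pos_iff, hvs y hy]; exact hs
      simpa [a, hq₀] using this)
    hi₁ (fun y _ => by simp only [a, hi₁S, if_false]) hd₁ IH
  have h1 := restrict_le_mem_good hF' hresc
  have h2 := restrict_lt_mem_good hu hr hur ha har hF'
  have hm : MeasurableSet {q : (Fin n → ℚ_[p]) × ℚ_[p] | ‖q.2‖ ≤ ‖mon (δ q₀) q.1‖} :=
    measurableSet_le measurable_snd.norm
      ((continuous_mon _).measurable.norm.comp measurable_fst)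
  rw [← restrict_add_restrict_compl (μ := (unitPi p n).prod (unitHaar p)) hm]
  refine add_mem h1 ?_
  convert h2 using 2
  ext q
  simp

end

lemma exists_order {ι X : Type*} {F : ι → X × ℚ_[p] → ℚ_[p]} {z : X × ℚ_[p]} {ε : ι → ℕ}
    (h : ∀ i, dsnd^[ε i] (F i) z ≠ 0) : ∃ e : ι → ℕ, (∀ i, e i ≤ ε i) ∧
      (∀ i, dsnd^[e i] (F i) z ≠ 0) ∧ ∀ i, ∀ l < e i, dsnd^[l] (F i) z = 0 := by
  classical
  have h' : ∀ i, ∃ l, dsnd^[l] (F i) z ≠ 0 := fun i => ⟨_, h i⟩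
  exact ⟨fun i => Nat.find (h' i), fun i => Nat.find_le (h i), fun i => Nat.find_spec (h' i),
    fun i l hl => not_not.1 (Nat.find_min (h' i) hl)⟩

section

variable {E : Type*} [NormedAddCommGroup E] [NormedSpace ℚ_[p] E]
  {ι : Type*} {F : ι → E × ℚ_[p] → ℚ_[p]} {e : ι → ℕ} {z : E × ℚ_[p]}

lemma iterate_dsnd_translate (F : E × ℚ_[p] → ℚ_[p]) (φ : E → ℚ_[p]) (l : ℕ) (z : E × ℚ_[p]) :
    dsnd^[l] (fun z => F (z.1, φ z.1 + z.2)) z = dsnd^[l] F (z.1, φ z.1 + z.2) := by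
  have h := iterate_dsnd_affine F (fun x => x) (fun _ => 1) φ (fun _ => 1) l z
  simpa only [one_mul, one_pow] using h

/-- A local centre for functions that are regular in the last variable. -/
lemma exists_center [CompleteSpace E] (hF : ∀ i, AnalyticAt ℚ_[p] (F i) z)
    (he : ∀ i, dsnd^[e i] (F i) z ≠ 0)
    (hl : ∀ i, ∀ l < e i, dsnd^[l] (F i) z = 0) :
    ∃ φ : E → ℚ_[p], AnalyticAt ℚ_[p] φ z.1 ∧ φ z.1 = z.2 ∧ ((∃ i, e i ≠ 0) → ∃ i, e i ≠ 0 ∧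
      ∀ᶠ x in 𝓝 z.1, dsnd^[e i - 1] (F i) (x, φ x) = 0) := by
  by_cases h : ∃ i, e i ≠ 0
  · obtain ⟨i, hi⟩ := h
    obtain ⟨φ, h1, h2, h3⟩ := exists_implicit (analyticAt_iterate_dsnd (hF i) (e i - 1))
      (hl i _ (by omega)) (by
        rw [← Function.iterate_succ_apply' dsnd, Nat.succ_eq_add_one,
          Nat.sub_add_cancel (Nat.one_le_iff_ne_zero.2 hi)]
        exact he i)
    exact ⟨φ, h1, h2, fun _ => ⟨i, hi, h3⟩⟩
  · exact ⟨fun _ => z.2, analyticAt_const, rfl, fun h' => absurd h' h⟩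

lemma analyticAt_translate {F : E × ℚ_[p] → ℚ_[p]} (hF : AnalyticAt ℚ_[p] F z) {φ : E → ℚ_[p]}
    (hφ : AnalyticAt ℚ_[p] φ z.1) (hφz : φ z.1 = z.2) :
    AnalyticAt ℚ_[p] (fun z => F (z.1, φ z.1 + z.2)) (z.1, 0) := by
  have hφ' : AnalyticAt ℚ_[p] (fun w : E × ℚ_[p] => φ w.1) (z.1, 0) :=
    AnalyticAt.comp (g := φ) (f := Prod.fst) hφ analyticAt_fst
  refine AnalyticAt.comp (g := F) (f := fun w : E × ℚ_[p] => (w.1, φ w.1 + w.2)) ?_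
    (analyticAt_fst.prod (hφ'.add analyticAt_snd))
  simpa only [add_zero, hφz] using hF

/-- Weierstrass normal form around a local centre. -/
lemma exists_normal_form [CompleteSpace E] (hF : ∀ i, AnalyticAt ℚ_[p] (F i) z)
    (he : ∀ i, dsnd^[e i] (F i) z ≠ 0) (hl : ∀ i, ∀ l < e i, dsnd^[l] (F i) z = 0) :
    ∃ (φ : E → ℚ_[p]) (a : ι → ℕ → E → ℚ_[p]) (u : ι → E × ℚ_[p] → ℚ_[p]),
      AnalyticAt ℚ_[p] φ z.1 ∧ φ z.1 = z.2 ∧ (∀ i l, AnalyticAt ℚ_[p] (a i l) z.1) ∧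
      (∀ i, ∀ l < e i, a i l z.1 = 0) ∧ (∀ i, AnalyticAt ℚ_[p] (u i) (z.1, 0)) ∧
      (∀ i, u i (z.1, 0) ≠ 0) ∧
      (∀ i, ∀ᶠ w in 𝓝 (z.1, (0 : ℚ_[p])), F i (w.1, φ w.1 + w.2) =
        ∑ l ∈ Finset.range (e i), a i l w.1 * w.2 ^ l + u i w * w.2 ^ e i) ∧
      (∀ i, ∀ᶠ w in 𝓝 (z.1, (0 : ℚ_[p])), dsnd^[e i] (F i) (w.1, φ w.1 + w.2) ≠ 0) ∧
      ((∃ i, e i ≠ 0) → ∃ i, e i ≠ 0 ∧ (∀ᶠ x in 𝓝 z.1, a i (e i - 1) x = 0) ∧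
        ∀ᶠ w in 𝓝 (z.1, (0 : ℚ_[p])), dsnd^[e i - 1] (F i) (w.1, φ w.1 + w.2) = 0 → w.2 = 0) := by
  obtain ⟨φ, hφ, hφz, hc⟩ := exists_center hF he hl
  choose a u ha hu hG using fun i => exists_taylor (e i) (analyticAt_translate (hF i) hφ hφz)
  have hD : ∀ i l, AnalyticAt ℚ_[p] (fun w => dsnd^[l] (F i) (w.1, φ w.1 + w.2)) (z.1, 0) :=
    fun i l => analyticAt_translate (analyticAt_iterate_dsnd (hF i) l) hφ hφz
  have ht := fun i => iterate_dsnd_taylor (e i) (fun l _ => ha i l) (hu i) (hG i)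
  simp only [iterate_dsnd_translate, add_zero, hφz] at ht
  refine ⟨φ, a, u, hφ, hφz, ha, fun i l hli => ?_, hu, fun i h0 => ?_, hG, fun i => ?_, ?_⟩
  · have h := (ht i).1 l hli
    rw [hl i l hli, eq_comm] at h
    exact (mul_eq_zero.1 h).resolve_left (Nat.cast_ne_zero.2 (Nat.factorial_ne_zero _))
  · have h := (ht i).2
    rw [h0, mul_zero] at h
    exact he i h
  · refine (hD i (e i)).continuousAt.eventually_ne ?_
    simpa only [add_zero, hφz] using he i
  · intro hex
    obtain ⟨i, hi, hi0⟩ := hc hex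
    have hcx : ContinuousAt (fun x : E => (x, (0 : ℚ_[p]))) z.1 := by fun_prop
    refine ⟨i, hi, ?_, ?_⟩
    · have h1 : ∀ᶠ x in 𝓝 z.1, ∀ᶠ w in 𝓝 (x, (0 : ℚ_[p])), F i (w.1, φ w.1 + w.2) =
          ∑ l ∈ Finset.range (e i), a i l w.1 * w.2 ^ l + u i w * w.2 ^ e i :=
        hcx.eventually (hG i).eventually_nhds
      have h2 : ∀ᶠ x in 𝓝 z.1, AnalyticAt ℚ_[p] (u i) (x, 0) :=
        hcx.eventually (hu i).eventually_analyticAt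
      have h3 : ∀ᶠ x in 𝓝 z.1, ∀ l ∈ Finset.range (e i), AnalyticAt ℚ_[p] (a i l) x :=
        (Finset.eventually_all _).2 fun l _ => (ha i l).eventually_analyticAt
      filter_upwards [h1, h2, h3, hi0] with x h1 h2 h3 h4
      have h := (iterate_dsnd_taylor (e i) (fun l hl => h3 l (Finset.mem_range.2 hl)) h2 h1).1
        (e i - 1) (by omega)
      rw [iterate_dsnd_translate] at h
      simp only [add_zero, h4] at h
      exact (mul_eq_zero.1 h.symm).resolve_left (Nat.cast_ne_zero.2 (Nat.factorial_ne_zero _))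
    · obtain ⟨H, hH, hHe⟩ := exists_eq_add_mul (hD i (e i - 1))
      have hH0 : H (z.1, 0) ≠ 0 := by
        have h := (iterate_dsnd_taylor 1 (x := z.1) (u := H)
          (a := fun _ x => dsnd^[e i - 1] (F i) (x, φ x + 0))
          (G := fun w => dsnd^[e i - 1] (F i) (w.1, φ w.1 + w.2)) (fun l _ => ?_) hH ?_).2
        · rw [iterate_dsnd_translate, Function.iterate_one,
            ← Function.iterate_succ_apply' dsnd, Nat.succ_eq_add_one,
            Nat.sub_add_cancel (Nat.one_le_iff_ne_zero.2 hi)] at h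
          simp only [add_zero, hφz] at h
          intro h0
          rw [h0, mul_zero] at h
          exact he i h
        · exact AnalyticAt.comp (g := fun w => dsnd^[e i - 1] (F i) (w.1, φ w.1 + w.2))
            (f := fun x => (x, (0 : ℚ_[p]))) (hD i (e i - 1))
            (analyticAt_id.prod analyticAt_const)
        · filter_upwards [hHe] with w hw
          rw [hw]; simp [mul_comm]
      have hi0' : ∀ᶠ w in 𝓝 (z.1, (0 : ℚ_[p])), dsnd^[e i - 1] (F i) (w.1, φ w.1) = 0 :=
        (continuous_fst.continuousAt (x := (z.1, (0 : ℚ_[p])))).eventually hi0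
      filter_upwards [hHe, hH.continuousAt.eventually_ne hH0, hi0'] with w h1 h2 h3 h4
      rw [h4, add_zero, h3, zero_add] at h1
      exact (mul_eq_zero.1 h1.symm).resolve_right h2

end

lemma exists_clopen_subset {s : Set (Fin n → ℚ_[p])} {x : Fin n → ℚ_[p]} (hs : s ∈ 𝓝 x) :
    ∃ O ∈ 𝓝 x, IsClopen O ∧ O ⊆ s := by
  obtain ⟨ε, hε, h⟩ := Metric.nhds_basis_closedBall.mem_iff.1 hs
  exact ⟨closedBall x ε, closedBall_mem_nhds _ hε,
    IsUltrametricDist.isClopen_closedBall _ hε.ne', h⟩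

lemma exists_box {x : Fin n → ℚ_[p]} {P : (Fin n → ℚ_[p]) × ℚ_[p] → Prop}
    (h : ∀ᶠ w in 𝓝 (x, (0 : ℚ_[p])), P w) :
    ∃ m : ℕ, ∃ O ∈ 𝓝 x, ∀ y ∈ O, ∀ t, ‖t‖ ≤ (p : ℝ) ^ (-m : ℤ) → P (y, t) := by
  rw [nhds_prod_eq, Filter.eventually_prod_iff] at h
  obtain ⟨pa, ha, pb, hb, hP⟩ := h
  obtain ⟨ε, hε, h⟩ := Metric.nhds_basis_closedBall.eventually_iff.1 hb
  obtain ⟨m, -, hm⟩ := exists_pow_neg_lt (p := p) hε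
  exact ⟨m, _, ha, fun y hy t ht => hP hy (h (by simpa using ht.trans hm))⟩

/-- Local simultaneous monomialization of analytic functions with nonzero germ. -/
def Claim (p : ℕ) [Fact p.Prime] (n : ℕ) : Prop :=
  ∀ (ι : Type) [Fintype ι] (F : ι → (Fin n → ℚ_[p]) → ℚ_[p]) (x : Fin n → ℚ_[p]),
    x ∈ polydisc p n → (∀ i, AnalyticAt ℚ_[p] (F i) x) → (∀ i, ¬ ∀ᶠ y in 𝓝 x, F i y = 0) →
    ∃ V ∈ 𝓝 x, IsClopen V ∧ (unitPi p n).restrict V ∈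
      Good n fun g : (Fin n → ℚ_[p]) → Fin n → ℚ_[p] => ∀ i, Mono 1 fun y => F i (g y)

/-- Monomialization in which suitable powers of the functions become comparable monomials. -/
lemma Claim.comparable (hC : Claim p n) {κ τ : Type} [Fintype κ] [Fintype τ]
    {w : κ → (Fin n → ℚ_[p]) → ℚ_[p]} {A : τ → (Fin n → ℚ_[p]) → ℚ_[p]} {x : Fin n → ℚ_[p]}
    (hx : x ∈ polydisc p n) (hw : ∀ j, AnalyticAt ℚ_[p] (w j) x)
    (hw0 : ∀ j, ¬ ∀ᶠ y in 𝓝 x, w j y = 0) (hA : ∀ q, AnalyticAt ℚ_[p] (A q) x) (k : τ → ℕ)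
    (hk : ∀ q, k q ≠ 0) {O : Set (Fin n → ℚ_[p])} (hO : O ∈ 𝓝 x) :
    ∃ V ∈ 𝓝 x, V ⊆ O ∧ IsClopen V ∧ (unitPi p n).restrict V ∈
      Good n fun f : (Fin n → ℚ_[p]) → Fin n → ℚ_[p] => MapsTo f (polydisc p n) O ∧
        (∀ j, Mono 1 fun y => w j (f y)) ∧
        (∀ q, (∀ᶠ y in 𝓝 x, A q y = 0) → ∀ y ∈ polydisc p n, A q (f y) = 0) ∧
        ∃ (δ : τ → Fin n → ℕ) (v : τ → (Fin n → ℚ_[p]) → ℚ_[p]),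
          (∀ q, (¬ ∀ᶠ y in 𝓝 x, A q y = 0) → IsUnitOn (v q) ∧ ∀ y ∈ polydisc p n,
            A q (f y) = mon (δ q) y ^ k q * v q y) ∧
          ∀ q q', (¬ ∀ᶠ y in 𝓝 x, A q y = 0) → (¬ ∀ᶠ y in 𝓝 x, A q' y = 0) →
            δ q ≤ δ q' ∨ δ q' ≤ δ q := by
  classical
  set N := ∏ q, k q with hN
  have hN0 : N ≠ 0 := Finset.prod_ne_zero_iff.2 fun q _ => hk q
  have hkN : ∀ q, k q * (N / k q) = N := fun q =>
    Nat.mul_div_cancel' (Finset.dvd_prod_of_mem k (Finset.mem_univ q))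
  let B : τ → (Fin n → ℚ_[p]) → ℚ_[p] := fun q y => A q y ^ (N / k q)
  have hB : ∀ q, AnalyticAt ℚ_[p] (B q) x := fun q => (hA q).pow _
  let G : ({q : τ // ¬ ∀ᶠ y in 𝓝 x, A q y = 0} ⊕ κ) ⊕
      {q : τ × τ // ¬ ∀ᶠ y in 𝓝 x, B q.1 y - B q.2 y = 0} → (Fin n → ℚ_[p]) → ℚ_[p] :=
    Sum.elim (Sum.elim (fun q => A q.1) w) fun q y => B q.1.1 y - B q.1.2 y
  obtain ⟨V, hV, hVc, hVG⟩ := hC _ G x hx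
    (by rintro ((q | j) | q); exacts [hA _, hw _, (hB _).sub (hB _)])
    (by rintro ((q | j) | q); exacts [q.2, hw0 j, q.2])
  have hev : ∀ᶠ y in 𝓝 x, y ∈ O ∧ (∀ q, (∀ᶠ y in 𝓝 x, A q y = 0) → A q y = 0) ∧
      ∀ q q', (∀ᶠ y in 𝓝 x, B q y - B q' y = 0) → B q y - B q' y = 0 := by
    refine Filter.Eventually.and hO (Filter.Eventually.and ?_ ?_)
    · refine eventually_all.2 fun q => ?_
      by_cases h : ∀ᶠ y in 𝓝 x, A q y = 0
      · filter_upwards [h] with y hy _ using hy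
      · exact Eventually.of_forall fun y h' => absurd h' h
    · refine eventually_all.2 fun q => eventually_all.2 fun q' => ?_
      by_cases h : ∀ᶠ y in 𝓝 x, B q y - B q' y = 0
      · filter_upwards [h] with y hy _ using hy
      · exact Eventually.of_forall fun y h' => absurd h' h
  obtain ⟨O', hO', hOc, hOs⟩ := exists_clopen_subset hev
  refine ⟨O' ∩ V, inter_mem hO' hV, fun y hy => (hOs hy.1).1, hOc.inter hVc, ?_⟩
  rw [← restrict_restrict hOc.isOpen.measurableSet]
  have h1 := Good.restrict hVG (fun f g hf hg i => (hf i).comp hg) hOc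
  refine Good.of_unitPi (unitPi_mem_good_nice hN0) (fun g hg => hg.to_one) h1 ?_
  rintro f g ⟨hf, hfO⟩ hg
  have hfg : ∀ y ∈ polydisc p n, f (g y) ∈ O' := fun y hy => hfO (hg.1 hy)
  have hA' : ∀ q : {q : τ // ¬ ∀ᶠ y in 𝓝 x, A q y = 0}, Mono N fun y => A q.1 (f (g y)) :=
    fun q => (hf (Sum.inl (Sum.inl q))).comp_nice hg
  have hex : ∀ q : τ, ∃ (α : Fin n → ℕ) (v : (Fin n → ℚ_[p]) → ℚ_[p]),
      (¬ ∀ᶠ y in 𝓝 x, A q y = 0) → IsUnitOn v ∧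
        ∀ y ∈ polydisc p n, A q (f (g y)) = mon α y ^ N * v y := by
    intro q
    by_cases h : ∀ᶠ y in 𝓝 x, A q y = 0
    · exact ⟨0, 0, fun h' => absurd h h'⟩
    · obtain ⟨α, v, h1, h2⟩ := hA' ⟨q, h⟩
      exact ⟨α, v, fun _ => ⟨h1, h2⟩⟩
  choose α v hαv using hex
  refine ⟨fun y hy => (hOs (hfg y hy)).1, fun j => ?_,
    fun q hq y hy => (hOs (hfg y hy)).2.1 q hq, fun q => (N / k q) • α q, v, fun q hq => ?_,
    fun q q' hq hq' => ?_⟩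
  · exact (hf (Sum.inl (Sum.inr j))).comp hg.to_one
  · refine ⟨(hαv q hq).1, fun y hy => ?_⟩
    rw [mon_smul, ← pow_mul, mul_comm (N / k q), hkN]
    exact (hαv q hq).2 y hy
  · have hform : ∀ q, (¬ ∀ᶠ y in 𝓝 x, A q y = 0) → ∀ y ∈ polydisc p n,
        B q (f (g y)) = mon (N • ((N / k q) • α q)) y * v q y ^ (N / k q) := by
      intro q hq y hy
      simp only [B]
      rw [(hαv q hq).2 y hy, mul_pow, mon_smul, mon_smul, ← pow_mul, ← pow_mul, mul_comm N]
    have h := exponents_comparable ((hαv q hq).1.pow (N / k q)) ((hαv q' hq').1.pow (N / k q'))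
      (hform q hq) (hform q' hq') (by
        by_cases hD : ∀ᶠ y in 𝓝 x, B q y - B q' y = 0
        · exact Or.inl fun y hy => (hOs (hfg y hy)).2.2 q q' hD
        · exact Or.inr ((hf (Sum.inr ⟨(q, q'), hD⟩)).comp hg.to_one))
    refine h.imp (fun h j => ?_) (fun h j => ?_)
    · exact Nat.le_of_mul_le_mul_left (h j) (Nat.pos_of_ne_zero hN0)
    · exact Nat.le_of_mul_le_mul_left (h j) (Nat.pos_of_ne_zero hN0)

/-- Shearing a box. -/
lemma restrict_box {O : Set (Fin n → ℚ_[p])} (hO : MeasurableSet O) {c : ℚ_[p]} (hc : ‖c‖ ≤ 1)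
    (m : ℕ) {φ : (Fin n → ℚ_[p]) → ℚ_[p]} (hφ : Measurable φ)
    (hφc : ∀ x ∈ O, ‖φ x - c‖ ≤ (p : ℝ) ^ (-m : ℤ)) :
    ((unitPi p n).prod (unitHaar p)).restrict (O ×ˢ closedBall c ((p : ℝ) ^ (-m : ℤ))) =
      ‖(p : ℚ_[p]) ^ m‖₊ • (((unitPi p n).restrict O).prod (unitHaar p)).map
        fun q => (q.1, φ q.1 + (p : ℚ_[p]) ^ m * q.2) := by
  have hΨ : Measurable fun q : (Fin n → ℚ_[p]) × ℚ_[p] => (q.1, φ q.1 + (p : ℚ_[p]) ^ m * q.2) :=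
    measurable_fst.prodMk ((hφ.comp measurable_fst).add (measurable_snd.const_mul _))
  rw [← Measure.prod_restrict]
  refine Measure.ext fun s hs => ?_
  rw [Measure.smul_apply, Measure.map_apply hΨ hs, Measure.prod_apply hs,
    Measure.prod_apply (hΨ hs), ENNReal.smul_def, smul_eq_mul, ← lintegral_const_mul']
  · refine setLIntegral_congr_fun hO fun x hx => ?_
    have hball : closedBall c ((p : ℝ) ^ (-m : ℤ)) = closedBall (φ x) ((p : ℝ) ^ (-m : ℤ)) := by
      refine (IsUltrametricDist.closedBall_eq_of_mem ?_)
      simpa [dist_eq_norm] using hφc x hx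
    have hφ1 : ‖φ x‖ ≤ 1 := by
      have : φ x = (φ x - c) + c := by ring
      rw [this]
      refine (IsUltrametricDist.norm_add_le_max _ _).trans (max_le ?_ hc)
      exact (hφc x hx).trans (zpow_neg_natCast_le_one m)
    have hm : Measurable fun t => φ x + (p : ℚ_[p]) ^ m * t :=
      (measurable_id.const_mul _).const_add _
    rw [hball, unitHaar_restrict_closedBall_natCast hφ1, Measure.smul_apply,
      Measure.map_apply hm (measurable_prodMk_left hs)]
    rfl
  · exact ENNReal.coe_ne_top

/-- The product of a good measure with the Haar measure of the disc, sheared along `φ`. -/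
lemma Good.prod_chart {ι κ : Type}
    {F : ι → (Fin n → ℚ_[p]) × ℚ_[p] → ℚ_[p]} {w : κ → (Fin n → ℚ_[p]) → ℚ_[p]}
    {φ φ' : (Fin n → ℚ_[p]) → ℚ_[p]} {O : Set (Fin n → ℚ_[p])}
    (hφ : AnalyticOnNhd ℚ_[p] φ O) (hφ' : Measurable φ') (hφφ : EqOn φ φ' O) {c : ℚ_[p]}
    {P : ((Fin n → ℚ_[p]) → Fin n → ℚ_[p]) → Prop} {μ : Measure (Fin n → ℚ_[p])}
    (hμ : μ ∈ Good n P) (hP : ∀ f, P f → MapsTo f (polydisc p n) O ∧ ∀ j, Mono 1 fun y => w j (f y))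
    (h : ∀ f, AnalyticOnNhd ℚ_[p] f (polydisc p n) → P f → (unitPi p n).prod (unitHaar p) ∈
      Good (n + 1) (IsChart fun i q => F i (f q.1, φ (f q.1) + c * q.2))) :
    (μ.prod (unitHaar p)).map (fun q => (q.1, φ' q.1 + c * q.2)) ∈ Good (n + 1) fun g =>
      (∀ i, Mono 1 fun y => F i (g y)) ∧ ∀ j, Mono 1 fun y => w j (g y).1 := by
  have hΨ : Measurable fun q : (Fin n → ℚ_[p]) × ℚ_[p] => (q.1, φ' q.1 + c * q.2) :=
    measurable_fst.prodMk ((hφ'.comp measurable_fst).add (measurable_snd.const_mul _))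
  refine Good.prod_unitHaar hμ hΨ fun f hf hPf => ⟨_, h f hf hPf, ?_, fun g hg hgc => ?_⟩
  · obtain ⟨hfO, -⟩ := hP f hPf
    have hf1 : ContinuousOn (fun q : (Fin n → ℚ_[p]) × ℚ_[p] => f q.1)
        (Prod.fst ⁻¹' polydisc p n) :=
      hf.continuousOn.comp continuous_fst.continuousOn (mapsTo_preimage _ _)
    have hf2 : ContinuousOn (fun q : (Fin n → ℚ_[p]) × ℚ_[p] => φ (f q.1))
        (Prod.fst ⁻¹' polydisc p n) := hφ.continuousOn.comp hf1 fun q hq => hfO hq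
    have hf3 : ContinuousOn (fun q : (Fin n → ℚ_[p]) × ℚ_[p] => (f q.1, φ (f q.1) + c * q.2))
        (Prod.fst ⁻¹' polydisc p n) := hf1.prodMk (hf2.add (by fun_prop))
    refine hf3.congr fun q hq => ?_
    simp only [hφφ (hfO hq)]
  · obtain ⟨hfO, hfw⟩ := hP f hPf
    obtain ⟨hgm, hgn, hgF⟩ := hgc
    have hmem : ∀ y ∈ polydisc p (n + 1), f (g y).1 ∈ O := fun y hy => hfO (hgn.1 hy)
    refine ⟨hgn, ?_, fun i => (hgF i).congr fun y hy => ?_, fun j => (hfw j).comp hgn⟩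
    · have h1 : AnalyticOnNhd ℚ_[p] (fun y => f (g y).1) (polydisc p (n + 1)) :=
        hf.comp hgn.analyticOnNhd hgn.1
      have h2 : AnalyticOnNhd ℚ_[p] (fun y => φ (f (g y).1)) (polydisc p (n + 1)) :=
        hφ.comp h1 hmem
      have h3 : AnalyticOnNhd ℚ_[p] (fun y => (g y).2) (polydisc p (n + 1)) := fun y hy =>
        analyticAt_snd.comp (hg y hy)
      have h4 : AnalyticOnNhd ℚ_[p] (fun y => (f (g y).1, φ (f (g y).1) + c * (g y).2))
          (polydisc p (n + 1)) := fun y hy =>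
        (h1 y hy).prod ((h2 y hy).add (analyticAt_const.mul (h3 y hy)))
      refine h4.congr isOpen_polydisc fun y hy => ?_
      simp only [hφφ (hmem y hy)]
    · simp only [hφφ (hmem y hy)]

/-- The inductive step that eliminates the last variable. -/
lemma localClaim (hC : Claim p n) (s : ℕ) : LocalClaim p n s := by
  classical
  induction s using Nat.strong_induction_on with
  | _ s IH =>
  intro ι κ _ _ F w ε z hz hF hε hs hw hw0
  obtain ⟨e, heε, he, hl⟩ := exists_order hε
  have hes : ∑ i, e i ≤ s := (Finset.sum_le_sum fun i _ => heε i).trans hs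
  obtain ⟨φ, a, u, hφ, hφz, ha, ha0, hu, hu0, hG, hd, hc⟩ := exists_normal_form hF he hl
  have hc' : ∃ D : (Fin n → ℚ_[p]) × ℚ_[p] → Prop, (∀ᶠ q in 𝓝 (z.1, (0 : ℚ_[p])), D q) ∧
      ((∃ i, e i ≠ 0) → ∃ i, e i ≠ 0 ∧ (∀ᶠ x in 𝓝 z.1, a i (e i - 1) x = 0) ∧
        ∀ q, D q → dsnd^[e i - 1] (F i) (q.1, φ q.1 + q.2) = 0 → q.2 = 0) := by
    by_cases h : ∃ i, e i ≠ 0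
    · obtain ⟨i, h1, h2, h3⟩ := hc h
      exact ⟨_, h3, fun _ => ⟨i, h1, h2, fun q hq => hq⟩⟩
    · exact ⟨fun _ => True, Eventually.of_forall fun _ => trivial, fun h' => absurd h' h⟩
  obtain ⟨D, hD, hDc⟩ := hc'
  have hun : ∀ i, ∀ᶠ q in 𝓝 (z.1, (0 : ℚ_[p])), ‖u i q‖ = ‖u i (z.1, 0)‖ := by
    intro i
    have h := (hu i).continuousAt.eventually (ball_mem_nhds _ (norm_pos_iff.2 (hu0 i)))
    filter_upwards [h] with q hq
    exact norm_eq_of_sub_lt (by simpa [dist_eq_norm] using hq)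
  obtain ⟨m, O₁, hO₁, hbox⟩ := exists_box ((eventually_all.2 hG).and ((eventually_all.2 hd).and
    ((eventually_all.2 fun i => (hu i).eventually_analyticAt).and ((eventually_all.2 hun).and hD))))
  set R : ι → ℝ := fun i => ‖u i (z.1, 0)‖
  have hR : ∀ i, 0 < R i := fun i => norm_pos_iff.2 (hu0 i)
  have hpm : (0 : ℝ) < (p : ℝ) ^ (-m : ℤ) := zpow_pos (by exact_mod_cast hp.out.pos) _
  have hev1 : ∀ᶠ x in 𝓝 z.1, ‖φ x - z.2‖ ≤ (p : ℝ) ^ (-m : ℤ) := by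
    have h := hφ.continuousAt.eventually (closedBall_mem_nhds _ hpm)
    filter_upwards [h] with x hx
    simpa [dist_eq_norm, hφz] using hx
  have hev2 : ∀ᶠ x in 𝓝 z.1, ∀ i, ∀ l ∈ Finset.range (e i),
      AnalyticAt ℚ_[p] (a i l) x ∧ ‖a i l x‖ ≤ R i * ((p : ℝ) ^ (-m : ℤ)) ^ (e i - l) := by
    refine eventually_all.2 fun i => (Finset.eventually_all _).2 fun l hl => ?_
    refine (ha i l).eventually_analyticAt.and ?_
    have h := (ha i l).continuousAt.eventually
      (closedBall_mem_nhds _ (mul_pos (hR i) (pow_pos hpm (e i - l))))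
    filter_upwards [h] with x hx
    simpa [ha0 i l (Finset.mem_range.1 hl)] using hx
  obtain ⟨O, hO, hOc, hOs⟩ := exists_clopen_subset
    (hev1.and (hφ.eventually_analyticAt.and (hev2.and hO₁)))
  obtain ⟨V, hV, hVO, hVc, hgood⟩ := hC.comparable (w := w) (x := z.1) (mem_bidisc.1 hz).1 hw hw0
    (A := fun q : (Σ i, Fin (e i)) => a q.1 q.2) (fun q => ha _ _) (fun q => e q.1 - q.2)
    (fun q => Nat.sub_ne_zero_of_lt q.2.2) hO
  obtain ⟨φ', hφ', hφφ⟩ := extend_measurable hOc.isOpen.measurableSet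
    (f := φ) (fun x hx => (hOs hx).2.1.continuousAt.continuousWithinAt)
  refine ⟨V ×ˢ closedBall z.2 ((p : ℝ) ^ (-m : ℤ)), ?_, hVc.prod
    (IsUltrametricDist.isClopen_closedBall _ hpm.ne'), ?_⟩
  · exact prod_mem_nhds hV (closedBall_mem_nhds _ hpm)
  rw [restrict_box hVc.isOpen.measurableSet (mem_bidisc.1 hz).2 m hφ'
    fun x hx => hφφ (hVO hx) ▸ (hOs (hVO hx)).1]
  refine Submodule.smul_mem _ _ ?_
  refine Good.prod_chart (fun x hx => (hOs hx).2.1) hφ' hφφ hgood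
    (fun f hf => ⟨hf.1, hf.2.1⟩) ?_
  rintro f hf ⟨hfO, -, hf0, δ, v, hδ, hcomp⟩
  set c : ℚ_[p] := (p : ℚ_[p]) ^ m with hcdef
  have hcn : ‖c‖ = (p : ℝ) ^ (-m : ℤ) := norm_natCast_pow m
  have hc0 : c ≠ 0 := pow_ne_zero _ p_ne_zero
  have hin : ∀ q ∈ bidisc p n, f q.1 ∈ O ∧ ‖c * q.2‖ ≤ (p : ℝ) ^ (-m : ℤ) := by
    intro q hq
    rw [mem_bidisc] at hq
    refine ⟨hfO hq.1, ?_⟩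
    rw [norm_mul, hcn]
    exact mul_le_of_le_one_right hpm.le hq.2
  have hb : ∀ q ∈ bidisc p n, _ := fun q hq =>
    hbox _ (hOs (hin q hq).1).2.2.2 _ (hin q hq).2
  let S : Finset (ι × ℕ) := Finset.univ.sigma (fun i => Finset.range (e i)) |>.image
    (fun q => (q.1, q.2)) |>.filter fun q => ¬ ∀ᶠ x in 𝓝 z.1, a q.1 q.2 x = 0
  have hS : ∀ q, q ∈ S ↔ q.2 < e q.1 ∧ ¬ ∀ᶠ x in 𝓝 z.1, a q.1 q.2 x = 0 := by
    rintro ⟨i, l⟩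
    simp [S]
  have hdsnd : ∀ i l q, dsnd^[l] (fun q => F i (f q.1, φ (f q.1) + c * q.2)) q =
      c ^ l * dsnd^[l] (F i) (f q.1, φ (f q.1) + c * q.2) := by
    intro i l q
    have h := iterate_dsnd_affine (F i) f (fun _ => 1) (fun x => φ (f x)) (fun _ => c) l q
    simpa only [one_mul] using h
  refine weierstrass_mem_good (e := e) (u := fun i q => c ^ e i * u i (f q.1, c * q.2))
    (b := fun i l y => c ^ l * a i l (f y)) (r := fun i => ‖c‖ ^ e i * R i) ?_ ?_ ?_ ?_ ?_ S
    (fun q hq => ((hS q).1 hq).1) ?_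
    (fun q => if h : q.2 < e q.1 then δ ⟨q.1, q.2, h⟩ else 0)
    (fun q y => if h : q.2 < e q.1 then c ^ q.2 * v ⟨q.1, q.2, h⟩ y else 0) ?_ ?_ ?_ ?_ ?_
    (fun s' hs' => IH s' (hs'.trans_le hes))
  · intro i q hq
    refine analyticAt_const.mul ?_
    refine AnalyticAt.comp (g := u i) (f := fun q : (Fin n → ℚ_[p]) × ℚ_[p] => (f q.1, c * q.2))
      ((hb q hq).2.2.1 i) ?_
    exact ((hf _ (mem_bidisc.1 hq).1).comp_of_eq analyticAt_fst rfl).prod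
      (analyticAt_const.mul analyticAt_snd)
  · exact fun i => mul_pos (pow_pos (norm_pos_iff.2 hc0) _) (hR i)
  · intro i q hq
    rw [norm_mul, norm_pow, (hb q hq).2.2.2.1 i]
  · intro i l hl y hy
    rw [norm_mul, norm_pow]
    calc
      _ ≤ ‖c‖ ^ l * (R i * ‖c‖ ^ (e i - l)) := by
        rw [hcn]
        exact mul_le_mul_of_nonneg_left ((hOs (hfO hy)).2.2.1 i l (Finset.mem_range.2 hl)).2
          (pow_nonneg hpm.le _)
      _ = ‖c‖ ^ (l + (e i - l)) * R i := by rw [pow_add]; ring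
      _ = _ := by rw [Nat.add_sub_cancel' hl.le]
  · intro i q hq
    rw [(hb q hq).1 i]
    congr 1
    · exact Finset.sum_congr rfl fun l _ => by ring
    · ring
  · intro i l hl hlS y hy
    have h : ∀ᶠ x in 𝓝 z.1, a i l x = 0 := by
      by_contra h
      exact hlS ((hS (i, l)).2 ⟨hl, h⟩)
    have h0 := hf0 ⟨i, l, hl⟩ h y hy
    simp only at h0
    rw [h0, mul_zero]
  · intro q hq
    obtain ⟨h1, h2⟩ := (hS q).1 hq
    simp only [h1, dif_pos]
    exact (IsUnitOn.const (pow_ne_zero _ hc0)).mul (hδ ⟨q.1, q.2, h1⟩ h2).1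
  · intro q hq y hy
    obtain ⟨h1, h2⟩ := (hS q).1 hq
    simp only [h1, dif_pos]
    have h3 := (hδ ⟨q.1, q.2, h1⟩ h2).2 y hy
    simp only at h3
    rw [h3]; ring
  · intro q hq q' hq'
    obtain ⟨h1, h2⟩ := (hS q).1 hq
    obtain ⟨h1', h2'⟩ := (hS q').1 hq'
    simp only [h1, h1', dif_pos]
    exact hcomp ⟨q.1, q.2, h1⟩ ⟨q'.1, q'.2, h1'⟩ h2 h2'
  · intro i q hq
    rw [hdsnd]
    exact mul_ne_zero (pow_ne_zero _ hc0) ((hb q hq).2.1 i)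
  · rintro ⟨q, hq⟩
    have hq := ((hS q).1 hq).1
    obtain ⟨i, hi, hi0, hiD⟩ := hDc ⟨q.1, by omega⟩
    refine ⟨i, hi, fun h => ((hS _).1 h).2 hi0, fun q hq h => ?_⟩
    rw [hdsnd] at h
    have h' := (mul_eq_zero.1 h).resolve_left (pow_ne_zero _ hc0)
    exact (mul_eq_zero.1 (hiD (f q.1, c * q.2) (hb q hq).2.2.2.2 h')).resolve_left hc0

/-- The diagonal of a multilinear form is a polynomial function. -/
lemma exists_mvPolynomial_eval_eq {R σ τ : Type*} [CommRing R] [Fintype σ] [DecidableEq σ]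
    [Fintype τ] (q : MultilinearMap R (fun _ : τ => σ → R) R) :
    ∃ P : MvPolynomial σ R, ∀ v, MvPolynomial.eval v P = q fun _ => v := by
  classical
  refine ⟨∑ r : τ → σ, MvPolynomial.C (q fun k => Pi.single (r k) 1) *
    ∏ k, MvPolynomial.X (r k), fun v => ?_⟩
  have hv : v = ∑ i, v i • (Pi.single i 1 : σ → R) := by
    ext j; simp [Finset.sum_apply, Pi.single_apply]
  conv_rhs => rw [hv]
  rw [MultilinearMap.map_sum]
  simp only [_root_.map_sum, map_mul, MvPolynomial.eval_C, map_prod, MvPolynomial.eval_X]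
  refine Finset.sum_congr rfl fun r _ => ?_
  rw [MultilinearMap.map_smul_univ q (fun k => v (r k)) fun k => Pi.single (r k) 1, smul_eq_mul,
    mul_comm]

/-- A nonzero analytic germ stays nonzero along almost every line. -/
lemma exists_direction_polynomial {F : (Fin n → ℚ_[p]) → ℚ_[p]} {x : Fin n → ℚ_[p]}
    (hF : AnalyticAt ℚ_[p] F x) (hF0 : ¬ ∀ᶠ y in 𝓝 x, F y = 0) :
    ∃ P : MvPolynomial (Fin n) ℚ_[p], P ≠ 0 ∧
      ∀ v, MvPolynomial.eval v P ≠ 0 → ¬ ∀ᶠ s : ℚ_[p] in 𝓝 0, F (x + s • v) = 0 := by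
  obtain ⟨q, hq⟩ := hF
  have h : ∃ m v, (q m fun _ => v) ≠ 0 := by
    by_contra! h
    refine hF0 ?_
    filter_upwards [hq.eventually_hasSum_sub] with y hy
    simp only [h] at hy
    exact hy.unique hasSum_zero
  obtain ⟨m, v₀, hv₀⟩ := h
  obtain ⟨P, hP⟩ := exists_mvPolynomial_eval_eq (q m).toMultilinearMap
  have hP' : ∀ v, MvPolynomial.eval v P = q m fun _ => v := hP
  refine ⟨P, fun h => hv₀ ?_, fun v hv h0 => hv ?_⟩
  · rw [← hP', h, map_zero]
  rw [hP']
  let L : ℚ_[p] →L[ℚ_[p]] (Fin n → ℚ_[p]) := (ContinuousLinearMap.id ℚ_[p] ℚ_[p]).smulRight v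
  have hq0 : HasFPowerSeriesAt (fun y => F (x + y)) q (L 0) := by
    obtain ⟨r, hr⟩ := hq
    exact ⟨r, hr.r_le, hr.r_pos, fun {y} hy => by simpa using hr.hasSum hy⟩
  have h1 := hq0.compContinuousLinearMap
  have h2 := h1.eq_zero_of_eventually (by
    filter_upwards [h0] with s hs
    simpa [L] using hs)
  have h3 := congrArg (fun r : FormalMultilinearSeries ℚ_[p] ℚ_[p] ℚ_[p] => r m fun _ => 1) h2
  have h4 : (L ∘ fun _ : Fin m => (1 : ℚ_[p])) = fun _ => v := by ext k; simp [L]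
  rwa [FormalMultilinearSeries.compContinuousLinearMap_apply, h4] at h3

lemma exists_direction {ι : Type*} [Fintype ι] {F : ι → (Fin (n + 1) → ℚ_[p]) → ℚ_[p]}
    {x : Fin (n + 1) → ℚ_[p]} (hF : ∀ i, AnalyticAt ℚ_[p] (F i) x)
    (hF0 : ∀ i, ¬ ∀ᶠ y in 𝓝 x, F i y = 0) :
    ∃ v ∈ polydisc p n, ∀ i, ¬ ∀ᶠ s : ℚ_[p] in 𝓝 0,
      F i (x + s • (Fin.cons 1 v : Fin (n + 1) → ℚ_[p])) = 0 := by
  choose P hP0 hP using fun i => exists_direction_polynomial (hF i) (hF0 i)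
  have h : ∃ v : Fin (n + 1) → ℚ_[p], ‖v 0‖ = 1 ∧ (∀ j, ‖v j‖ ≤ 1) ∧
      MvPolynomial.eval v (∏ i, P i) ≠ 0 := by
    by_contra! h
    refine (Finset.prod_ne_zero_iff.2 fun i _ => hP0 i : ∏ i, P i ≠ 0) ?_
    refine MvPolynomial.funext_set (fun _ => ball (1 : ℚ_[p]) 1)
      (fun _ => infinite_of_mem_nhds 1 (ball_mem_nhds _ one_pos)) fun v hv => ?_
    have h1 : ∀ j, ‖v j‖ = 1 := fun j => by
      have := hv j trivial
      rw [mem_ball, dist_eq_norm] at this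
      rw [norm_eq_of_sub_lt (a := v j) (b := 1) (by simpa using this), norm_one]
    rw [h v (h1 0) fun j => (h1 j).le, map_zero]
  obtain ⟨v, hv0, hv1, hv⟩ := h
  have hv00 : v 0 ≠ 0 := fun h => by simp [h] at hv0
  refine ⟨fun j => (v 0)⁻¹ * v j.succ, mem_polydisc.2 fun j => by
    rw [norm_mul, norm_inv, hv0]; simpa using hv1 _, fun i h0 => ?_⟩
  rw [map_prod, Finset.prod_ne_zero_iff] at hv
  refine hP i v (hv i (Finset.mem_univ i)) ?_
  have hc : ContinuousAt (fun s : ℚ_[p] => s * v 0) 0 := by fun_prop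
  rw [ContinuousAt, zero_mul] at hc
  filter_upwards [hc.eventually h0] with s hs
  convert hs using 3
  ext j
  refine Fin.cases ?_ (fun j => ?_) j
  · simp
  · simp; field_simp

lemma exists_iterate_dsnd_ne_zero {E : Type*} [NormedAddCommGroup E] [NormedSpace ℚ_[p] E]
    {G : E × ℚ_[p] → ℚ_[p]} {z : E × ℚ_[p]} (hG : AnalyticAt ℚ_[p] G z)
    (h : ¬ ∀ᶠ s in 𝓝 0, G (z.1, z.2 + s) = 0) : ∃ l, dsnd^[l] G z ≠ 0 := by
  have hg : AnalyticAt ℚ_[p] (fun s => G (z.1, z.2 + s)) 0 := by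
    refine AnalyticAt.comp (g := G) (f := fun s : ℚ_[p] => (z.1, z.2 + s)) (by simpa using hG) ?_
    exact AnalyticAt.prod analyticAt_const (analyticAt_const.add analyticAt_id)
  obtain ⟨l, u, hu, hu0, he⟩ := hg.exists_eventuallyEq_pow_smul_nonzero_iff.2 h
  refine ⟨l, fun hl => hu0 ?_⟩
  have h1 : ∀ᶠ w in 𝓝 (z.1, (0 : ℚ_[p])), G (z.1, z.2 + w.2) =
      ∑ k ∈ Finset.range l, (0 : ℚ_[p]) * w.2 ^ k + u w.2 * w.2 ^ l := by
    have hc : ContinuousAt (fun w : E × ℚ_[p] => w.2) (z.1, (0 : ℚ_[p])) := by fun_prop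
    filter_upwards [hc.eventually he] with w hw
    rw [hw]; simp [mul_comm]
  have h2 := (iterate_dsnd_taylor l (G := fun w : E × ℚ_[p] => G (z.1, z.2 + w.2)) (x := z.1)
    (a := fun _ _ => 0) (u := fun w => u w.2) (fun _ _ => analyticAt_const)
    (AnalyticAt.comp (g := u) (f := fun w : E × ℚ_[p] => w.2) hu analyticAt_snd) h1).2
  have h3 := iterate_dsnd_affine G (fun _ : E => z.1) (fun _ => 1) (fun _ => z.2) (fun _ => 1) l
    (z.1, 0)
  simp only [one_mul, one_pow, add_zero, Prod.mk.eta, hl] at h3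
  rw [h3] at h2
  exact (mul_eq_zero.1 h2.symm).resolve_left (by exact_mod_cast l.factorial_ne_zero)

lemma unitPi_map_add {a : Fin n → ℚ_[p]} (ha : a ∈ polydisc p n) :
    (unitPi p n).map (fun y => a + y) = unitPi p n := by
  have h := Measure.pi_map_pi (μ := fun _ : Fin n => unitHaar p) (f := fun i t => a i + t)
    (fun i => (measurable_const_add _).aemeasurable)
  simp only [unitHaar_map_add (mem_polydisc.1 ha _)] at h
  exact h

/-- A linear change of coordinates which is a shear in the direction `v`. -/
noncomputable def shear (v : Fin n → ℚ_[p]) (z : (Fin n → ℚ_[p]) × ℚ_[p]) : Fin (n + 1) → ℚ_[p] :=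
  Fin.cons z.2 (z.2 • v + z.1)

lemma measurable_shear (v : Fin n → ℚ_[p]) : Measurable (shear v) := by
  refine measurable_pi_iff.2 fun j => ?_
  refine Fin.cases ?_ (fun j => ?_) j
  · exact measurable_snd
  · exact (measurable_snd.mul_const (v j)).add ((measurable_pi_apply j).comp measurable_fst)

lemma analyticAt_shear (v : Fin n → ℚ_[p]) (z : (Fin n → ℚ_[p]) × ℚ_[p]) :
    AnalyticAt ℚ_[p] (shear v) z := by
  refine analyticAt_pi_iff.2 fun j => ?_
  refine Fin.cases ?_ (fun j => ?_) j
  · exact analyticAt_snd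
  · exact (analyticAt_snd.mul analyticAt_const).add
      (AnalyticAt.comp (g := fun y : Fin n → ℚ_[p] => y j) (f := Prod.fst)
        (analyticOnNhd_coord j univ _ trivial) analyticAt_fst)

lemma map_shear {v : Fin n → ℚ_[p]} (hv : v ∈ polydisc p n) :
    ((unitPi p n).prod (unitHaar p)).map (shear v) = unitPi p (n + 1) := by
  have h1 : MeasurePreserving
      (fun q : ℚ_[p] × (Fin n → ℚ_[p]) => (q.1, q.1 • v + q.2))
      ((unitHaar p).prod (unitPi p n)) ((unitHaar p).prod (unitPi p n)) := by
    refine MeasurePreserving.skew_product (MeasurePreserving.id _)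
      (g := fun (t : ℚ_[p]) (y : Fin n → ℚ_[p]) => t • v + y) ?_ ?_
    · refine measurable_pi_iff.2 fun j => ?_
      exact (measurable_fst.mul_const (v j)).add ((measurable_pi_apply j).comp measurable_snd)
    · filter_upwards [ae_unitHaar] with t ht
      refine unitPi_map_add (mem_polydisc.2 fun j => ?_)
      rw [Pi.smul_apply, smul_eq_mul, norm_mul]
      exact mul_le_one₀ ht (norm_nonneg _) (mem_polydisc.1 hv j)
  have h2 := (measurePreserving_piFinSuccAbove (fun _ : Fin (n + 1) => unitHaar p) 0).symm
  have h3 := (h2.comp h1).comp (Measure.measurePreserving_swap (μ := unitPi p n) (ν := unitHaar p))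
  rw [← show _ = unitPi p (n + 1) from h3.map_eq]
  congr 1
  ext z j
  refine Fin.cases ?_ (fun j => ?_) j
  · rfl
  · simp [shear, MeasurableEquiv.piFinSuccAbove, Fin.insertNthEquiv]

lemma claim_succ (hC : Claim p n) : Claim p (n + 1) := by
  intro ι _ F x hx hF hF0
  obtain ⟨v, hv, hvF⟩ := exists_direction hF hF0
  let z : (Fin n → ℚ_[p]) × ℚ_[p] := (fun j => x j.succ - x 0 * v j, x 0)
  have hx' := mem_polydisc.1 hx
  have hz : z ∈ bidisc p n := by
    refine mem_bidisc.2 ⟨mem_polydisc.2 fun j => ?_, hx' 0⟩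
    refine (norm_sub_le_max' _ _).trans (max_le (hx' _) ?_)
    rw [norm_mul]
    exact mul_le_one₀ (hx' 0) (norm_nonneg _) (mem_polydisc.1 hv j)
  have hzx : ∀ s : ℚ_[p], shear v (z.1, z.2 + s) =
      x + s • (Fin.cons 1 v : Fin (n + 1) → ℚ_[p]) := by
    intro s
    ext j
    refine Fin.cases ?_ (fun j => ?_) j
    · simp [shear, z]
    · simp [shear, z]; ring
  have hzx0 : shear v z = x := by simpa using hzx 0
  have hFz : ∀ i, AnalyticAt ℚ_[p] (fun w => F i (shear v w)) z := fun i =>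
    AnalyticAt.comp (g := F i) (f := shear v) (by rw [hzx0]; exact hF i) (analyticAt_shear v z)
  have hε : ∀ i, ∃ l, dsnd^[l] (fun w => F i (shear v w)) z ≠ 0 := fun i =>
    exists_iterate_dsnd_ne_zero (hFz i) (by simpa only [hzx] using hvF i)
  choose ε hε using hε
  obtain ⟨V, hV, hVc, hVG⟩ := localClaim hC _ ι Empty (fun i w => F i (shear v w)) (fun j => j.elim)
    ε z hz hFz hε le_rfl (fun j => j.elim) (fun j => j.elim)
  let M : (Fin (n + 1) → ℚ_[p]) → (Fin n → ℚ_[p]) × ℚ_[p] :=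
    fun y => (fun j => y j.succ - y 0 * v j, y 0)
  have hM : Continuous M := by fun_prop
  have hMs : ∀ w, M (shear v w) = w := fun w => by
    ext j <;> simp [M, shear]
  have hVM : shear v ⁻¹' (M ⁻¹' V) = V := by
    rw [← preimage_comp, show M ∘ shear v = id from funext hMs, preimage_id]
  refine ⟨M ⁻¹' V, hM.continuousAt.preimage_mem_nhds hV, hVc.preimage hM, ?_⟩
  rw [← map_shear hv, restrict_map (measurable_shear v) (hVc.preimage hM).isOpen.measurableSet, hVM]
  have hs : Continuous (shear v) := continuous_iff_continuousAt.2 fun w =>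
    (analyticAt_shear v w).continuousAt
  refine Good.map hVG MeasurableSet.univ hs.continuousOn fun g hg hP =>
    ⟨mapsTo_univ _ _, fun y hy => (analyticAt_shear v _).comp (hg y hy), hP.1⟩

lemma claim_zero : Claim p 0 := by
  intro ι _ F x hx hF hF0
  refine ⟨univ, univ_mem, isClopen_univ, ?_⟩
  rw [restrict_univ]
  refine Good.mono (unitPi_mem_good_nice one_ne_zero) fun g _ _ i => ?_
  have h : F i x ≠ 0 := fun h => hF0 i (Eventually.of_forall fun y => by
    rw [Subsingleton.elim y x, h])
  exact (Mono.const h).congr fun y _ => by rw [Subsingleton.elim (g y) x]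

/-- Analytic functions with nonzero germ are simultaneously monomialized by a finite family of
analytic charts. -/
theorem claim (n : ℕ) : Claim p n := by
  induction n with
  | zero => exact claim_zero
  | succ n ih => exact claim_succ ih

/-- The backward shift on two-sided real sequences. -/
def shift : Module.End ℝ (ℤ → ℝ) where
  toFun S m := S (m - 1)
  map_add' _ _ := rfl
  map_smul' _ _ := rfl

lemma shift_pow_apply (i : ℕ) (S : ℤ → ℝ) (m : ℤ) : (shift ^ i) S m = S (m - i) := by
  induction i generalizing m with
  | zero => simp
  | succ i ih =>
    rw [pow_succ', Module.End.mul_apply]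
    change (shift ^ i) S (m - 1) = _
    rw [ih]; congr 1; push_cast; ring

lemma aeval_shift_apply (B : Polynomial ℚ) (S : ℤ → ℝ) (m : ℤ) :
    Polynomial.aeval shift B S m =
      ∑ i ∈ Finset.range (B.natDegree + 1), (B.coeff i : ℝ) * S (m - i) := by
  rw [Polynomial.aeval_eq_sum_range, LinearMap.sum_apply, Finset.sum_apply]
  refine Finset.sum_congr rfl fun i _ => ?_
  rw [LinearMap.smul_apply, Pi.smul_apply, shift_pow_apply, Rat.smul_def]

/-- The sequence vanishes from some index on. -/
def EventuallyZero (S : ℤ → ℝ) : Prop := ∃ M, ∀ m ≥ M, S m = 0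

lemma EventuallyZero.add {S T : ℤ → ℝ} (hS : EventuallyZero S) (hT : EventuallyZero T) :
    EventuallyZero (S + T) := by
  obtain ⟨M, hM⟩ := hS
  obtain ⟨M', hM'⟩ := hT
  exact ⟨max M M', fun m hm => by
    rw [Pi.add_apply, hM m (le_of_max_le_left hm), hM' m (le_of_max_le_right hm), add_zero]⟩

lemma EventuallyZero.smul {S : ℤ → ℝ} (hS : EventuallyZero S) (c : ℝ) :
    EventuallyZero (c • S) := by
  obtain ⟨M, hM⟩ := hS
  exact ⟨M, fun m hm => by rw [Pi.smul_apply, hM m hm, smul_zero]⟩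

lemma EventuallyZero.aeval {S : ℤ → ℝ} (hS : EventuallyZero S) (B : Polynomial ℚ) :
    EventuallyZero (Polynomial.aeval shift B S) := by
  obtain ⟨M, hM⟩ := hS
  refine ⟨M + B.natDegree, fun m hm => ?_⟩
  rw [aeval_shift_apply]
  refine Finset.sum_eq_zero fun i hi => ?_
  rw [hM _ (by rw [Finset.mem_range] at hi; omega), mul_zero]

/-- The sequence eventually satisfies a linear recurrence with rational coefficients. -/
def IsRecurrent (S : ℤ → ℝ) : Prop :=
  ∃ B : Polynomial ℚ, B.coeff 0 = 1 ∧ EventuallyZero (Polynomial.aeval shift B S)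

lemma EventuallyZero.isRecurrent {S : ℤ → ℝ} (hS : EventuallyZero S) : IsRecurrent S :=
  ⟨1, by simp, by simpa using hS⟩

lemma IsRecurrent.of_aeval {S : ℤ → ℝ} {B : Polynomial ℚ} (hB : B.coeff 0 = 1)
    (h : IsRecurrent (Polynomial.aeval shift B S)) : IsRecurrent S := by
  obtain ⟨B', hB', h⟩ := h
  exact ⟨B' * B, by rw [Polynomial.mul_coeff_zero, hB, hB', one_mul], by
    rwa [map_mul, Module.End.mul_apply]⟩

lemma IsRecurrent.add {S T : ℤ → ℝ} (hS : IsRecurrent S) (hT : IsRecurrent T) :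
    IsRecurrent (S + T) := by
  obtain ⟨B, hB, hS⟩ := hS
  obtain ⟨B', hB', hT⟩ := hT
  refine ⟨B' * B, by rw [Polynomial.mul_coeff_zero, hB, hB', one_mul], ?_⟩
  rw [map_add]
  refine EventuallyZero.add ?_ ?_
  · rw [map_mul, Module.End.mul_apply]
    exact hS.aeval B'
  · rw [mul_comm, map_mul, Module.End.mul_apply]
    exact hT.aeval B

lemma IsRecurrent.smul {S : ℤ → ℝ} (hS : IsRecurrent S) (c : ℝ) : IsRecurrent (c • S) := by
  obtain ⟨B, hB, hS⟩ := hS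
  exact ⟨B, hB, by rw [map_smul]; exact hS.smul c⟩

lemma IsRecurrent.translate {S : ℤ → ℝ} (hS : IsRecurrent S) (k : ℤ) :
    IsRecurrent fun m => S (m + k) := by
  obtain ⟨B, hB, M, hM⟩ := hS
  refine ⟨B, hB, M - k, fun m hm => ?_⟩
  rw [← hM (m + k) (by omega), aeval_shift_apply, aeval_shift_apply]
  refine Finset.sum_congr rfl fun i _ => ?_
  congr 2; ring

lemma IsRecurrent.const (c : ℝ) : IsRecurrent fun _ => c :=
  ⟨1 - Polynomial.X, by simp, 0, fun m _ => by
    rw [map_sub, map_one, Polynomial.aeval_X]; simp [shift]⟩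

/-- A first-order recurrence in steps of `a` preserves recurrent sequences. -/
lemma IsRecurrent.of_recursion {S T : ℤ → ℝ} (hT : IsRecurrent T) {c : ℝ} {q : ℚ} (hq : q ≠ 1)
    (a : ℕ) (h : ∀ k, S k = c * T k + q * S (k - a)) : IsRecurrent S := by
  rcases Nat.eq_zero_or_pos a with rfl | ha
  · have h' : S = (c / (1 - q)) • T := by
      ext k
      have h1 := h k
      have h2 : (1 - q : ℝ) ≠ 0 := sub_ne_zero.2 (by exact_mod_cast hq.symm)
      simp only [Nat.cast_zero, sub_zero] at h1
      rw [Pi.smul_apply, smul_eq_mul]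
      field_simp
      linarith
    rw [h']
    exact hT.smul _
  · refine IsRecurrent.of_aeval (B := 1 - Polynomial.C q * Polynomial.X ^ a)
      (by simp [ha.ne]) ?_
    have h' : Polynomial.aeval shift (1 - Polynomial.C q * Polynomial.X ^ a) S = c • T := by
      ext k
      rw [← Polynomial.smul_eq_C_mul, map_sub, map_one, map_smul, map_pow, Polynomial.aeval_X,
        LinearMap.sub_apply, LinearMap.smul_apply, Pi.sub_apply, Pi.smul_apply, shift_pow_apply,
        Pi.smul_apply, smul_eq_mul, Rat.smul_def, Module.End.one_apply, h k]
      ring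
    rw [h']
    exact hT.smul _

lemma lintegral_unitHaar_eq_add {F : ℚ_[p] → ℝ≥0∞} (hF : Measurable F) {c : ℝ≥0∞}
    (hc : ∀ t, ‖t‖ = 1 → F t = c) :
    ∫⁻ t, F t ∂(unitHaar p) = unitHaar p {t | ‖t‖ ≤ ‖(p : ℚ_[p])‖}ᶜ * c +
      ‖(p : ℚ_[p])‖ₑ * ∫⁻ t, F (p * t) ∂(unitHaar p) := by
  have hA : MeasurableSet {t : ℚ_[p] | ‖t‖ ≤ ‖(p : ℚ_[p])‖} :=
    measurableSet_norm_le measurable_id measurable_const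
  rw [← lintegral_add_compl F hA, setLIntegral_unitHaar_norm_le norm_p_lt_one.le hF, add_comm]
  congr 1
  rw [mul_comm, ← setLIntegral_const]
  refine lintegral_congr_ae ?_
  filter_upwards [ae_restrict_mem hA.compl, ae_restrict_of_ae ae_unitHaar] with t ht ht1
  refine hc t (le_antisymm ht1 ?_)
  by_contra! h
  exact ht (by simpa using norm_le_of_lt (a := t) (b := 1) (by simpa using h))

/-- A monomial restricted to a sublevel set of another monomial. -/
noncomputable def monOn (α β : Fin n → ℕ) (k : ℤ) : (Fin n → ℚ_[p]) → ℝ≥0∞ :=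
  {y | ‖mon α y‖ ≤ (p : ℝ) ^ (-k)}.indicator fun y => ‖mon β y‖ₑ

lemma measurable_monOn (α β : Fin n → ℕ) (k : ℤ) : Measurable (monOn (p := p) α β k) :=
  (continuous_mon β).measurable.enorm.indicator
    (measurableSet_le (continuous_mon α).measurable.norm measurable_const)

/-- The integral of a monomial over a sublevel set of another monomial. -/
noncomputable def monInt (p : ℕ) [Fact p.Prime] (α β : Fin n → ℕ) (k : ℤ) : ℝ≥0∞ :=
  ∫⁻ y, monOn α β k y ∂(unitPi p n)

lemma monInt_ne_top (α β : Fin n → ℕ) (k : ℤ) : monInt p α β k ≠ ∞ := by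
  have h : monInt p α β k ≤ ∫⁻ _, 1 ∂(unitPi p n) := by
    refine lintegral_mono_ae ?_
    filter_upwards [ae_unitPi] with y hy
    refine (indicator_le_self' (fun _ _ => zero_le) y).trans ?_
    rw [← ofReal_norm, ENNReal.ofReal_le_one]
    exact norm_mon_le_one β hy
  exact ne_top_of_le_ne_top (by simp) h

lemma mon_shear_zero (α : Fin (n + 1) → ℕ) (x : Fin n → ℚ_[p]) (t : ℚ_[p]) :
    mon α (shear 0 (x, t)) = t ^ α 0 * mon (fun j => α j.succ) x := by
  simp [mon, shear, Fin.prod_univ_succ]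

lemma monOn_shear_mul (α β : Fin (n + 1) → ℕ) (k : ℤ) (x : Fin n → ℚ_[p]) (t : ℚ_[p]) :
    monOn α β k (shear 0 (x, (p : ℚ_[p]) * t)) =
      ‖(p : ℚ_[p])‖ₑ ^ β 0 * monOn α β (k - α 0) (shear 0 (x, t)) := by
  have h : ‖mon α (shear 0 (x, (p : ℚ_[p]) * t))‖ ≤ (p : ℝ) ^ (-k) ↔
      ‖mon α (shear 0 (x, t))‖ ≤ (p : ℝ) ^ (-(k - α 0)) := by
    have hp0 : (0 : ℝ) < p := by exact_mod_cast hp.out.pos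
    rw [mon_shear_zero, mon_shear_zero, mul_pow, mul_assoc, norm_mul, norm_natCast_pow,
      show -k = -(α 0 : ℤ) + -(k - α 0) by ring, zpow_add₀ hp0.ne']
    exact mul_le_mul_iff_right₀ (zpow_pos hp0 _)
  simp only [monOn, indicator, mem_ofPred_eq, h]
  split_ifs
  · rw [mon_shear_zero, mon_shear_zero, mul_pow, mul_assoc, enorm_mul, enorm_pow]
  · simp

lemma monOn_shear_unit (α β : Fin (n + 1) → ℕ) (k : ℤ) (x : Fin n → ℚ_[p]) {t : ℚ_[p]}
    (ht : ‖t‖ = 1) :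
    monOn α β k (shear 0 (x, t)) = monOn (fun j => α j.succ) (fun j => β j.succ) k x := by
  have h : ‖t‖ₑ = 1 := by rw [← ofReal_norm, ht, ENNReal.ofReal_one]
  simp [monOn, indicator, mon_shear_zero, ht, h, enorm_mul, enorm_pow]

lemma monInt_succ (α β : Fin (n + 1) → ℕ) (k : ℤ) :
    monInt p α β k = unitHaar p {t | ‖t‖ ≤ ‖(p : ℚ_[p])‖}ᶜ *
      monInt p (fun j => α j.succ) (fun j => β j.succ) k +
      ‖(p : ℚ_[p])‖ₑ ^ (β 0 + 1) * monInt p α β (k - α 0) := by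
  have hm : ∀ k, Measurable fun z : (Fin n → ℚ_[p]) × ℚ_[p] => monOn α β k (shear 0 z) := fun k =>
    (measurable_monOn α β k).comp (measurable_shear 0)
  have h : ∀ k, monInt p α β k =
      ∫⁻ t, ∫⁻ x, monOn α β k (shear 0 (x, t)) ∂(unitPi p n) ∂(unitHaar p) := fun k => by
    rw [monInt, ← map_shear zero_mem_polydisc, lintegral_map (measurable_monOn α β k)
      (measurable_shear 0), lintegral_prod_symm _ (hm k).aemeasurable]
  rw [h k, lintegral_unitHaar_eq_add (hm k).lintegral_prod_left'
    (c := monInt p (fun j => α j.succ) (fun j => β j.succ) k)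
    fun t ht => by simp only [monOn_shear_unit α β k _ ht]; rfl]
  congr 1
  rw [h (k - α 0), pow_succ', mul_assoc, ← lintegral_const_mul _ (hm _).lintegral_prod_left']
  congr 1
  refine lintegral_congr fun t => ?_
  simp only [monOn_shear_mul]
  exact lintegral_const_mul _ ((hm _).comp measurable_prodMk_right)

lemma isRecurrent_monInt (α β : Fin n → ℕ) : IsRecurrent fun k => (monInt p α β k).toReal := by
  induction n with
  | zero =>
    refine EventuallyZero.isRecurrent ⟨1, fun k hk => ?_⟩
    have h : monOn (p := p) α β k = 0 := by
      ext y
      refine indicator_of_notMem (fun h => ?_) _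
      have h1 : (1 : ℝ) < p := by exact_mod_cast hp.out.one_lt
      have h2 : (p : ℝ) ^ (-k) < 1 := zpow_lt_one_of_neg₀ h1 (by omega)
      simp only [mem_ofPred_eq, mon, Finset.univ_eq_empty, Finset.prod_empty, norm_one] at h
      linarith
    simp [monInt, h]
  | succ n ih =>
    refine IsRecurrent.of_recursion (ih (fun j => α j.succ) fun j => β j.succ)
      (c := (unitHaar p {t | ‖t‖ ≤ ‖(p : ℚ_[p])‖}ᶜ).toReal) (q := ((p : ℚ) ^ (β 0 + 1))⁻¹) ?_ (α 0)
      fun k => ?_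
    · rw [Ne, inv_eq_one]
      have h1 : (1 : ℚ) < p := by exact_mod_cast hp.out.one_lt
      exact (one_lt_pow₀ h1 (Nat.succ_ne_zero _)).ne'
    · rw [monInt_succ, ENNReal.toReal_add
        (ENNReal.mul_ne_top (measure_ne_top _ _) (monInt_ne_top _ _ _))
        (ENNReal.mul_ne_top (ENNReal.pow_ne_top enorm_ne_top) (monInt_ne_top _ _ _)),
        ENNReal.toReal_mul, ENNReal.toReal_mul, ENNReal.toReal_pow, toReal_enorm, Padic.norm_p]
      push_cast
      rw [inv_pow]

/-- The measures of the sublevel sets of a function that is pulled back to monomials by the charts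
form a recurrent sequence. -/
lemma Good.isRecurrent {F : (Fin n → ℚ_[p]) → ℚ_[p]} (hF : Continuous F)
    {κ : Measure (Fin n → ℚ_[p])} (hκ : κ ∈ Good n
      fun g : (Fin n → ℚ_[p]) → Fin n → ℚ_[p] => Mono 1 fun y => F (g y)) :
    (∀ s, κ s ≠ ∞) ∧ IsRecurrent fun k => (κ {y | ‖F y‖ ≤ (p : ℝ) ^ (-k)}).toReal := by
  induction hκ using Submodule.span_induction with
  | mem κ hκ =>
    obtain ⟨g, J, hg, ⟨α, u, ⟨-, r, hr, hur⟩, hα⟩, hJ, rfl⟩ := hκ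
    have hJm := hJ.aemeasurable_enorm
    obtain ⟨β, w, ⟨-, r', hr', hwr⟩, hβ⟩ := hJ
    have hgm := aemeasurable_unitPi hg.continuousOn
    obtain ⟨l, hl⟩ : ∃ l : ℤ, r = (p : ℝ) ^ (-l) := by
      have h0 := hur 0 zero_mem_polydisc
      exact ⟨_, h0.symm.trans (Padic.norm_eq_zpow_neg_valuation
        fun h => hr.ne' (by rw [← h0, h, norm_zero]))⟩
    have hp0 : (0 : ℝ) < p := by exact_mod_cast hp.out.pos
    have hle : ∀ y ∈ polydisc p n, ∀ k : ℤ, ‖F (g y)‖ ≤ (p : ℝ) ^ (-k) ↔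
        ‖mon α y‖ ≤ (p : ℝ) ^ (-(k + -l)) := by
      intro y hy k
      rw [show F (g y) = _ from hα y hy, pow_one, norm_mul, hur y hy, hl,
        show -k = -(k + -l) + -l by ring, zpow_add₀ hp0.ne']
      exact mul_le_mul_iff_left₀ (zpow_pos hp0 _)
    have hS : ∀ k : ℤ, MeasurableSet {y | ‖F y‖ ≤ (p : ℝ) ^ (-k)} := fun k =>
      measurableSet_le hF.measurable.norm measurable_const
    have hJn : ∀ y ∈ polydisc p n, ‖J y‖ₑ = ENNReal.ofReal r' * ‖mon β y‖ₑ := fun y hy => by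
      rw [hβ y hy, pow_one, enorm_mul, mul_comm, ← hwr y hy, ofReal_norm]
    have key : ∀ k : ℤ, (((unitPi p n).withDensity fun y => ‖J y‖ₑ).map g)
        {y | ‖F y‖ ≤ (p : ℝ) ^ (-k)} = ENNReal.ofReal r' * monInt p α β (k + -l) := by
      intro k
      have hg' := hgm.mono_ac (withDensity_absolutelyContinuous (unitPi p n) fun y => ‖J y‖ₑ)
      rw [map_apply_of_aemeasurable hg' (hS k), withDensity_apply₀ _
        (hgm.nullMeasurableSet_preimage (hS k)), ← lintegral_indicator₀
        (hgm.nullMeasurableSet_preimage (hS k)), monInt, ← lintegral_const_mul _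
        (measurable_monOn α β _)]
      refine lintegral_congr_ae ?_
      filter_upwards [ae_unitPi] with y hy
      simp only [monOn, indicator, mem_preimage, mem_ofPred_eq, hle y hy]
      split_ifs
      · exact hJn y hy
      · simp
    have hfin : ∫⁻ y, ‖J y‖ₑ ∂(unitPi p n) ≠ ∞ := by
      have h : ∫⁻ y, ‖J y‖ₑ ∂(unitPi p n) ≤ ∫⁻ _, ENNReal.ofReal r' ∂(unitPi p n) := by
        refine lintegral_mono_ae ?_
        filter_upwards [ae_unitPi] with y hy
        rw [hJn y hy, ← ofReal_norm (mon β y)]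
        exact mul_le_of_le_one_right' (ENNReal.ofReal_le_one.2 (norm_mon_le_one β hy))
      exact ne_top_of_le_ne_top (by simp) h
    have := isFiniteMeasure_withDensity hfin
    refine ⟨fun s => measure_ne_top _ s, ?_⟩
    simp only [key, ENNReal.toReal_mul]
    exact ((isRecurrent_monInt α β).translate (-l)).smul _
  | zero => exact ⟨fun s => by simp, by simpa using IsRecurrent.const 0⟩
  | add κ κ' _ _ h h' =>
    refine ⟨fun s => by simpa using ⟨h.1 s, h'.1 s⟩, ?_⟩
    convert h.2.add h'.2 using 1
    ext k
    simp [ENNReal.toReal_add (h.1 _) (h'.1 _)]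
  | smul c κ _ h =>
    refine ⟨fun s => ?_, ?_⟩
    · rw [Measure.smul_apply]
      exact ENNReal.mul_ne_top ENNReal.coe_ne_top (h.1 s)
    · convert h.2.smul c using 1
      ext k
      rw [Measure.smul_apply, ENNReal.smul_def, smul_eq_mul, ENNReal.toReal_mul]
      rfl

lemma coe_eval (f : MvPolynomial (Fin n) ℤ_[p]) (z : Fin n → ℤ_[p]) :
    MvPolynomial.aeval (fun j => (z j : ℚ_[p])) f = ((MvPolynomial.eval z f : ℤ_[p]) : ℚ_[p]) := by
  have h := MvPolynomial.aeval_algebraMap_apply ℚ_[p] z f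
  rwa [MvPolynomial.aeval_eq_eval] at h

lemma analyticAt_aeval (f : MvPolynomial (Fin n) ℤ_[p]) (x : Fin n → ℚ_[p]) :
    AnalyticAt ℚ_[p] (fun y : Fin n → ℚ_[p] => MvPolynomial.aeval y f) x := by
  induction f using MvPolynomial.induction_on with
  | C a => simpa using analyticAt_const
  | add f g hf hg => simpa using hf.fun_add hg
  | mul_X f j hf => simpa using hf.fun_mul (analyticOnNhd_coord j univ x trivial)

lemma continuous_aeval (f : MvPolynomial (Fin n) ℤ_[p]) :
    Continuous fun y : Fin n → ℚ_[p] => MvPolynomial.aeval y f :=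
  continuous_iff_continuousAt.2 fun x => (analyticAt_aeval f x).continuousAt

lemma not_eventually_aeval_eq_zero {f : MvPolynomial (Fin n) ℤ_[p]} (hf : f ≠ 0)
    (x : Fin n → ℚ_[p]) : ¬ ∀ᶠ y in 𝓝 x, MvPolynomial.aeval y f = 0 := by
  intro h
  obtain ⟨ε, hε, h⟩ := Metric.eventually_nhds_iff_ball.1 h
  have haev : ∀ y : Fin n → ℚ_[p],
      MvPolynomial.eval y (MvPolynomial.map (algebraMap ℤ_[p] ℚ_[p]) f) =
      MvPolynomial.aeval y f := fun y => by rw [MvPolynomial.eval_map, MvPolynomial.aeval_def]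
  refine hf (MvPolynomial.map_injective (algebraMap ℤ_[p] ℚ_[p])
    (FaithfulSMul.algebraMap_injective _ _) ?_)
  rw [map_zero]
  refine MvPolynomial.funext_set (fun j => ball (x j) ε)
    (fun j => infinite_of_mem_nhds (x j) (ball_mem_nhds _ hε)) fun y hy => ?_
  rw [haev, map_zero]
  exact h y (by rwa [ball_pi _ hε])

lemma norm_le_pow_iff_toZModPow_eq_zero (m : ℕ) (z : ℤ_[p]) :
    ‖z‖ ≤ (p : ℝ) ^ (-m : ℤ) ↔ PadicInt.toZModPow m z = 0 := by
  rw [PadicInt.norm_le_pow_iff_mem_span_pow, ← PadicInt.ker_toZModPow, RingHom.mem_ker]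

lemma unitHaar_closedBall {c : ℚ_[p]} (hc : ‖c‖ ≤ 1) (m : ℕ) :
    unitHaar p (closedBall c ((p : ℝ) ^ (-m : ℤ))) = ((p : ℝ≥0∞) ^ m)⁻¹ := by
  rw [unitHaar, Measure.restrict_apply measurableSet_closedBall, inter_eq_left.2,
    haar_closedBall_pow]
  intro t ht
  rw [mem_closedBall, dist_eq_norm] at ht
  rw [mem_closedBall_zero_iff, ← sub_add_cancel t c]
  exact (Padic.nonarchimedean _ _).trans (max_le (ht.trans (zpow_neg_natCast_le_one m)) hc)

/-- The measure of the sublevel set of a polynomial counts its zeros modulo a power of `p`. -/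
lemma unitPi_aeval_le (f : MvPolynomial (Fin n) ℤ_[p]) (m : ℕ) :
    unitPi p n {y | ‖MvPolynomial.aeval y f‖ ≤ (p : ℝ) ^ (-m : ℤ)} =
      igusaN p n f m * (((p : ℝ≥0∞) ^ m)⁻¹) ^ n := by
  have : NeZero (p ^ m) := ⟨pow_ne_zero m hp.out.ne_zero⟩
  let Z := {u : Fin n → ZMod (p ^ m) //
    MvPolynomial.eval u (MvPolynomial.map (PadicInt.toZModPow m) f) = 0}
  let B : (Fin n → ZMod (p ^ m)) → Set (Fin n → ℚ_[p]) := fun u =>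
    univ.pi fun j => closedBall (((u j).val : ℕ) : ℚ_[p]) ((p : ℝ) ^ (-m : ℤ))
  have hBp : ∀ u, B u ⊆ polydisc p n := by
    intro u y hy
    refine mem_polydisc.2 fun j => ?_
    have := hy j trivial
    rw [mem_closedBall, dist_eq_norm] at this
    rw [← sub_add_cancel (y j) ((u j).val : ℚ_[p])]
    exact (Padic.nonarchimedean _ _).trans
      (max_le (this.trans (zpow_neg_natCast_le_one m)) (norm_natCast_le_one _))
  have hB : ∀ (z : Fin n → ℤ_[p]) u, (fun j => (z j : ℚ_[p])) ∈ B u ↔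
      (fun j => PadicInt.toZModPow m (z j)) = u := by
    intro z u
    simp only [B, mem_univ_pi, funext_iff]
    refine forall_congr' fun j => ?_
    rw [mem_closedBall, dist_eq_norm, ← sub_eq_zero]
    have h := norm_le_pow_iff_toZModPow_eq_zero m (z j - ((u j).val : ℤ_[p]))
    rw [map_sub, map_natCast, ZMod.natCast_zmod_val] at h
    rw [← h, PadicInt.norm_def]
    push_cast
    rfl
  have hlift : ∀ y ∈ polydisc p n, ∃ z : Fin n → ℤ_[p], (fun j => (z j : ℚ_[p])) = y :=
    fun y hy => ⟨fun j => ⟨y j, mem_polydisc.1 hy j⟩, rfl⟩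
  have hS : {y | ‖MvPolynomial.aeval y f‖ ≤ (p : ℝ) ^ (-m : ℤ)} ∩ polydisc p n =
      ⋃ u : Z, B u.1 := by
    ext y
    rw [mem_inter_iff, mem_iUnion]
    have key : ∀ z : Fin n → ℤ_[p], ‖MvPolynomial.aeval (fun j => (z j : ℚ_[p])) f‖ ≤
        (p : ℝ) ^ (-m : ℤ) ↔ MvPolynomial.eval (fun j => PadicInt.toZModPow m (z j))
          (MvPolynomial.map (PadicInt.toZModPow m) f) = 0 := by
      intro z
      rw [coe_eval, PadicInt.padic_norm_e_of_padicInt, norm_le_pow_iff_toZModPow_eq_zero,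
        MvPolynomial.eval_map, ← MvPolynomial.eval₂_id, MvPolynomial.hom_eval₂]
      rfl
    constructor
    · rintro ⟨h, hy⟩
      obtain ⟨z, rfl⟩ := hlift y hy
      exact ⟨⟨_, (key z).1 h⟩, (hB z _).2 rfl⟩
    · rintro ⟨u, hu⟩
      obtain ⟨z, rfl⟩ := hlift y (hBp _ hu)
      refine ⟨(key z).2 ?_, hBp _ hu⟩
      rw [(hB z _).1 hu]
      exact u.2
  have hdisj : Pairwise (Function.onFun Disjoint fun u : Z => B u.1) := by
    intro u u' huu
    refine Set.disjoint_left.2 fun y hy hy' => huu (Subtype.ext ?_)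
    obtain ⟨z, rfl⟩ := hlift y (hBp _ hy)
    rw [← (hB z _).1 hy, ← (hB z _).1 hy']
  have hBm : ∀ u, unitPi p n (B u) = (((p : ℝ≥0∞) ^ m)⁻¹) ^ n := by
    intro u
    rw [unitPi, Measure.pi_pi]
    simp only [unitHaar_closedBall (norm_natCast_le_one _), Finset.prod_const, Finset.card_univ,
      Fintype.card_fin]
  rw [← measure_inter_conull (t := polydisc p n) (mem_ae_iff.1 ae_unitPi), hS,
    measure_iUnion hdisj fun u => MeasurableSet.univ_pi fun j => measurableSet_closedBall]
  have : Fintype Z := Fintype.ofFinite Z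
  simp only [hBm, tsum_fintype, Finset.sum_const, Finset.card_univ, nsmul_eq_mul, igusaN,
    Nat.card_eq_fintype_card]
  rfl

lemma isRecurrent_unitPi_aeval (f : MvPolynomial (Fin n) ℤ_[p]) :
    IsRecurrent fun k => (unitPi p n {y | ‖MvPolynomial.aeval y f‖ ≤ (p : ℝ) ^ (-k)}).toReal := by
  by_cases hf : f = 0
  · convert IsRecurrent.const 1 using 2 with k
    have h : {y : Fin n → ℚ_[p] | ‖MvPolynomial.aeval y f‖ ≤ (p : ℝ) ^ (-k)} = univ := by
      refine eq_univ_of_forall fun y => ?_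
      rw [mem_ofPred_eq, hf, map_zero, norm_zero]
      positivity
    rw [h, measure_univ, ENNReal.toReal_one]
  · have h := Good.of_local (μ := unitPi p n) (isCompact_polydisc (p := p) (n := n))
      isClopen_polydisc (P := fun g : (Fin n → ℚ_[p]) → Fin n → ℚ_[p] =>
        Mono 1 fun y => MvPolynomial.aeval (g y) f) (fun g g' hg hg' => hg.comp hg') fun x hx => by
        obtain ⟨V, hV, hVc, hG⟩ := claim n Unit (fun _ y => MvPolynomial.aeval y f) x hx
          (fun _ => analyticAt_aeval f x) fun _ => not_eventually_aeval_eq_zero hf x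
        exact ⟨V, hV, hVc, Good.mono hG fun g _ hg => hg ()⟩
    rw [unitPi_restrict_polydisc] at h
    exact (Good.isRecurrent (continuous_aeval f) (Good.mono h fun g _ hg => hg.1)).2

lemma igusaN_eq (f : MvPolynomial (Fin n) ℤ_[p]) (m : ℕ) :
    (igusaN p n f m : ℝ) = ((p : ℝ) ^ n) ^ m *
      (unitPi p n {y | ‖MvPolynomial.aeval y f‖ ≤ (p : ℝ) ^ (-m : ℤ)}).toReal := by
  have hp0 : (p : ℝ) ≠ 0 := by exact_mod_cast hp.out.ne_zero
  rw [unitPi_aeval_le, ENNReal.toReal_mul, ENNReal.toReal_natCast, ENNReal.toReal_pow,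
    ENNReal.toReal_inv, ENNReal.toReal_pow, ENNReal.toReal_natCast, inv_pow, pow_right_comm]
  field_simp

/-- A power series whose coefficients eventually vanish is a polynomial. -/
lemma exists_eq_coe_of_coeff_eq_zero {R : Type*} [CommSemiring R] {Q : PowerSeries R} {M : ℕ}
    (h : ∀ m ≥ M, PowerSeries.coeff m Q = 0) : ∃ A : Polynomial R, Q = A := by
  refine ⟨PowerSeries.trunc M Q, ?_⟩
  ext m
  rw [Polynomial.coeff_coe, PowerSeries.coeff_trunc]
  split_ifs with hm
  · rfl
  · exact h m (not_lt.1 hm)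

end Igusa

/-- (Borevich–Shafarevich conjecture, proved by Igusa.)  The
Igusa Poincaré series `Q(f;t) = ∑_{m≥1} N_m(f) t^m ∈ ℚ[[t]]` is rational: there
are polynomials `A, B ∈ ℚ[t]` with constant term of `B` equal to `1` such that
`B(t) Q(f;t) = A(t)` as formal power series. -/
theorem igusa_poincare_rational (p : ℕ) [Fact p.Prime] (d : ℕ) (hd : 1 ≤ d)
    (f : MvPolynomial (Fin d) ℤ_[p]) :
    ∃ A B : Polynomial ℚ, B.coeff 0 = 1 ∧
      (B : PowerSeries ℚ)
          * PowerSeries.mk (fun m => if m = 0 then 0 else (igusaN p d f m : ℚ))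
        = (A : PowerSeries ℚ) := by
  obtain ⟨B, hB, M, hM⟩ := Igusa.isRecurrent_unitPi_aeval f
  have hB' : ∀ i, (B.comp (Polynomial.C ((p : ℚ) ^ d) * Polynomial.X)).coeff i =
      B.coeff i * ((p : ℚ) ^ d) ^ i := fun i => Polynomial.comp_C_mul_X_coeff
  obtain ⟨A, hA⟩ := Igusa.exists_eq_coe_of_coeff_eq_zero
    (Q := (B.comp (Polynomial.C ((p : ℚ) ^ d) * Polynomial.X) : PowerSeries ℚ) *
      PowerSeries.mk (fun m => if m = 0 then 0 else (igusaN p d f m : ℚ)))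
    (M := M.toNat + B.natDegree + 1) fun m hm => by
      rw [PowerSeries.coeff_mul, Finset.Nat.sum_antidiagonal_eq_sum_range_succ_mk]
      simp only [Polynomial.coeff_coe, PowerSeries.coeff_mk, hB']
      rw [← Finset.sum_subset (s₁ := Finset.range (B.natDegree + 1))
        (Finset.range_subset_range.2 (by omega)) fun i _ hi => by
          rw [Polynomial.coeff_eq_zero_of_natDegree_lt
            (by rw [Finset.mem_range] at hi; omega), zero_mul, zero_mul]]
      have h := hM m (by omega)
      rw [Igusa.aeval_shift_apply] at h
      have h' := congrArg (fun x => ((p : ℝ) ^ d) ^ m * x) h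
      rw [mul_zero, Finset.mul_sum] at h'
      rw [← Rat.cast_inj (α := ℝ), Rat.cast_zero, ← h', Rat.cast_sum]
      refine Finset.sum_congr rfl fun i hi => ?_
      rw [Finset.mem_range] at hi
      have him : i ≤ m := by omega
      rw [if_neg (by omega)]
      push_cast
      rw [Igusa.igusaN_eq, Nat.cast_sub him, ← Nat.sub_add_cancel him, pow_add]
      simp only [Nat.sub_add_cancel him]
      ring
  exact ⟨A, _, by rw [hB', hB, pow_zero, one_mul], hA⟩
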